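/- Assume the Riemann Hypothesis. Let N be a sufficiently large integer and L = log N. Then ∫_{−ξ}^{ξ} | S₁(α) − T₁(α) |² dα ≪ N ξ L² + min( L² / (ξ (log 3ξ)²) , N ξ L⁴ ), uniformly for 1/(2N) ≤ ξ ≤ 1/2. -/

import Mathlib

open Complex MeasureTheory

/-- `S₁(α) = ∑_{n=1}^{N} Λ(n) e(nα)`, with `e(x) = exp(2πix)`. -/
noncomputable def S1 (N : ℕ) (α : ℝ) : ℂ :=
  ∑ n ∈ Finset.Icc 1 N, (ArithmeticFunction.vonMangoldt n : ℂ) *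
    Complex.exp (2 * Real.pi * Complex.I * n * α)

/-- `T₁(α) = ∑_{n=1}^{N} e(nα)`. -/
noncomputable def T1 (N : ℕ) (α : ℝ) : ℂ :=
  ∑ n ∈ Finset.Icc 1 N, Complex.exp (2 * Real.pi * Complex.I * n * α)

open scoped FourierTransform ContDiff

/-- The logarithmic derivative of a zero-free function is controlled by its growth
(via Borel–Carathéodory applied to a branch of its logarithm). -/
lemma norm_logDeriv_le_of_ne_zero {g : ℂ → ℂ} (hg : Differentiable ℂ g) {r R₁ K : ℝ}
    (hr : 0 ≤ r) (hrR : r < R₁) (hne : ∀ s, ‖s‖ ≤ R₁ → g s ≠ 0)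
    (hK : ∀ s, ‖s‖ ≤ R₁ → ‖g s‖ ≤ K) {s : ℂ} (hs : ‖s‖ ≤ r) :
    ‖logDeriv g s‖ ≤ 8 * R₁ / (R₁ - r) ^ 2 * (Real.log (K / ‖g 0‖) + 1) := by
  have hR₁ : 0 < R₁ := lt_of_le_of_lt hr hrR
  have hld : DifferentiableOn ℂ (logDeriv g) (Metric.ball 0 R₁) := by
    intro z hz
    have hz' : ‖z‖ < R₁ := by simpa using hz
    have h1 : DifferentiableAt ℂ (deriv g) z := (hg.analyticAt z).deriv.differentiableAt
    exact (h1.div (hg z) (hne z hz'.le)).differentiableWithinAt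
  obtain ⟨H, hH⟩ := hld.isExactOn_ball
  set h : ℂ → ℂ := fun z => H z - H 0 with hh
  have hder : ∀ z ∈ Metric.ball (0 : ℂ) R₁, HasDerivAt h (logDeriv g z) z := fun z hz =>
    (hH z hz).sub_const _
  have hconst : ∀ z ∈ Metric.ball (0 : ℂ) R₁, g z * exp (-h z) = g 0 := by
    have hd : ∀ z ∈ Metric.ball (0 : ℂ) R₁, HasDerivAt (fun z => g z * exp (-h z)) 0 z := by
      intro z hz
      have hz' : ‖z‖ < R₁ := by simpa using hz
      refine ((hg z).hasDerivAt.fun_mul ((hder z hz).fun_neg.cexp)).congr_deriv ?_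
      have := hne z hz'.le
      rw [logDeriv_apply]
      field_simp
      ring
    intro z hz
    have := Metric.isOpen_ball.is_const_of_deriv_eq_zero (𝕜 := ℂ) (f := fun z => g z * exp (-h z))
      (convex_ball (0 : ℂ) R₁).isPreconnected
      (fun z hz => (hd z hz).differentiableAt.differentiableWithinAt)
      (fun z hz => (hd z hz).deriv) hz (Metric.mem_ball_self hR₁)
    simpa [hh] using this
  have hg0 : 0 < ‖g 0‖ := norm_pos_iff.2 (hne 0 (by simpa using hR₁.le))
  have hKg : ‖g 0‖ ≤ K := hK 0 (by simpa using hR₁.le)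
  have hlog : 0 ≤ Real.log (K / ‖g 0‖) := Real.log_nonneg (by rwa [le_div_iff₀ hg0, one_mul])
  set M : ℝ := Real.log (K / ‖g 0‖) + 1 with hM
  have hMpos : 0 < M := by linarith
  have hre : Set.MapsTo h (Metric.ball 0 R₁) {z | z.re ≤ M} := by
    intro z hz
    have hz' : ‖z‖ < R₁ := by simpa using hz
    have h1 : ‖g z‖ = ‖g 0‖ * Real.exp (h z).re := by
      rw [← hconst z hz, norm_mul, norm_exp, neg_re, mul_assoc, ← Real.exp_add]
      simp
    have h2 : Real.exp (h z).re ≤ K / ‖g 0‖ := by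
      rw [le_div_iff₀ hg0, mul_comm, ← h1]
      exact hK z hz'.le
    have h3 := (Real.le_log_iff_exp_le (div_pos (hg0.trans_le hKg) hg0)).2 h2
    show (h z).re ≤ M
    linarith
  have hhd : DifferentiableOn ℂ h (Metric.ball 0 R₁) := fun z hz =>
    (hder z hz).differentiableAt.differentiableWithinAt
  set ε : ℝ := (R₁ - r) / 2 with hε
  have hεpos : 0 < ε := by rw [hε]; linarith
  have hbd : ∀ z ∈ Metric.closedBall s ε, z ∈ Metric.ball (0 : ℂ) R₁ ∧ ‖z‖ ≤ R₁ - ε := by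
    intro z hz
    have h1 : ‖z - s‖ ≤ ε := by simpa [dist_eq_norm] using hz
    have h2 : ‖z‖ ≤ ‖z - s‖ + ‖s‖ := norm_le_norm_sub_add _ _
    have h3 : ‖z‖ ≤ R₁ - ε := by rw [hε] at *; linarith
    exact ⟨by simp; linarith, h3⟩
  have hsph : ∀ z ∈ Metric.sphere s ε, ‖h z‖ ≤ 2 * M * R₁ / ε := by
    intro z hz
    obtain ⟨h1, h2⟩ := hbd z (Metric.sphere_subset_closedBall hz)
    refine (borelCaratheodory_zero hMpos hhd hre hR₁ h1 (by simp [hh])).trans ?_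
    have h3 : ε ≤ R₁ - ‖z‖ := by linarith
    have h4 : ‖z‖ ≤ R₁ := by linarith
    gcongr
  have hdc : DiffContOnCl ℂ h (Metric.ball s ε) := by
    apply DifferentiableOn.diffContOnCl
    rw [closure_ball _ hεpos.ne']
    exact hhd.mono fun z hz => (hbd z hz).1
  have := norm_deriv_le_of_forall_mem_sphere_norm_le hεpos hdc hsph
  rw [(hder s (hbd s (Metric.mem_closedBall_self hεpos.le)).1).deriv] at this
  refine this.trans (le_of_eq ?_)
  have : R₁ - r ≠ 0 := by linarith
  rw [hε]
  field_simp
  ring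

/-- Dividing out one zero `ρ` by the Blaschke factor of the disc of radius `R`. -/
lemma exists_divide_zero {g : ℂ → ℂ} (hg : Differentiable ℂ g) {R K : ℝ} {ρ : ℂ} (hρ : g ρ = 0)
    (hρR : ‖ρ‖ < R) (hK : ∀ s, ‖s‖ = R → ‖g s‖ ≤ K) :
    ∃ g₁ : ℂ → ℂ, Differentiable ℂ g₁ ∧ (∀ s, ‖s‖ = R → ‖g₁ s‖ ≤ K) ∧
      ∀ s, g s * (R ^ 2 - (starRingEnd ℂ) ρ * s) = g₁ s * (s - ρ) * R := by
  have hR : 0 < R := lt_of_le_of_lt (norm_nonneg _) hρR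
  have hRc : (R : ℂ) ≠ 0 := by exact_mod_cast hR.ne'
  have hds : Differentiable ℂ (dslope g ρ) := by
    rw [← differentiableOn_univ, differentiableOn_dslope Filter.univ_mem]
    exact hg.differentiableOn
  have hmul : ∀ s, g s = dslope g ρ s * (s - ρ) := by
    intro s
    have := sub_smul_dslope g ρ s
    rw [hρ, sub_zero, smul_eq_mul] at this
    rw [← this, mul_comm]
  have key : ∀ s, g s * (R ^ 2 - (starRingEnd ℂ) ρ * s) =
      (dslope g ρ s * (R ^ 2 - (starRingEnd ℂ) ρ * s) / R) * (s - ρ) * R := by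
    intro s
    rw [hmul s]
    field_simp
  refine ⟨fun s => dslope g ρ s * (R ^ 2 - (starRingEnd ℂ) ρ * s) / R, by fun_prop, ?_, key⟩
  intro s hs
  have hsρ : s - ρ ≠ 0 := by
    intro h
    rw [sub_eq_zero.1 h] at hs
    linarith
  have hnorm : ‖(R : ℂ) ^ 2 - (starRingEnd ℂ) ρ * s‖ = R * ‖s - ρ‖ := by
    have h1 : (R : ℂ) ^ 2 = (starRingEnd ℂ) s * s := by
      rw [mul_comm, mul_conj, normSq_eq_norm_sq, hs]; push_cast; ring
    rw [h1, ← sub_mul, norm_mul, ← map_sub, norm_conj, hs, mul_comm]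
  have h2 := congrArg norm (key s)
  rw [norm_mul, hnorm, norm_mul, norm_mul, norm_real, Real.norm_of_nonneg hR.le] at h2
  have h3 : 0 < ‖s - ρ‖ := norm_pos_iff.2 hsρ
  have h4 : ‖g s‖ = ‖dslope g ρ s * (R ^ 2 - (starRingEnd ℂ) ρ * s) / R‖ := by
    have : (R * ‖s - ρ‖) ≠ 0 := by positivity
    apply mul_right_cancel₀ this
    rw [h2]; ring
  show ‖dslope g ρ s * (R ^ 2 - (starRingEnd ℂ) ρ * s) / R‖ ≤ K
  rw [← h4]
  exact hK s hs

/-- Local partial fractions of the logarithmic derivative of an entire function. -/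
lemma exists_zeros_logDeriv_approx {r R₁ R : ℝ} (hr : 0 < r) (hr1 : r < R₁) (hR : R₁ < R) (n : ℕ) :
    ∀ (g : ℂ → ℂ) (K : ℝ), Differentiable ℂ g → g 0 ≠ 0 → (∀ s, ‖s‖ = R → ‖g s‖ ≤ K) →
      K < ‖g 0‖ * (R / R₁) ^ n →
      ∃ Z : Multiset ℂ, Multiset.card Z ≤ n ∧ (∀ ρ ∈ Z, g ρ = 0 ∧ ‖ρ‖ ≤ R₁) ∧
        ∀ s, ‖s‖ ≤ r → g s ≠ 0 →
          ‖logDeriv g s - (Z.map fun ρ => 1 / (s - ρ)).sum‖ ≤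
            8 * R₁ / (R₁ - r) ^ 2 * (Real.log (K / ‖g 0‖) + 1) + n * (1 / (R - r)) := by
  have hR₁ : 0 < R₁ := by linarith
  have hR0 : 0 < R := by linarith
  have hmax : ∀ (g : ℂ → ℂ) (K : ℝ), Differentiable ℂ g → (∀ s, ‖s‖ = R → ‖g s‖ ≤ K) →
      ∀ s, ‖s‖ ≤ R → ‖g s‖ ≤ K := by
    intro g K hg hK s hs
    refine norm_le_of_forall_mem_frontier_norm_le (U := Metric.ball 0 R) Metric.isBounded_ball
      hg.diffContOnCl ?_ ?_
    · intro z hz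
      rw [frontier_ball _ hR0.ne'] at hz
      exact hK z (by simpa using hz)
    · rw [closure_ball _ hR0.ne']
      simpa using hs
  induction n with
  | zero =>
    intro g K hg hg0 hK hlt
    have := hmax g K hg hK 0 (by simpa using hR0.le)
    simp at hlt
    linarith
  | succ n ih =>
    intro g K hg hg0 hK hlt
    have hg0' : 0 < ‖g 0‖ := norm_pos_iff.2 hg0
    have hKg : ‖g 0‖ ≤ K := hmax g K hg hK 0 (by simpa using hR0.le)
    by_cases hz : ∃ ρ, ‖ρ‖ ≤ R₁ ∧ g ρ = 0
    · obtain ⟨ρ, hρ1, hρ⟩ := hz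
      have hρR : ‖ρ‖ < R := by linarith
      obtain ⟨g₁, hg₁, hK₁, hmul⟩ := exists_divide_zero hg hρ hρR hK
      have hRc : (R : ℂ) ≠ 0 := by exact_mod_cast hR0.ne'
      have hρ0 : 0 < ‖ρ‖ := by
        rw [norm_pos_iff]; rintro rfl; exact hg0 hρ
      have h0 : ‖g 0‖ * R = ‖g₁ 0‖ * ‖ρ‖ := by
        have := congrArg norm (hmul 0)
        simp only [mul_zero, sub_zero, zero_sub, norm_mul, norm_pow, norm_neg, norm_real,
          Real.norm_of_nonneg hR0.le] at this
        have h2 : (‖g 0‖ * R) * R = (‖g₁ 0‖ * ‖ρ‖) * R := by rw [← this]; ring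
        exact mul_right_cancel₀ hR0.ne' h2
      have h1 : ‖g 0‖ * (R / R₁) ≤ ‖g₁ 0‖ := by
        rw [← mul_div_assoc, div_le_iff₀ hR₁, h0]
        gcongr
      have h2 : ‖g 0‖ ≤ ‖g₁ 0‖ := by
        refine le_trans ?_ h1
        have : 1 ≤ R / R₁ := by rw [le_div_iff₀ hR₁]; linarith
        nlinarith
      have hg₁0 : g₁ 0 ≠ 0 := by
        rw [← norm_pos_iff]; linarith
      obtain ⟨Z, hZc, hZ, hZs⟩ := ih g₁ K hg₁ hg₁0 hK₁ (by
        refine hlt.trans_le ?_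
        rw [pow_succ']
        calc ‖g 0‖ * (R / R₁ * (R / R₁) ^ n) = (‖g 0‖ * (R / R₁)) * (R / R₁) ^ n := by ring
          _ ≤ _ := by gcongr)
      have hden : ∀ s, ‖s‖ < R → R * (R - ‖s‖) ≤ ‖(R : ℂ) ^ 2 - (starRingEnd ℂ) ρ * s‖ := by
        intro s hs
        have h5 := norm_sub_norm_le ((R : ℂ) ^ 2) ((starRingEnd ℂ) ρ * s)
        rw [norm_mul, norm_conj, norm_pow, norm_real, Real.norm_of_nonneg hR0.le] at h5
        have : ‖ρ‖ * ‖s‖ ≤ R * ‖s‖ := by gcongr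
        nlinarith
      have hden0 : ∀ s, ‖s‖ < R → (R : ℂ) ^ 2 - (starRingEnd ℂ) ρ * s ≠ 0 := by
        intro s hs
        rw [← norm_pos_iff]
        refine lt_of_lt_of_le ?_ (hden s hs)
        have : 0 < R - ‖s‖ := by linarith
        positivity
      refine ⟨ρ ::ₘ Z, by simpa using hZc, ?_, ?_⟩
      · intro ρ' hρ'
        rcases Multiset.mem_cons.1 hρ' with rfl | h
        · exact ⟨hρ, hρ1⟩
        · obtain ⟨h5, h6⟩ := hZ ρ' h
          refine ⟨?_, h6⟩
          have h7 := hmul ρ'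
          rw [h5, zero_mul, zero_mul] at h7
          exact (mul_eq_zero.1 h7).resolve_right (hden0 ρ' (by linarith))
      · intro s hs hgs
        have hsR : ‖s‖ < R := by linarith
        have hg₁s : g₁ s ≠ 0 := by
          intro h
          have h7 := hmul s
          rw [h, zero_mul, zero_mul] at h7
          exact (mul_ne_zero hgs (hden0 s hsR)) h7
        have hsρ : s - ρ ≠ 0 := by
          intro h
          rw [sub_eq_zero.1 h] at hgs
          exact hgs hρ
        have hld : logDeriv g s = logDeriv g₁ s + 1 / (s - ρ) +
            (starRingEnd ℂ) ρ / ((R : ℂ) ^ 2 - (starRingEnd ℂ) ρ * s) := by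
          have e1 : HasDerivAt (fun s => g s * ((R : ℂ) ^ 2 - (starRingEnd ℂ) ρ * s))
              (deriv g s * ((R : ℂ) ^ 2 - (starRingEnd ℂ) ρ * s) + g s * (- (starRingEnd ℂ) ρ)) s := by
            have := ((hasDerivAt_id' s).const_mul ((starRingEnd ℂ) ρ)).const_sub ((R : ℂ) ^ 2)
            exact ((hg s).hasDerivAt.fun_mul this).congr_deriv (by simp)
          have e2 : HasDerivAt (fun s => g₁ s * (s - ρ) * R)
              ((deriv g₁ s * (s - ρ) + g₁ s * 1) * R) s :=
            ((hg₁ s).hasDerivAt.mul ((hasDerivAt_id s).sub_const ρ)).mul_const _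
          have e3 : (fun s => g s * ((R : ℂ) ^ 2 - (starRingEnd ℂ) ρ * s)) =
              fun s => g₁ s * (s - ρ) * R := funext hmul
          rw [e3] at e1
          have e4 := e1.unique e2
          have e5 := hmul s
          have hd := hden0 s hsR
          rw [logDeriv_apply, logDeriv_apply]
          set d := (R : ℂ) ^ 2 - (starRingEnd ℂ) ρ * s with hdd
          have e6 : g s = g₁ s * (s - ρ) * R / d := by rw [eq_div_iff hd, e5]
          have e7 : deriv g s = ((deriv g₁ s * (s - ρ) + g₁ s * 1) * R + g s * (starRingEnd ℂ) ρ) / d := by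
            rw [eq_div_iff hd, ← e4]; ring
          rw [e7, e6]
          field_simp
        have hbl : ‖(starRingEnd ℂ) ρ / ((R : ℂ) ^ 2 - (starRingEnd ℂ) ρ * s)‖ ≤ 1 / (R - r) := by
          rw [norm_div, norm_conj]
          have h8 : R * (R - r) ≤ ‖(R : ℂ) ^ 2 - (starRingEnd ℂ) ρ * s‖ := by
            refine le_trans ?_ (hden s hsR)
            gcongr
          have h9 : 0 < R - r := by linarith
          calc ‖ρ‖ / ‖(R : ℂ) ^ 2 - (starRingEnd ℂ) ρ * s‖ ≤ R / (R * (R - r)) := by gcongr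
            _ = 1 / (R - r) := by field_simp
        have h10 := hZs s hs hg₁s
        rw [Multiset.map_cons, Multiset.sum_cons, hld]
        have h11 : logDeriv g₁ s + 1 / (s - ρ) +
            (starRingEnd ℂ) ρ / ((R : ℂ) ^ 2 - (starRingEnd ℂ) ρ * s) -
            (1 / (s - ρ) + (Multiset.map (fun ρ => 1 / (s - ρ)) Z).sum) =
            (logDeriv g₁ s - (Multiset.map (fun ρ => 1 / (s - ρ)) Z).sum) +
            (starRingEnd ℂ) ρ / ((R : ℂ) ^ 2 - (starRingEnd ℂ) ρ * s) := by ring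
        rw [h11]
        refine (norm_add_le _ _).trans ?_
        have h12 : Real.log (K / ‖g₁ 0‖) ≤ Real.log (K / ‖g 0‖) := by
          apply Real.log_le_log
          · have : 0 < ‖g₁ 0‖ := by linarith
            have : 0 < K := by linarith
            positivity
          · have : 0 ≤ K := by linarith
            gcongr
        have h13 : 8 * R₁ / (R₁ - r) ^ 2 * (Real.log (K / ‖g₁ 0‖) + 1) ≤
            8 * R₁ / (R₁ - r) ^ 2 * (Real.log (K / ‖g 0‖) + 1) := by gcongr
        push_cast
        linarith
    · push Not at hz
      refine ⟨0, by simp, by simp, ?_⟩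
      intro s hs hgs
      have h1 := norm_logDeriv_le_of_ne_zero hg hr.le hr1 hz
        (fun s hs => hmax g K hg hK s (by linarith)) hs
      have h2 : 0 ≤ ((n + 1 : ℕ) : ℝ) * (1 / (R - r)) := by
        have : 0 < R - r := by linarith
        positivity
      simp only [Multiset.map_zero, Multiset.sum_zero, sub_zero]
      linarith

/-- A locally dominated parameter integral of holomorphic functions is holomorphic. -/
lemma differentiableOn_integral_of_locally_dominated {X : Type*} [MeasurableSpace X]
    {μ : Measure X} {U : Set ℂ} (hU : IsOpen U) {F : ℂ → X → ℂ}
    (hmeas : ∀ z ∈ U, AEStronglyMeasurable (F z) μ)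
    (hdiff : ∀ᵐ x ∂μ, DifferentiableOn ℂ (fun z => F z x) U)
    (hbound : ∀ z₀ ∈ U, ∃ V ∈ nhds z₀, ∃ b : X → ℝ, Integrable b μ ∧
      ∀ᵐ x ∂μ, ∀ z ∈ V, ‖F z x‖ ≤ b x) :
    DifferentiableOn ℂ (fun z => ∫ x, F z x ∂μ) U := by
  intro z₀ hz₀
  obtain ⟨V, hV, b, hb, hFb⟩ := hbound z₀ hz₀
  obtain ⟨ε, hε, hεV⟩ := Metric.mem_nhds_iff.1 (Filter.inter_mem hV (hU.mem_nhds hz₀))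
  have hsub : ∀ z ∈ Metric.ball z₀ (ε / 2), Metric.closedBall z (ε / 4) ⊆ V ∩ U := by
    intro z hz w hw
    apply hεV
    rw [Metric.mem_ball] at *
    rw [Metric.mem_closedBall] at hw
    have := dist_triangle w z z₀
    linarith
  have hself : ∀ z ∈ Metric.ball z₀ (ε / 2), z ∈ V ∩ U := fun z hz =>
    hsub z hz (Metric.mem_closedBall_self (by positivity))
  have hz₀b : z₀ ∈ Metric.ball z₀ (ε / 2) := Metric.mem_ball_self (by positivity)
  have hder : ∀ᵐ x ∂μ, ∀ z ∈ Metric.ball z₀ (ε / 2),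
      HasDerivAt (fun z => F z x) (deriv (fun z => F z x) z) z := by
    filter_upwards [hdiff] with x hx z hz
    exact ((hx z (hself z hz).2).differentiableAt (hU.mem_nhds (hself z hz).2)).hasDerivAt
  have hF' : AEStronglyMeasurable (fun x => deriv (fun z => F z x) z₀) μ := by
    set u : ℕ → ℂ := fun n => ((ε / 4 : ℝ) : ℂ) * (1 / ((n : ℂ) + 1)) with hu
    have hu0 : Filter.Tendsto u Filter.atTop (nhds 0) := by
      have := (tendsto_one_div_add_atTop_nhds_zero_nat (𝕜 := ℂ)).const_mul ((ε / 4 : ℝ) : ℂ)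
      rwa [mul_zero] at this
    have hune : ∀ n, u n ≠ 0 := by
      intro n
      have : (n : ℂ) + 1 ≠ 0 := by exact_mod_cast n.succ_ne_zero
      have h4 : ((ε / 4 : ℝ) : ℂ) ≠ 0 := by exact_mod_cast (by positivity : ε / 4 ≠ 0)
      exact mul_ne_zero h4 (one_div_ne_zero this)
    have hun : ∀ n, z₀ + u n ∈ U := by
      intro n
      refine (hsub z₀ hz₀b ?_).2
      rw [Metric.mem_closedBall, dist_eq_norm, add_sub_cancel_left, hu]
      have : ‖(n : ℂ) + 1‖ = n + 1 := by
        rw [← Nat.cast_succ, Complex.norm_natCast]; push_cast; rfl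
      rw [norm_mul, norm_real, Real.norm_of_nonneg (by positivity), norm_div, norm_one, this]
      have : 1 / ((n : ℝ) + 1) ≤ 1 := by
        rw [div_le_one (by positivity)]; linarith [(Nat.cast_nonneg n : (0 : ℝ) ≤ n)]
      nlinarith
    refine aestronglyMeasurable_of_tendsto_ae Filter.atTop
      (f := fun n x => (u n)⁻¹ • (F (z₀ + u n) x - F z₀ x))
      (fun n => ((hmeas _ (hun n)).sub (hmeas _ hz₀)).const_smul (u n)⁻¹) ?_
    filter_upwards [hder] with x hx
    refine (hasDerivAt_iff_tendsto_slope_zero.1 (hx z₀ hz₀b)).comp ?_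
    exact tendsto_nhdsWithin_iff.2 ⟨hu0, Filter.Eventually.of_forall hune⟩
  refine (hasDerivAt_integral_of_dominated_loc_of_deriv_le (μ := μ) (F := F)
    (F' := fun z x => deriv (fun z => F z x) z) (x₀ := z₀) (s := Metric.ball z₀ (ε / 2))
    (bound := fun x => b x / (ε / 4)) (Metric.ball_mem_nhds _ (by positivity)) ?_ ?_ hF' ?_
    (hb.div_const _) ?_).2.differentiableAt.differentiableWithinAt
  · filter_upwards [hU.mem_nhds hz₀] with z hz using hmeas z hz
  · refine hb.mono' (hmeas _ hz₀) ?_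
    filter_upwards [hFb] with x hx using hx z₀ (hself z₀ hz₀b).1
  · filter_upwards [hFb, hdiff] with x hx hd z hz
    refine norm_deriv_le_of_forall_mem_sphere_norm_le (by positivity) ?_ ?_
    · apply DifferentiableOn.diffContOnCl
      rw [closure_ball _ (by positivity)]
      exact hd.mono fun w hw => (hsub z hz hw).2
    · intro w hw
      exact hx w (hsub z hz (Metric.sphere_subset_closedBall hw)).1
  · filter_upwards [hder] with x hx using hx

lemma isPreconnected_re_gt (a : ℝ) : IsPreconnected {s : ℂ | a < s.re} :=
  (convex_halfSpace_re_gt a).isPreconnected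

lemma norm_fract_mul_cpow_le {t : ℝ} (ht : t ∈ Set.Ioi (1 : ℝ)) {s : ℂ} {a : ℝ} (ha : a ≤ s.re) :
    ‖((Int.fract t : ℝ) : ℂ) * (t : ℂ) ^ (-(s + 1))‖ ≤ t ^ (-(a + 1)) := by
  have ht' : (1 : ℝ) < t := ht
  rw [norm_mul, norm_real, Real.norm_of_nonneg (Int.fract_nonneg t),
    norm_cpow_eq_rpow_re_of_pos (by linarith)]
  have h1 : t ^ (-(s + 1)).re ≤ t ^ (-(a + 1)) :=
    Real.rpow_le_rpow_of_exponent_le ht'.le (by simp; linarith)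
  have h2 := (Int.fract_lt_one t).le
  have h3 : 0 ≤ t ^ (-(s + 1)).re := by positivity
  nlinarith

lemma integrableOn_fract_mul_cpow {s : ℂ} (hs : 0 < s.re) :
    IntegrableOn (fun t : ℝ => ((Int.fract t : ℝ) : ℂ) * (t : ℂ) ^ (-(s + 1))) (Set.Ioi 1) := by
  refine Integrable.mono' (integrableOn_Ioi_rpow_of_lt (a := -(s.re + 1)) (by linarith)
    zero_lt_one) ?_ ?_
  · refine AEStronglyMeasurable.mul ?_ ?_
    · exact (Complex.measurable_ofReal.comp measurable_fract).aestronglyMeasurable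
    · refine ContinuousOn.aestronglyMeasurable (fun t ht => ?_) measurableSet_Ioi
      exact (continuousAt_ofReal_cpow_const _ _
        (Or.inr (zero_lt_one.trans ht).ne')).continuousWithinAt
  · filter_upwards [ae_restrict_mem measurableSet_Ioi] with t ht
    exact norm_fract_mul_cpow_le ht le_rfl

lemma differentiableOn_integral_fract :
    DifferentiableOn ℂ (fun s : ℂ => ∫ t in Set.Ioi (1 : ℝ), ((Int.fract t : ℝ) : ℂ) *
      (t : ℂ) ^ (-(s + 1))) {s | 0 < s.re} := by
  refine differentiableOn_integral_of_locally_dominated (isOpen_lt continuous_const continuous_re)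
    (fun z hz => (integrableOn_fract_mul_cpow hz).1) ?_ ?_
  · filter_upwards [ae_restrict_mem measurableSet_Ioi] with t ht
    have : (t : ℂ) ≠ 0 := by exact_mod_cast (zero_lt_one.trans ht).ne'
    have hd : Differentiable ℂ (fun z : ℂ => ((Int.fract t : ℝ) : ℂ) * (t : ℂ) ^ (-(z + 1))) :=
      ((((differentiable_id.add_const (1 : ℂ)).neg).const_cpow (Or.inl this))).const_mul _
    exact hd.differentiableOn
  · intro z₀ hz₀
    have hz₀' : 0 < z₀.re := hz₀
    refine ⟨{s | z₀.re / 2 < s.re}, (isOpen_lt continuous_const continuous_re).mem_nhds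
      (by simpa using hz₀'), fun t => t ^ (-(z₀.re / 2 + 1)),
      integrableOn_Ioi_rpow_of_lt (by linarith) zero_lt_one, ?_⟩
    filter_upwards [ae_restrict_mem measurableSet_Ioi] with t ht z hz
    exact norm_fract_mul_cpow_le ht (le_of_lt hz)

lemma riemannZeta₁_eq_integral {s : ℂ} (hs : 0 < s.re) :
    riemannZeta₁ s = s - (s - 1) * s * ∫ t in Set.Ioi (1 : ℝ), ((Int.fract t : ℝ) : ℂ) *
      (t : ℂ) ^ (-(s + 1)) := by
  have hopen : IsOpen {s : ℂ | 0 < s.re} := isOpen_lt continuous_const continuous_re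
  have h1 : AnalyticOnNhd ℂ riemannZeta₁ {s | 0 < s.re} :=
    differentiable_riemannZeta₁.differentiableOn.analyticOnNhd hopen
  have h2 : AnalyticOnNhd ℂ (fun s : ℂ => s - (s - 1) * s * ∫ t in Set.Ioi (1 : ℝ),
      ((Int.fract t : ℝ) : ℂ) * (t : ℂ) ^ (-(s + 1))) {s | 0 < s.re} := by
    refine DifferentiableOn.analyticOnNhd ?_ hopen
    exact differentiableOn_id.sub (((differentiableOn_id.sub_const _).mul differentiableOn_id).mul
      differentiableOn_integral_fract)
  refine h1.eqOn_of_preconnected_of_eventuallyEq h2 (isPreconnected_re_gt 0) (z₀ := 2)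
    (by simp) ?_ hs
  filter_upwards [(isOpen_lt continuous_const continuous_re).mem_nhds
    (show (2 : ℂ) ∈ {s : ℂ | 1 < s.re} by simp)] with z hz
  have hz1 : 1 < z.re := hz
  have hzne : z - 1 ≠ 0 := by
    intro h
    rw [sub_eq_zero.1 h] at hz1
    simp at hz1
  have hz0 : z ≠ 0 := by
    rintro rfl
    simp at hz1
    linarith
  have e1 : riemannZeta z = z * ∫ t in Set.Ioi (1 : ℝ),
      (∑ k ∈ Finset.Icc 1 ⌊t⌋₊, (1 : ℂ)) * t ^ (-(z + 1)) := by
    rw [← LSeries_one_eq_riemannZeta hz1]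
    refine LSeries_eq_mul_integral 1 (r := 1) zero_le_one hz1 (LSeriesSummable_one_iff.2 hz1) ?_
    refine Asymptotics.isBigO_of_le _ fun n => ?_
    simp
  have e2 : ∫ t in Set.Ioi (1 : ℝ), (∑ k ∈ Finset.Icc 1 ⌊t⌋₊, (1 : ℂ)) * (t : ℂ) ^ (-(z + 1)) =
      (∫ t in Set.Ioi (1 : ℝ), (t : ℂ) ^ (-z)) -
        ∫ t in Set.Ioi (1 : ℝ), ((Int.fract t : ℝ) : ℂ) * (t : ℂ) ^ (-(z + 1)) := by
    rw [← integral_sub]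
    · refine setIntegral_congr_fun measurableSet_Ioi fun t ht => ?_
      have ht0 : 0 < t := zero_lt_one.trans ht
      have h3 : (t : ℂ) ≠ 0 := by exact_mod_cast ht0.ne'
      have h4 : ((⌊t⌋₊ : ℝ)) = t - Int.fract t := by
        rw [natCast_floor_eq_intCast_floor ht0.le, ← Int.self_sub_fract]
      have h5 : (⌊t⌋₊ : ℂ) = t - Int.fract t := by
        exact_mod_cast congrArg (fun x : ℝ => (x : ℂ)) h4
      have h6 : (t : ℂ) ^ (-z) = t * (t : ℂ) ^ (-(z + 1)) := by
        rw [show -z = 1 + -(z + 1) by ring, cpow_add _ _ h3, cpow_one]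
      simp only [Finset.sum_const, Nat.card_Icc, add_tsub_cancel_right, nsmul_eq_mul, mul_one]
      rw [h5, h6]
      ring
    · exact integrableOn_Ioi_cpow_of_lt (by simpa using hz1) zero_lt_one
    · exact integrableOn_fract_mul_cpow (by linarith)
  rw [integral_Ioi_cpow_of_lt (by simpa using hz1) zero_lt_one] at e2
  have e3 : riemannZeta z = (z - 1)⁻¹ * riemannZeta₁ z :=
    riemannZeta_eq_inv_sub_mul (by intro h; simp [h] at hzne)
  rw [e2, e3] at e1
  have e4 : -z + 1 ≠ 0 := by
    intro h; apply hzne; linear_combination -h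
  simp only [ofReal_one, one_cpow] at e1
  rw [inv_mul_eq_iff_eq_mul₀ hzne] at e1
  rw [e1]
  field_simp
  ring

lemma norm_riemannZeta₁_le {s : ℂ} (hs : 1 / 5 ≤ s.re) :
    ‖riemannZeta₁ s‖ ≤ ‖s‖ + 5 * ‖s - 1‖ * ‖s‖ := by
  have h0 : ‖∫ t in Set.Ioi (1 : ℝ), ((Int.fract t : ℝ) : ℂ) * (t : ℂ) ^ (-(s + 1))‖ ≤ 5 := by
    have h1 : ∀ᵐ t ∂(volume.restrict (Set.Ioi (1 : ℝ))),
        ‖((Int.fract t : ℝ) : ℂ) * (t : ℂ) ^ (-(s + 1))‖ ≤ t ^ (-(1 / 5 + 1) : ℝ) := by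
      filter_upwards [ae_restrict_mem measurableSet_Ioi] with t ht
      exact norm_fract_mul_cpow_le ht hs
    refine (norm_integral_le_of_norm_le (integrableOn_Ioi_rpow_of_lt (by norm_num)
      zero_lt_one) h1).trans ?_
    rw [integral_Ioi_rpow_of_lt (by norm_num) zero_lt_one]
    norm_num
  rw [riemannZeta₁_eq_integral (by linarith)]
  refine (norm_sub_le _ _).trans ?_
  rw [norm_mul, norm_mul]
  have : 0 ≤ ‖s - 1‖ * ‖s‖ := by positivity
  nlinarith

lemma norm_riemannZeta₁_ge {s : ℂ} (hs : s.re = 2) : 1 / 3 ≤ ‖riemannZeta₁ s‖ := by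
  have hs1 : 1 < s.re := by linarith
  have hne : s - 1 ≠ 0 := by
    intro h
    have := congrArg re h
    simp [hs] at this
    linarith
  have h1 : riemannZeta s = ∑' n : ℕ, 1 / (n + 1 : ℂ) ^ s := zeta_eq_tsum_one_div_nat_add_one_cpow hs1
  have hnorm : ∀ n : ℕ, ‖1 / (n + 1 : ℂ) ^ s‖ = 1 / (n + 1 : ℝ) ^ 2 := by
    intro n
    have : ((n + 1 : ℝ) : ℂ) = (n : ℂ) + 1 := by push_cast; rfl
    rw [norm_div, norm_one, ← this, norm_cpow_eq_rpow_re_of_pos (by positivity), hs]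
    norm_num
  have hsum2 : HasSum (fun n : ℕ => 1 / (n + 1 : ℝ) ^ 2) (Real.pi ^ 2 / 6) := by
    have := (hasSum_nat_add_iff' (f := fun n : ℕ => 1 / (n : ℝ) ^ 2) 1).2 hasSum_zeta_two
    simpa using this
  have hsumm : Summable fun n : ℕ => 1 / (n + 1 : ℂ) ^ s := by
    refine Summable.of_norm ?_
    simp_rw [hnorm]
    exact hsum2.summable
  have htail : HasSum (fun n : ℕ => 1 / ((n + 1 : ℕ) + 1 : ℝ) ^ 2) (Real.pi ^ 2 / 6 - 1) := by
    have := (hasSum_nat_add_iff' (f := fun n : ℕ => 1 / (n + 1 : ℝ) ^ 2) 1).2 hsum2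
    simpa using this
  have h2 : ‖riemannZeta s - 1‖ ≤ Real.pi ^ 2 / 6 - 1 := by
    rw [h1, hsumm.tsum_eq_zero_add]
    simp only [Nat.cast_zero, zero_add, one_cpow, div_one, add_sub_cancel_left]
    refine (tsum_of_norm_bounded htail fun n => ?_)
    rw [hnorm]
  have h3 : 1 / 3 ≤ ‖riemannZeta s‖ := by
    have h4 := norm_sub_norm_le (1 : ℂ) (1 - riemannZeta s)
    rw [sub_sub_cancel, norm_one, ← norm_neg (1 - riemannZeta s), neg_sub] at h4
    have := Real.pi_lt_d2
    have := Real.pi_pos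
    nlinarith
  have e3 : riemannZeta s = (s - 1)⁻¹ * riemannZeta₁ s :=
    riemannZeta_eq_inv_sub_mul (by intro h; simp [h] at hne)
  have h5 : 1 ≤ ‖s - 1‖ := by
    refine le_trans ?_ (abs_re_le_norm _)
    simp [hs]
    norm_num
  rw [e3, norm_mul, norm_inv] at h3
  have h6 : ‖s - 1‖⁻¹ ≤ 1 := inv_le_one_of_one_le₀ h5
  have := norm_nonneg (riemannZeta₁ s)
  nlinarith

lemma one_le_log_abs_add_four (t : ℝ) : 1 ≤ Real.log (|t| + 4) := by
  rw [Real.le_log_iff_exp_le (by positivity)]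
  have := Real.exp_one_lt_d9
  have := abs_nonneg t
  linarith

lemma riemannZeta₁_ne_zero_or (hRH : RiemannHypothesis) {s : ℂ} (hs : 0 < s.re)
    (h : riemannZeta₁ s = 0) : s.re = 1 / 2 := by
  have h1 : s ≠ 1 := by
    rintro rfl
    simp at h
  refine hRH s ?_ ?_ h1
  · rw [riemannZeta_eq_inv_sub_mul h1, h, mul_zero]
  · rintro ⟨n, hn⟩
    rw [hn] at hs
    simp at hs
    have : (0 : ℝ) ≤ n := n.cast_nonneg
    linarith

lemma riemannZeta₁_ne_zero (hRH : RiemannHypothesis) {s : ℂ} (hs : 1 / 2 < s.re) :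
    riemannZeta₁ s ≠ 0 := by
  intro h
  have := riemannZeta₁_ne_zero_or hRH (by linarith) h
  linarith

lemma exists_zeros_logDeriv_riemannZeta₁ (hRH : RiemannHypothesis) :
    ∃ C > (0 : ℝ), ∀ t₀ : ℝ, ∃ Z : Multiset ℝ, (Multiset.card Z : ℝ) ≤ C * Real.log (|t₀| + 4) ∧
      ∀ s : ℂ, ‖s - (2 + t₀ * I)‖ ≤ 8 / 5 → 1 / 2 < s.re →
        ‖logDeriv riemannZeta₁ s - (Z.map fun γ : ℝ => 1 / (s - (1 / 2 + γ * I))).sum‖ ≤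
          C * Real.log (|t₀| + 4) := by
  set q : ℝ := Real.log (18 / 17) with hq
  have hqpos : 0 < q := Real.log_pos (by norm_num)
  have hpos : 0 < 5 / q + 2 := by positivity
  refine ⟨1360 * 6 + 5 * (5 / q + 2), by positivity, fun t₀ => ?_⟩
  set ℓ := Real.log (|t₀| + 4) with hℓ
  have hℓ1 : 1 ≤ ℓ := one_le_log_abs_add_four t₀
  set g : ℂ → ℂ := fun z => riemannZeta₁ ((2 + t₀ * I) + z) with hg
  have hgd : Differentiable ℂ g := differentiable_riemannZeta₁.comp (by fun_prop)
  have hg0 : 1 / 3 ≤ ‖g 0‖ := norm_riemannZeta₁_ge (by simp)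
  set x := |t₀| + 4 with hx
  have hx4 : 4 ≤ x := by have := abs_nonneg t₀; linarith
  set K : ℝ := 6 * x ^ 2 with hK
  have hKg : ∀ s, ‖s‖ = 9 / 5 → ‖g s‖ ≤ K := by
    intro s hs
    have hre : |s.re| ≤ 9 / 5 := hs ▸ abs_re_le_norm s
    have h1 : 1 / 5 ≤ (2 + t₀ * I + s).re := by
      have := (abs_le.1 hre).1
      simp
      linarith
    refine (norm_riemannZeta₁_le h1).trans ?_
    have h2 : ‖2 + t₀ * I + s‖ ≤ x := by
      refine (norm_add_le _ _).trans ?_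
      have : ‖(2 : ℂ) + t₀ * I‖ ≤ 2 + |t₀| := by
        refine (norm_add_le _ _).trans ?_
        simp
      rw [hs]; linarith
    have h3 : ‖2 + t₀ * I + s - 1‖ ≤ x := by
      rw [show 2 + t₀ * I + s - 1 = 1 + t₀ * I + s by ring]
      refine (norm_add_le _ _).trans ?_
      have : ‖(1 : ℂ) + t₀ * I‖ ≤ 1 + |t₀| := by
        refine (norm_add_le _ _).trans ?_
        simp
      rw [hs]; linarith
    have h4 := norm_nonneg (2 + t₀ * I + s)
    have h5 := norm_nonneg (2 + t₀ * I + s - 1)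
    nlinarith
  have hKlog : Real.log (K / ‖g 0‖) ≤ 5 * ℓ := by
    have h1 : K / ‖g 0‖ ≤ 18 * x ^ 2 := by
      rw [div_le_iff₀ (by linarith)]
      nlinarith [sq_nonneg x]
    refine (Real.log_le_log (div_pos (by positivity) (by linarith)) h1).trans ?_
    rw [Real.log_mul (by norm_num) (by positivity), Real.log_pow]
    have : Real.log 18 ≤ 3 := by
      rw [Real.log_le_iff_le_exp (by norm_num)]
      have h1 := Real.exp_one_gt_d9
      have : Real.exp 3 = Real.exp 1 ^ 3 := by rw [← Real.exp_nat_mul]; norm_num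
      rw [this]
      have : (2.7 : ℝ) ^ 3 ≤ Real.exp 1 ^ 3 := by gcongr; linarith
      norm_num at this
      linarith
    push_cast
    linarith
  set n : ℕ := ⌊5 * ℓ / q⌋₊ + 1 with hn
  have hn1 : 5 * ℓ / q < n := by rw [hn]; push_cast; exact Nat.lt_floor_add_one _
  have hn2 : (n : ℝ) ≤ 5 * ℓ / q + 1 := by
    rw [hn]; push_cast
    gcongr
    exact Nat.floor_le (by positivity)
  have hn3 : (n : ℝ) ≤ (5 / q + 2) * ℓ := by
    refine hn2.trans ?_
    have : (5 / q + 2) * ℓ = 5 * ℓ / q + 2 * ℓ := by ring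
    linarith
  have hKn : K < ‖g 0‖ * ((9 / 5 : ℝ) / (17 / 10)) ^ n := by
    have hg0' : 0 < ‖g 0‖ := by linarith
    have h1 : 0 < K / ‖g 0‖ := div_pos (by positivity) hg0'
    rw [← div_lt_iff₀' hg0', ← Real.log_lt_log_iff h1 (by positivity), Real.log_pow]
    refine hKlog.trans_lt ?_
    rw [div_lt_iff₀ hqpos] at hn1
    norm_num at hn1 ⊢
    exact hn1
  obtain ⟨Z, hZc, hZ, hZs⟩ := exists_zeros_logDeriv_approx (r := 8 / 5) (R₁ := 17 / 10)
    (R := 9 / 5) (by norm_num) (by norm_num) (by norm_num) n g K hgd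
    (by rw [← norm_pos_iff]; linarith) hKg hKn
  have hZre : ∀ ρ ∈ Z, (2 + t₀ * I) + ρ = 1 / 2 + ((((2 + t₀ * I) + ρ).im : ℝ) : ℂ) * I := by
    intro ρ hρ
    obtain ⟨h1, h2⟩ := hZ ρ hρ
    have h3 : 0 < ((2 + t₀ * I) + ρ).re := by
      have := (abs_le.1 ((abs_re_le_norm ρ).trans h2)).1
      simp
      linarith
    have h4 := riemannZeta₁_ne_zero_or hRH h3 h1
    apply Complex.ext
    · rw [h4]; simp
    · simp
  refine ⟨Z.map fun ρ => ((2 + t₀ * I) + ρ).im, ?_, ?_⟩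
  · rw [Multiset.card_map]
    have h1 : ((Multiset.card Z : ℕ) : ℝ) ≤ n := by exact_mod_cast hZc
    refine h1.trans (hn3.trans ?_)
    nlinarith
  · intro s hs hsre
    have hgs : g (s - (2 + t₀ * I)) = riemannZeta₁ s := by simp [hg]
    have h1 := hZs (s - (2 + t₀ * I)) hs (by rw [hgs]; exact riemannZeta₁_ne_zero hRH hsre)
    have h2 : logDeriv g (s - (2 + t₀ * I)) = logDeriv riemannZeta₁ s := by
      rw [logDeriv_apply, logDeriv_apply, hgs]
      congr 1
      rw [hg, deriv_comp_const_add]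
      congr 1
      ring
    have h3 : (Z.map fun ρ => 1 / (s - (2 + t₀ * I) - ρ)).sum =
        ((Z.map fun ρ => ((2 + t₀ * I) + ρ).im).map fun γ : ℝ => 1 / (s - (1 / 2 + γ * I))).sum := by
      rw [Multiset.map_map]
      congr 1
      refine Multiset.map_congr rfl fun ρ hρ => ?_
      simp only [Function.comp]
      rw [← hZre ρ hρ]
      congr 1
      ring
    rw [h2, h3] at h1
    refine h1.trans ?_
    norm_num at hKlog ⊢
    nlinarith

lemma exists_norm_logDeriv_riemannZeta₁_le (hRH : RiemannHypothesis) :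
    ∃ C > (0 : ℝ), ∀ s : ℂ, 1 / 2 < s.re → s.re ≤ 3 →
      ‖logDeriv riemannZeta₁ s‖ ≤ C * Real.log (|s.im| + 4) * (1 + 1 / (s.re - 1 / 2)) := by
  obtain ⟨C, hC, h⟩ := exists_zeros_logDeriv_riemannZeta₁ hRH
  refine ⟨C, hC, fun s hs hs3 => ?_⟩
  obtain ⟨Z, hZc, hZ⟩ := h s.im
  have hδ : 0 < s.re - 1 / 2 := by linarith
  have h0 : s - (2 + s.im * I) = ((s.re - 2 : ℝ) : ℂ) := by
    apply Complex.ext <;> simp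
  have h1 := hZ s (by
    rw [h0, norm_real, Real.norm_eq_abs, abs_le]
    constructor <;> linarith) hs
  have h2 : ‖(Z.map fun γ : ℝ => 1 / (s - (1 / 2 + γ * I))).sum‖ ≤
      Multiset.card Z * (1 / (s.re - 1 / 2)) := by
    refine (norm_multiset_sum_le _).trans ?_
    rw [Multiset.map_map, ← nsmul_eq_mul]
    have := Multiset.sum_le_card_nsmul
      (Z.map (norm ∘ fun γ : ℝ => 1 / (s - (1 / 2 + γ * I)))) (1 / (s.re - 1 / 2)) ?_
    · simpa using this
    · intro x hx
      obtain ⟨γ, -, rfl⟩ := Multiset.mem_map.1 hx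
      simp only [Function.comp, norm_div, norm_one]
      refine one_div_le_one_div_of_le hδ ?_
      refine le_trans ?_ (abs_re_le_norm _)
      refine le_trans (le_of_eq ?_) (le_abs_self _)
      simp
  have h3 := norm_sub_norm_le (logDeriv riemannZeta₁ s)
    (Z.map fun γ : ℝ => 1 / (s - (1 / 2 + γ * I))).sum
  have h4 : Multiset.card Z * (1 / (s.re - 1 / 2)) ≤
    C * Real.log (|s.im| + 4) * (1 / (s.re - 1 / 2)) := by gcongr
  linarith

lemma integral_poisson_le {δ : ℝ} (hδ : 0 < δ) (γ a b : ℝ) :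
    ∫ w in a..b, δ / (δ ^ 2 + (2 * Real.pi * w - γ) ^ 2) ≤ 1 := by
  have hpi := Real.pi_pos
  have hd : ∀ w ∈ Set.uIcc a b, HasDerivAt
      (fun w => 1 / (2 * Real.pi) * Real.arctan ((2 * Real.pi * w - γ) / δ))
      (δ / (δ ^ 2 + (2 * Real.pi * w - γ) ^ 2)) w := by
    intro w _
    have h1 : HasDerivAt (fun w => (2 * Real.pi * w - γ) / δ) (2 * Real.pi * 1 / δ) w :=
      (((hasDerivAt_id' w).const_mul (2 * Real.pi)).sub_const γ).div_const δ
    refine (h1.arctan.const_mul (1 / (2 * Real.pi))).congr_deriv ?_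
    field_simp
  rw [intervalIntegral.integral_eq_sub_of_hasDerivAt hd]
  · have h1 := Real.arctan_lt_pi_div_two ((2 * Real.pi * b - γ) / δ)
    have h2 := Real.neg_pi_div_two_lt_arctan ((2 * Real.pi * a - γ) / δ)
    rw [← mul_sub]
    rw [one_div, inv_mul_le_iff₀ (by positivity)]
    linarith
  · apply Continuous.intervalIntegrable
    apply Continuous.div continuous_const (by fun_prop)
    intro w
    positivity

lemma exists_integral_re_logDeriv_le (hRH : RiemannHypothesis) :
    ∃ C > (0 : ℝ), ∀ u σ : ℝ, 1 / 2 < σ → σ ≤ 1 →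
      ∫ w in (u - 1 / 8)..u, |(logDeriv riemannZeta₁ (σ + 2 * Real.pi * w * I)).re| ≤
        C * Real.log (|u| + 4) := by
  obtain ⟨C, hC, h⟩ := exists_zeros_logDeriv_riemannZeta₁ hRH
  refine ⟨6 * C, by positivity, fun u σ hσ hσ1 => ?_⟩
  set δ := σ - 1 / 2 with hδ
  have hδ0 : 0 < δ := by linarith
  set t₀ := 2 * Real.pi * (u - 1 / 16) with ht₀
  obtain ⟨Z, hZc, hZ⟩ := h t₀
  have hpi := Real.pi_pos
  have hpi2 := Real.pi_lt_d2
  have hℓ : Real.log (|t₀| + 4) ≤ 3 * Real.log (|u| + 4) := by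
    have h1 : |t₀| + 4 ≤ 7 * (|u| + 4) := by
      rw [ht₀, abs_mul, abs_of_pos (by positivity)]
      have : |u - 1 / 16| ≤ |u| + 1 / 16 := by
        refine (abs_sub _ _).trans ?_
        rw [abs_of_pos (by norm_num : (0 : ℝ) < 1 / 16)]
      have := abs_nonneg u
      have := abs_nonneg (u - 1 / 16)
      nlinarith
    refine (Real.log_le_log (by positivity) h1).trans ?_
    rw [Real.log_mul (by norm_num) (by positivity)]
    have : Real.log 7 ≤ 2 := by
      rw [Real.log_le_iff_le_exp (by norm_num)]
      have h1 := Real.exp_one_gt_d9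
      have : Real.exp 2 = Real.exp 1 ^ 2 := by rw [← Real.exp_nat_mul]; norm_num
      rw [this]
      have : (2.7 : ℝ) ^ 2 ≤ Real.exp 1 ^ 2 := by gcongr; linarith
      norm_num at this
      linarith
    have := one_le_log_abs_add_four u
    linarith
  have hpt : ∀ w ∈ Set.Icc (u - 1 / 8) u,
      |(logDeriv riemannZeta₁ (σ + 2 * Real.pi * w * I)).re| ≤
        C * Real.log (|t₀| + 4) +
          (Z.map fun γ : ℝ => δ / (δ ^ 2 + (2 * Real.pi * w - γ) ^ 2)).sum := by
    intro w hw
    have h1 := hZ (σ + 2 * Real.pi * w * I) (by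
      have e : (σ : ℂ) + 2 * Real.pi * w * I - (2 + t₀ * I) =
          ((σ - 2 : ℝ) : ℂ) + ((2 * Real.pi * w - t₀ : ℝ) : ℂ) * I := by push_cast; ring
      rw [e, norm_add_mul_I]
      apply Real.sqrt_le_iff.2 ⟨by norm_num, ?_⟩
      have h3 : |2 * Real.pi * w - t₀| ≤ 2 * Real.pi * (1 / 16) := by
        rw [ht₀, ← mul_sub, abs_mul, abs_of_pos (by positivity : 0 < 2 * Real.pi)]
        gcongr
        rw [abs_le]
        constructor <;> linarith [hw.1, hw.2]
      have h4 : |2 * Real.pi * w - t₀| ≤ 1 / 2 := by linarith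
      have h5 := sq_le_sq' (abs_le.1 h4).1 (abs_le.1 h4).2
      nlinarith) (by simpa using hσ)
    have h2 : ((Z.map fun γ : ℝ => 1 / ((σ : ℂ) + 2 * Real.pi * w * I - (1 / 2 + γ * I))).sum).re =
        (Z.map fun γ : ℝ => δ / (δ ^ 2 + (2 * Real.pi * w - γ) ^ 2)).sum := by
      rw [← Complex.reCLM_apply, map_multiset_sum, Multiset.map_map]
      congr 1
      refine Multiset.map_congr rfl fun γ _ => ?_
      have e : (σ : ℂ) + 2 * Real.pi * w * I - (1 / 2 + γ * I) =
          (δ : ℂ) + ((2 * Real.pi * w - γ : ℝ) : ℂ) * I := by rw [hδ]; push_cast; ring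
      simp only [Function.comp, Complex.reCLM_apply]
      rw [e, one_div, inv_re, normSq_add_mul_I]
      simp
    have h3 := abs_re_le_norm (logDeriv riemannZeta₁ (σ + 2 * Real.pi * w * I) -
      (Z.map fun γ : ℝ => 1 / ((σ : ℂ) + 2 * Real.pi * w * I - (1 / 2 + γ * I))).sum)
    rw [sub_re, h2] at h3
    have h4 : 0 ≤ (Z.map fun γ : ℝ => δ / (δ ^ 2 + (2 * Real.pi * w - γ) ^ 2)).sum := by
      apply Multiset.sum_nonneg
      intro x hx
      obtain ⟨γ, -, rfl⟩ := Multiset.mem_map.1 hx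
      positivity
    have h5 := abs_le.1 (h3.trans h1)
    rw [abs_le]
    constructor <;> linarith [h5.1, h5.2]
  have hcont : Continuous fun w : ℝ => logDeriv riemannZeta₁ (σ + 2 * Real.pi * w * I) := by
    simp only [logDeriv_apply]
    refine Continuous.div ?_ ?_ ?_
    · have : Continuous (deriv riemannZeta₁) :=
        (differentiable_riemannZeta₁.contDiff (n := 1)).continuous_deriv le_rfl
      exact this.comp (by fun_prop)
    · exact differentiable_riemannZeta₁.continuous.comp (by fun_prop)
    · intro w
      exact riemannZeta₁_ne_zero hRH (by simpa using hσ)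
  have hpc : ∀ γ : ℝ, Continuous fun w : ℝ => δ / (δ ^ 2 + (2 * Real.pi * w - γ) ^ 2) := by
    intro γ
    apply Continuous.div continuous_const (by fun_prop)
    intro w
    positivity
  have hsum : ∀ Z : Multiset ℝ,
      Continuous (fun w : ℝ => (Z.map fun γ : ℝ => δ / (δ ^ 2 + (2 * Real.pi * w - γ) ^ 2)).sum) ∧
      ∫ w in (u - 1 / 8)..u, (Z.map fun γ : ℝ => δ / (δ ^ 2 + (2 * Real.pi * w - γ) ^ 2)).sum ≤
        (Multiset.card Z : ℝ) := by
    intro Z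
    induction Z using Multiset.induction_on with
    | empty => simp [continuous_const]
    | cons γ Z ih =>
      simp only [Multiset.map_cons, Multiset.sum_cons, Multiset.card_cons]
      refine ⟨(hpc γ).add ih.1, ?_⟩
      rw [intervalIntegral.integral_add ((hpc γ).intervalIntegrable _ _)
        (ih.1.intervalIntegrable _ _)]
      have := integral_poisson_le hδ0 γ (u - 1 / 8) u
      push_cast
      linarith [ih.2]
  have hfin := intervalIntegral.integral_mono_on (μ := volume) (by linarith : u - 1 / 8 ≤ u)
    ((continuous_abs.comp (continuous_re.comp hcont)).intervalIntegrable _ _)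
    ((continuous_const.add (hsum Z).1).intervalIntegrable _ _) hpt
  refine hfin.trans ?_
  simp only [Pi.add_apply]
  rw [intervalIntegral.integral_add intervalIntegrable_const ((hsum Z).1.intervalIntegrable _ _),
    intervalIntegral.integral_const]
  have h6 := (hsum Z).2
  have h7 := one_le_log_abs_add_four t₀
  simp only [sub_sub_cancel, smul_eq_mul]
  nlinarith

lemma neg_logDeriv_riemannZeta₁_eq {s : ℂ} (hs : 1 < s.re) :
    -logDeriv riemannZeta₁ s =
      LSeries (fun n => (ArithmeticFunction.vonMangoldt n : ℂ)) s - 1 / (s - 1) := by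
  have hne : s - 1 ≠ 0 := by
    intro h
    rw [sub_eq_zero.1 h] at hs
    simp at hs
  have hne1 : s ≠ 1 := by
    rintro rfl
    simp at hs
  have hζ : riemannZeta s ≠ 0 := riemannZeta_ne_zero_of_one_lt_re hs
  have e : riemannZeta₁ =ᶠ[nhds s] fun z => (z - 1) * riemannZeta z := by
    filter_upwards [isOpen_ne.mem_nhds hne1] with z hz
    rw [riemannZeta_eq_inv_sub_mul hz, mul_inv_cancel_left₀ (sub_ne_zero.2 hz)]
  have e2 : riemannZeta₁ s = (s - 1) * riemannZeta s := e.eq_of_nhds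
  have hd : HasDerivAt (fun z => (z - 1) * riemannZeta z)
      (1 * riemannZeta s + (s - 1) * deriv riemannZeta s) s :=
    ((hasDerivAt_id' s).sub_const 1).fun_mul (differentiableAt_riemannZeta hne1).hasDerivAt
  rw [ArithmeticFunction.LSeries_vonMangoldt_eq_deriv_riemannZeta_div hs, logDeriv_apply,
    e.deriv_eq, hd.deriv, e2]
  field_simp
  ring

lemma norm_term_vonMangoldt_sub (z : ℂ) (w : ℝ) (n : ℕ) :
    LSeries.term (fun n => (ArithmeticFunction.vonMangoldt n : ℂ)) (z - 2 * Real.pi * w * I) n =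
      LSeries.term (fun n => (ArithmeticFunction.vonMangoldt n : ℂ)) z n *
        exp (2 * Real.pi * I * w * Real.log n) := by
  rcases eq_or_ne n 0 with rfl | hn
  · simp
  · have hn' : (n : ℂ) ≠ 0 := by exact_mod_cast hn
    rw [LSeries.term_of_ne_zero hn, LSeries.term_of_ne_zero hn, cpow_sub _ _ hn']
    have : (n : ℂ) ^ (2 * Real.pi * w * I) = exp (2 * Real.pi * I * w * Real.log n) := by
      rw [cpow_def_of_ne_zero hn', ← ofReal_natCast, ← ofReal_log (Nat.cast_nonneg n)]
      congr 1
      ring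
    rw [this]
    field_simp [exp_ne_zero]

lemma continuous_logDeriv_riemannZeta₁ (hRH : RiemannHypothesis) {z : ℂ} (hz : 1 / 2 < z.re) :
    Continuous fun w : ℝ => logDeriv riemannZeta₁ (z - 2 * Real.pi * w * I) := by
  simp only [logDeriv_apply]
  refine Continuous.div ?_ ?_ ?_
  · have : Continuous (deriv riemannZeta₁) :=
      (differentiable_riemannZeta₁.contDiff (n := 1)).continuous_deriv le_rfl
    exact this.comp (by fun_prop)
  · exact differentiable_riemannZeta₁.continuous.comp (by fun_prop)
  · intro w
    exact riemannZeta₁_ne_zero hRH (by simpa using hz)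

lemma norm_exp_two_pi_I_mul (x y : ℝ) : ‖exp (2 * Real.pi * I * x * y)‖ = 1 := by
  have : (2 * Real.pi * I * x * y : ℂ) = ((2 * Real.pi * x * y : ℝ) : ℂ) * I := by push_cast; ring
  rw [this, norm_exp_ofReal_mul_I]

section

variable {Φ φ : ℝ → ℂ}

lemma integral_mul_LSeries_vonMangoldt (hΦc : Continuous Φ) (hΦ : Integrable Φ)
    (hφ : ∀ x : ℝ, φ x = ∫ w : ℝ, Φ w * exp (2 * Real.pi * I * w * x)) {b : ℕ}
    (hb : ∀ x, Real.log b ≤ x → φ x = 0) {z : ℂ} (hz : 1 < z.re) :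
    ∫ w : ℝ, Φ w * LSeries (fun n => (ArithmeticFunction.vonMangoldt n : ℂ))
        (z - 2 * Real.pi * w * I) =
      ∑ n ∈ Finset.Icc 1 b, (ArithmeticFunction.vonMangoldt n : ℂ) / (n : ℂ) ^ z *
        φ (Real.log n) := by
  set a : ℕ → ℂ := LSeries.term (fun n => (ArithmeticFunction.vonMangoldt n : ℂ)) z with ha
  have hsum : Summable fun n => ‖a n‖ :=
    (ArithmeticFunction.LSeriesSummable_vonMangoldt hz).norm
  have hF : ∀ n w, Φ w * LSeries.term (fun n => (ArithmeticFunction.vonMangoldt n : ℂ))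
      (z - 2 * Real.pi * w * I) n = a n * (Φ w * exp (2 * Real.pi * I * w * Real.log n)) := by
    intro n w
    rw [norm_term_vonMangoldt_sub]
    ring
  have hnorm : ∀ n w, ‖a n * (Φ w * exp (2 * Real.pi * I * w * Real.log n))‖ = ‖a n‖ * ‖Φ w‖ := by
    intro n w
    rw [norm_mul, norm_mul, norm_exp_two_pi_I_mul, mul_one]
  have hintg : ∀ n : ℕ, Integrable fun w : ℝ =>
      a n * (Φ w * exp (2 * Real.pi * I * w * Real.log n)) := by
    intro n
    refine (hΦ.norm.const_mul ‖a n‖).mono' ?_ (Filter.Eventually.of_forall fun w => (hnorm n w).le)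
    exact Continuous.aestronglyMeasurable (by fun_prop)
  have key := hasSum_integral_of_summable_integral_norm hintg (by
    simp_rw [hnorm, integral_const_mul]
    exact hsum.mul_right _)
  have e1 : (fun w : ℝ => Φ w * LSeries (fun n => (ArithmeticFunction.vonMangoldt n : ℂ))
      (z - 2 * Real.pi * w * I)) =
      fun w : ℝ => ∑' n, a n * (Φ w * exp (2 * Real.pi * I * w * Real.log n)) := by
    funext w
    rw [LSeries, ← tsum_mul_left]
    exact tsum_congr fun n => hF n w
  rw [e1, ← key.tsum_eq]
  have e2 : ∀ n : ℕ, ∫ w : ℝ, a n * (Φ w * exp (2 * Real.pi * I * w * Real.log n)) =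
      a n * φ (Real.log n) := by
    intro n
    rw [integral_const_mul, hφ]
  simp_rw [e2]
  rw [tsum_eq_sum (s := Finset.Icc 1 b)]
  · refine Finset.sum_congr rfl fun n hn => ?_
    rw [ha, LSeries.term_of_ne_zero (by have := (Finset.mem_Icc.1 hn).1; omega)]
  · intro n hn
    rcases Nat.eq_zero_or_pos n with rfl | hn0
    · simp [ha]
    · rw [hb, mul_zero]
      have h1 : b < n := by
        by_contra h
        exact hn (Finset.mem_Icc.2 ⟨hn0, not_lt.1 h⟩)
      rcases Nat.eq_zero_or_pos b with rfl | hb0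
      · simp
        positivity
      · apply Real.log_le_log
        · exact_mod_cast hb0
        · exact_mod_cast h1.le

lemma integral_mul_inv_sub (hΦc : Continuous Φ) (hΦ : Integrable Φ)
    (hφ : ∀ x : ℝ, φ x = ∫ w : ℝ, Φ w * exp (2 * Real.pi * I * w * x)) {b : ℕ}
    (hb : ∀ x, Real.log b ≤ x → φ x = 0) {z : ℂ} (hz : 1 < z.re) :
    ∫ w : ℝ, Φ w * (1 / (z - 2 * Real.pi * w * I - 1)) =
      ∫ y in Set.Ioc 0 (Real.log b), φ y * exp ((1 - z) * y) := by
  have e1 : ∀ w : ℝ, Φ w * (1 / (z - 2 * Real.pi * w * I - 1)) =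
      ∫ y in Set.Ioi (0 : ℝ), Φ w * exp ((1 - z) * y) * exp (2 * Real.pi * I * w * y) := by
    intro w
    have h1 : ∀ y : ℝ, Φ w * exp ((1 - z) * y) * exp (2 * Real.pi * I * w * y) =
        Φ w * exp ((1 - z + 2 * Real.pi * w * I) * y) := by
      intro y
      rw [mul_assoc, ← exp_add]
      congr 2
      ring
    have hre : (1 - z + 2 * Real.pi * w * I).re < 0 := by simpa using hz
    simp_rw [h1]
    rw [integral_const_mul, integral_exp_mul_complex_Ioi hre]
    have hne : 1 - z + 2 * Real.pi * w * I ≠ 0 := by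
      intro h
      rw [h] at hre
      simp at hre
    have hne' : z - 2 * Real.pi * w * I - 1 ≠ 0 := by
      intro h
      apply hne
      linear_combination -h
    simp only [ofReal_zero, mul_zero, exp_zero]
    congr 1
    rw [div_eq_div_iff hne' hne]
    ring
  simp_rw [e1]
  rw [integral_integral_swap]
  · have e2 : ∀ y : ℝ, ∫ w : ℝ, Φ w * exp ((1 - z) * y) * exp (2 * Real.pi * I * w * y) =
        φ y * exp ((1 - z) * y) := by
      intro y
      rw [hφ, ← integral_mul_const]
      congr 1
      funext w
      ring
    simp_rw [e2]
    refine setIntegral_eq_of_subset_of_forall_sdiff_eq_zero measurableSet_Ioi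
      Set.Ioc_subset_Ioi_self ?_
    intro y hy
    have h1 : (0 : ℝ) < y := hy.1
    rw [hb, zero_mul]
    by_contra h
    exact hy.2 ⟨h1, (not_le.1 h).le⟩
  · have h1 : Integrable (fun p : ℝ × ℝ => Φ p.1 * exp ((1 - z) * p.2))
        (volume.prod (volume.restrict (Set.Ioi 0))) :=
      hΦ.mul_prod (integrableOn_exp_mul_complex_Ioi (by simpa using hz) 0)
    refine h1.norm.mono' ?_ (Filter.Eventually.of_forall fun p => ?_)
    · exact Continuous.aestronglyMeasurable (by fun_prop)
    · simp only [Function.uncurry]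
      rw [norm_mul _ (exp (2 * Real.pi * I * p.1 * p.2)), norm_exp_two_pi_I_mul, mul_one]

lemma integral_mul_neg_logDeriv_of_one_lt (hΦc : Continuous Φ) (hΦ : Integrable Φ)
    (hφ : ∀ x : ℝ, φ x = ∫ w : ℝ, Φ w * exp (2 * Real.pi * I * w * x)) {b : ℕ}
    (hb : ∀ x, Real.log b ≤ x → φ x = 0) (hRH : RiemannHypothesis) {z : ℂ} (hz : 1 < z.re) :
    ∫ w : ℝ, Φ w * (-logDeriv riemannZeta₁ (z - 2 * Real.pi * w * I)) =
      ∑ n ∈ Finset.Icc 1 b, (ArithmeticFunction.vonMangoldt n : ℂ) / (n : ℂ) ^ z *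
        φ (Real.log n) - ∫ y in Set.Ioc 0 (Real.log b), φ y * exp ((1 - z) * y) := by
  have hre : ∀ w : ℝ, (z - 2 * Real.pi * w * I).re = z.re := by intro w; simp
  have h1 : ∀ w : ℝ, Φ w * (-logDeriv riemannZeta₁ (z - 2 * Real.pi * w * I)) =
      Φ w * LSeries (fun n => (ArithmeticFunction.vonMangoldt n : ℂ)) (z - 2 * Real.pi * w * I) -
      Φ w * (1 / (z - 2 * Real.pi * w * I - 1)) := by
    intro w
    rw [neg_logDeriv_riemannZeta₁_eq (by rw [hre]; exact hz)]
    ring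
  have hne : ∀ w : ℝ, z - 2 * Real.pi * w * I - 1 ≠ 0 := by
    intro w h
    have := congrArg re h
    rw [sub_re, hre] at this
    simp at this
    linarith
  have hc2 : Continuous fun w : ℝ => 1 / (z - 2 * Real.pi * w * I - 1) :=
    continuous_const.div (by fun_prop) hne
  have hc1 : Continuous fun w : ℝ => LSeries (fun n => (ArithmeticFunction.vonMangoldt n : ℂ))
      (z - 2 * Real.pi * w * I) := by
    have : (fun w : ℝ => LSeries (fun n => (ArithmeticFunction.vonMangoldt n : ℂ))
      (z - 2 * Real.pi * w * I)) = fun w : ℝ =>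
        -logDeriv riemannZeta₁ (z - 2 * Real.pi * w * I) + 1 / (z - 2 * Real.pi * w * I - 1) := by
      funext w
      rw [neg_logDeriv_riemannZeta₁_eq (by rw [hre]; exact hz)]
      ring
    rw [this]
    exact (continuous_logDeriv_riemannZeta₁ hRH (by linarith)).neg.add hc2
  simp_rw [h1]
  rw [integral_sub, integral_mul_LSeries_vonMangoldt hΦc hΦ hφ hb hz,
    integral_mul_inv_sub hΦc hΦ hφ hb hz]
  · have hsum : Summable fun n =>
        ‖LSeries.term (fun n => (ArithmeticFunction.vonMangoldt n : ℂ)) z n‖ :=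
      (ArithmeticFunction.LSeriesSummable_vonMangoldt hz).norm
    refine (hΦ.norm.mul_const (∑' n, ‖LSeries.term
      (fun n => (ArithmeticFunction.vonMangoldt n : ℂ)) z n‖)).mono'
      (hΦc.mul hc1).aestronglyMeasurable (Filter.Eventually.of_forall fun w => ?_)
    rw [norm_mul]
    gcongr
    refine tsum_of_norm_bounded hsum.hasSum fun n => ?_
    rw [norm_term_vonMangoldt_sub, norm_mul, norm_exp_two_pi_I_mul, mul_one]
  · refine (hΦ.norm.mul_const (1 / (z.re - 1))).mono'
      (hΦc.mul hc2).aestronglyMeasurable (Filter.Eventually.of_forall fun w => ?_)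
    rw [norm_mul, norm_div, norm_one]
    have h0 : 0 < z.re - 1 := by linarith
    gcongr
    refine le_trans (le_of_eq ?_) (re_le_norm _)
    rw [sub_re, hre, one_re]

lemma differentiable_sum_vonMangoldt_sub_integral (hΦc : Continuous Φ) (hΦ : Integrable Φ)
    (hφ : ∀ x : ℝ, φ x = ∫ w : ℝ, Φ w * exp (2 * Real.pi * I * w * x)) (b : ℕ) :
    Differentiable ℂ (fun z : ℂ =>
      ∑ n ∈ Finset.Icc 1 b, (ArithmeticFunction.vonMangoldt n : ℂ) / (n : ℂ) ^ z *
        φ (Real.log n) - ∫ y in Set.Ioc 0 (Real.log b), φ y * exp ((1 - z) * y)) := by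
  have hφb : ∀ x, ‖φ x‖ ≤ ∫ w, ‖Φ w‖ := by
    intro x
    rw [hφ]
    refine (norm_integral_le_integral_norm _).trans (le_of_eq ?_)
    congr 1
    funext w
    rw [norm_mul, norm_exp_two_pi_I_mul, mul_one]
  have hφc : Continuous φ := by
    have : φ = fun x : ℝ => ∫ w : ℝ, Φ w * exp (2 * Real.pi * I * w * x) := funext hφ
    rw [this]
    refine continuous_of_dominated (bound := fun w => ‖Φ w‖) ?_ ?_ hΦ.norm ?_
    · intro x
      exact Continuous.aestronglyMeasurable (by fun_prop)
    · intro x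
      refine Filter.Eventually.of_forall fun w => ?_
      rw [norm_mul, norm_exp_two_pi_I_mul, mul_one]
    · refine Filter.Eventually.of_forall fun w => ?_
      fun_prop
  rw [← differentiableOn_univ]
  refine DifferentiableOn.sub ?_ ?_
  · refine DifferentiableOn.fun_sum fun n hn => ?_
    have hn0 : (n : ℂ) ≠ 0 := by
      have := (Finset.mem_Icc.1 hn).1
      exact_mod_cast (by omega : n ≠ 0)
    refine DifferentiableOn.mul_const ?_ _
    intro z _
    refine DifferentiableAt.differentiableWithinAt ?_
    refine DifferentiableAt.div (by fun_prop) (differentiableAt_id.const_cpow (Or.inl hn0)) ?_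
    simp [cpow_eq_zero_iff, hn0]
  · refine differentiableOn_integral_of_locally_dominated isOpen_univ ?_ ?_ ?_
    · intro z _
      exact Continuous.aestronglyMeasurable (by fun_prop)
    · refine Filter.Eventually.of_forall fun y => ?_
      fun_prop
    · intro z₀ _
      refine ⟨Metric.ball z₀ 1, Metric.ball_mem_nhds _ one_pos,
        fun y => (∫ w, ‖Φ w‖) * Real.exp ((‖1 - z₀‖ + 1) * Real.log b), ?_, ?_⟩
      · exact integrableOn_const (by simp)
      · filter_upwards [ae_restrict_mem measurableSet_Ioc] with y hy z hz
        rw [norm_mul, norm_exp]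
        have h0 : 0 ≤ ∫ w, ‖Φ w‖ := integral_nonneg fun w => norm_nonneg _
        gcongr
        · exact hφb y
        · have h3 : ((1 - z) * y).re ≤ ‖1 - z‖ * y := by
            refine (re_le_norm _).trans ?_
            rw [norm_mul, norm_real, Real.norm_of_nonneg hy.1.le]
          refine h3.trans ?_
          have h4 : ‖1 - z‖ ≤ ‖1 - z₀‖ + 1 := by
            have : ‖z₀ - z‖ < 1 := by
              rw [← norm_neg, neg_sub]; simpa [dist_eq_norm] using hz
            have h5 := norm_add_le (1 - z₀) (z₀ - z)
            rw [sub_add_sub_cancel] at h5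
            linarith
          have := hy.1.le
          have := hy.2
          gcongr

lemma integral_mul_neg_logDeriv (hΦc : Continuous Φ) (hΦ : Integrable Φ)
    (hΦ' : Integrable fun w : ℝ => w * Φ w)
    (hφ : ∀ x : ℝ, φ x = ∫ w : ℝ, Φ w * exp (2 * Real.pi * I * w * x)) {b : ℕ}
    (hb : ∀ x, Real.log b ≤ x → φ x = 0) (hRH : RiemannHypothesis) {z : ℂ} (hz : 1 / 2 < z.re)
    (hz3 : z.re < 3) :
    ∫ w : ℝ, Φ w * (-logDeriv riemannZeta₁ (z - 2 * Real.pi * w * I)) =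
      ∑ n ∈ Finset.Icc 1 b, (ArithmeticFunction.vonMangoldt n : ℂ) / (n : ℂ) ^ z *
        φ (Real.log n) - ∫ y in Set.Ioc 0 (Real.log b), φ y * exp ((1 - z) * y) := by
  set U : Set ℂ := {s | 1 / 2 < s.re} ∩ {s | s.re < 3} with hU
  have hUo : IsOpen U :=
    (isOpen_lt continuous_const continuous_re).inter (isOpen_lt continuous_re continuous_const)
  have hUp : IsPreconnected U :=
    ((convex_halfSpace_re_gt (1 / 2)).inter (convex_halfSpace_re_lt 3)).isPreconnected
  obtain ⟨C, hC, hA⟩ := exists_norm_logDeriv_riemannZeta₁_le hRH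
  have h1 : DifferentiableOn ℂ (fun z : ℂ => ∫ w : ℝ, Φ w *
      (-logDeriv riemannZeta₁ (z - 2 * Real.pi * w * I))) U := by
    refine differentiableOn_integral_of_locally_dominated hUo ?_ ?_ ?_
    · intro z hz
      exact (hΦc.mul (continuous_logDeriv_riemannZeta₁ hRH hz.1).neg).aestronglyMeasurable
    · refine Filter.Eventually.of_forall fun w => ?_
      refine DifferentiableOn.const_mul (DifferentiableOn.neg ?_) _
      intro z hz
      have hne : riemannZeta₁ (z - 2 * Real.pi * w * I) ≠ 0 :=
        riemannZeta₁_ne_zero hRH (by simpa using hz.1)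
      have hd : DifferentiableAt ℂ (logDeriv riemannZeta₁) (z - 2 * Real.pi * w * I) :=
        ((differentiable_riemannZeta₁.analyticAt _).deriv.differentiableAt).div
          (differentiable_riemannZeta₁ _) hne
      exact (DifferentiableAt.comp z (g := logDeriv riemannZeta₁)
        (f := fun z : ℂ => z - 2 * Real.pi * w * I) hd (by fun_prop)).differentiableWithinAt
    · intro z₀ hz₀
      have hz₀' : 1 / 2 < z₀.re := hz₀.1
      set δ := (z₀.re - 1 / 2) / 2 with hδ
      have hδ0 : 0 < δ := by rw [hδ]; linarith
      refine ⟨({s | 1 / 2 + δ < s.re} ∩ {s | s.re < 3}) ∩ {s | |s.im| < |z₀.im| + 1}, ?_,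
        fun w => C * (1 + 1 / δ) * ((|z₀.im| + 5) * ‖Φ w‖ + 2 * Real.pi * ‖w * Φ w‖), ?_, ?_⟩
      · refine (((isOpen_lt continuous_const continuous_re).inter
          (isOpen_lt continuous_re continuous_const)).inter
          (isOpen_lt (continuous_abs.comp continuous_im) continuous_const)).mem_nhds ?_
        refine ⟨⟨?_, hz₀.2⟩, ?_⟩
        · show 1 / 2 + δ < z₀.re
          rw [hδ]; linarith
        · show |z₀.im| < |z₀.im| + 1
          linarith
      · exact ((hΦ.norm.const_mul _).add (hΦ'.norm.const_mul _)).const_mul _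
      · refine Filter.Eventually.of_forall fun w z hz => ?_
        have hz1 : 1 / 2 + δ < z.re := hz.1.1
        have hz2 : z.re < 3 := hz.1.2
        have hz4 : |z.im| < |z₀.im| + 1 := hz.2
        have h5 := hA (z - 2 * Real.pi * w * I) (by simp; linarith) (by simp; linarith)
        have hre : (z - 2 * Real.pi * w * I).re = z.re := by simp
        have him : (z - 2 * Real.pi * w * I).im = z.im - 2 * Real.pi * w := by simp
        rw [hre, him] at h5
        have h6 : Real.log (|z.im - 2 * Real.pi * w| + 4) ≤ |z₀.im| + 5 + 2 * Real.pi * |w| := by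
          refine (Real.log_le_self (by positivity)).trans ?_
          have : |z.im - 2 * Real.pi * w| ≤ |z.im| + 2 * Real.pi * |w| := by
            refine (abs_sub _ _).trans ?_
            rw [abs_mul, abs_of_pos (by positivity : 0 < 2 * Real.pi)]
          linarith
        have h7 : 1 + 1 / (z.re - 1 / 2) ≤ 1 + 1 / δ := by
          gcongr
          linarith
        have h8 : ‖logDeriv riemannZeta₁ (z - 2 * Real.pi * w * I)‖ ≤
            C * (|z₀.im| + 5 + 2 * Real.pi * |w|) * (1 + 1 / δ) := by
          refine h5.trans ?_
          have : 0 < z.re - 1 / 2 := by linarith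
          gcongr
        rw [norm_mul, norm_neg]
        calc ‖Φ w‖ * ‖logDeriv riemannZeta₁ (z - 2 * Real.pi * w * I)‖
            ≤ ‖Φ w‖ * (C * (|z₀.im| + 5 + 2 * Real.pi * |w|) * (1 + 1 / δ)) := by gcongr
          _ = _ := by
            simp only [norm_mul, norm_real, Real.norm_eq_abs]
            ring
  have h2 := (differentiable_sum_vonMangoldt_sub_integral hΦc hΦ hφ b).differentiableOn (s := U)
  refine (h1.analyticOnNhd hUo).eqOn_of_preconnected_of_eventuallyEq (h2.analyticOnNhd hUo) hUp
    (z₀ := 2) (by constructor <;> norm_num) ?_ ⟨hz, hz3⟩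
  filter_upwards [(isOpen_lt continuous_const continuous_re).mem_nhds
    (show (2 : ℂ) ∈ {s : ℂ | 1 < s.re} by simp)] with s hs
  exact integral_mul_neg_logDeriv_of_one_lt hΦc hΦ hφ hb hRH hs

end

lemma norm_le_intervalIntegral_of_hasDerivAt {Ψ Ψ' : ℝ → ℂ} (hd : ∀ w, HasDerivAt Ψ (Ψ' w) w)
    (hc' : Continuous Ψ') (t : ℝ) :
    ‖Ψ t‖ ≤ ∫ u in t..(t + 1 / 8), (8 * ‖Ψ u‖ + ‖Ψ' u‖) := by
  have hc : Continuous Ψ := continuous_iff_continuousAt.2 fun w => (hd w).continuousAt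
  have hpt : ∀ u ∈ Set.Icc t (t + 1 / 8),
      ‖Ψ t‖ - (∫ v in t..(t + 1 / 8), ‖Ψ' v‖) ≤ ‖Ψ u‖ := by
    intro u hu
    have h1 : ∫ v in t..u, Ψ' v = Ψ u - Ψ t :=
      intervalIntegral.integral_eq_sub_of_hasDerivAt (fun x _ => hd x) (hc'.intervalIntegrable _ _)
    have h2 : ‖∫ v in t..u, Ψ' v‖ ≤ ∫ v in t..u, ‖Ψ' v‖ :=
      intervalIntegral.norm_integral_le_integral_norm hu.1
    have h3 : ∫ v in t..u, ‖Ψ' v‖ ≤ ∫ v in t..(t + 1 / 8), ‖Ψ' v‖ :=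
      intervalIntegral.integral_mono_interval le_rfl hu.1 hu.2
        (Filter.Eventually.of_forall fun v => norm_nonneg _) (hc'.norm.intervalIntegrable _ _)
    have h4 := norm_sub_norm_le (Ψ t) (Ψ t - Ψ u)
    rw [sub_sub_cancel] at h4
    rw [h1, ← norm_neg, neg_sub] at h2
    linarith
  have h5 := intervalIntegral.integral_mono_on (μ := volume) (by linarith : t ≤ t + 1 / 8)
    intervalIntegrable_const (hc.norm.intervalIntegrable _ _) hpt
  rw [intervalIntegral.integral_const] at h5
  rw [intervalIntegral.integral_add ((hc.norm.const_mul 8).intervalIntegrable _ _)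
    (hc'.norm.intervalIntegrable _ _), intervalIntegral.integral_const_mul]
  simp only [add_sub_cancel_left, smul_eq_mul] at h5
  linarith

/-- Averaging a function over short windows against a weight with bounded local integrals. -/
lemma integral_norm_mul_le_of_window {Ψ Ψ' : ℝ → ℂ} (hd : ∀ w, HasDerivAt Ψ (Ψ' w) w)
    (hc' : Continuous Ψ') {g B : ℝ → ℝ} (hg : Continuous g) (hg0 : ∀ t, 0 ≤ g t)
    (hB : ∀ u, ∫ t in (u - 1 / 8)..u, g t ≤ B u)
    (hintg : Integrable fun u => B u * (8 * ‖Ψ u‖ + ‖Ψ' u‖)) :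
    ∫ t, ‖Ψ t‖ * g t ≤ ∫ u, B u * (8 * ‖Ψ u‖ + ‖Ψ' u‖) := by
  have hc : Continuous Ψ := continuous_iff_continuousAt.2 fun w => (hd w).continuousAt
  set h : ℝ → ℝ := fun u => 8 * ‖Ψ u‖ + ‖Ψ' u‖ with hh
  have hhc : Continuous h := by fun_prop
  have hh0 : ∀ u, 0 ≤ h u := fun u => by simp only [hh]; positivity
  have hB0 : ∀ u, 0 ≤ B u := fun u =>
    (intervalIntegral.integral_nonneg (by linarith) fun t _ => hg0 t).trans (hB u)
  set S : Set (ℝ × ℝ) := {p | p.1 < p.2 ∧ p.2 ≤ p.1 + 1 / 8} with hS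
  have hSm : MeasurableSet S :=
    (measurableSet_lt measurable_fst measurable_snd).inter
      (measurableSet_le measurable_snd (measurable_fst.add_const _))
  set f : ℝ → ℝ → ENNReal := fun t u =>
    S.indicator (fun p => ENNReal.ofReal (g p.1) * ENNReal.ofReal (h p.2)) (t, u) with hf
  have hfm : Measurable (Function.uncurry f) := by
    refine Measurable.indicator ?_ hSm
    exact ((hg.measurable.comp measurable_fst).ennreal_ofReal).mul
      ((hhc.measurable.comp measurable_snd).ennreal_ofReal)
  have hle1 : ∀ t, ENNReal.ofReal (‖Ψ t‖ * g t) ≤ ∫⁻ u, f t u := by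
    intro t
    have e1 : ∀ u, f t u = (Set.Ioc t (t + 1 / 8)).indicator
        (fun u => ENNReal.ofReal (g t) * ENNReal.ofReal (h u)) u := by
      intro u
      simp only [hf, Set.indicator_apply]
      rfl
    simp_rw [e1]
    rw [lintegral_indicator measurableSet_Ioc, lintegral_const_mul _ hhc.measurable.ennreal_ofReal,
      mul_comm, ENNReal.ofReal_mul (hg0 t)]
    gcongr
    rw [← ofReal_integral_eq_lintegral_ofReal
      (hhc.integrableOn_Icc.mono_set Set.Ioc_subset_Icc_self)
      (Filter.Eventually.of_forall hh0), ← intervalIntegral.integral_of_le (by linarith)]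
    exact ENNReal.ofReal_le_ofReal (norm_le_intervalIntegral_of_hasDerivAt hd hc' t)
  have hle2 : ∀ u, ∫⁻ t, f t u ≤ ENNReal.ofReal (B u * h u) := by
    intro u
    have e1 : ∀ t, f t u = (Set.Ico (u - 1 / 8) u).indicator
        (fun t => ENNReal.ofReal (h u) * ENNReal.ofReal (g t)) t := by
      intro t
      simp only [hf, Set.indicator_apply]
      refine if_congr ?_ (mul_comm _ _) rfl
      simp only [hS, Set.mem_ofPred_eq, Set.mem_Ico]
      constructor <;> rintro ⟨h1, h2⟩ <;> constructor <;> linarith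
    simp_rw [e1]
    rw [lintegral_indicator measurableSet_Ico, lintegral_const_mul _ hg.measurable.ennreal_ofReal,
      mul_comm, ENNReal.ofReal_mul (hB0 u)]
    gcongr
    rw [restrict_Ico_eq_restrict_Ioc, ← ofReal_integral_eq_lintegral_ofReal
      (hg.integrableOn_Icc.mono_set Set.Ioc_subset_Icc_self)
      (Filter.Eventually.of_forall hg0), ← intervalIntegral.integral_of_le (by linarith)]
    exact ENNReal.ofReal_le_ofReal (hB u)
  have hfin : ∫⁻ t, ENNReal.ofReal (‖Ψ t‖ * g t) ≤ ∫⁻ u, ENNReal.ofReal (B u * h u) :=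
    calc ∫⁻ t, ENNReal.ofReal (‖Ψ t‖ * g t) ≤ ∫⁻ t, ∫⁻ u, f t u := lintegral_mono hle1
      _ = ∫⁻ u, ∫⁻ t, f t u := lintegral_lintegral_swap hfm.aemeasurable
      _ ≤ _ := lintegral_mono hle2
  rw [integral_eq_lintegral_of_nonneg_ae
    (Filter.Eventually.of_forall fun t => mul_nonneg (norm_nonneg _) (hg0 t))
    (hc.norm.mul hg).aestronglyMeasurable]
  refine ENNReal.toReal_le_of_le_ofReal
    (integral_nonneg fun u => mul_nonneg (hB0 u) (hh0 u)) ?_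
  rwa [ofReal_integral_eq_lintegral_ofReal hintg
    (Filter.Eventually.of_forall fun u => mul_nonneg (hB0 u) (hh0 u))]

lemma riemannZeta₁_conj (s : ℂ) :
    riemannZeta₁ ((starRingEnd ℂ) s) = (starRingEnd ℂ) (riemannZeta₁ s) := by
  rcases eq_or_ne s 1 with rfl | hs
  · simp
  · have hs' : (starRingEnd ℂ) s ≠ 1 := by
      intro h
      apply hs
      simpa using congrArg (starRingEnd ℂ) h
    have h1 := riemannZeta_eq_inv_sub_mul hs
    have h2 := riemannZeta_eq_inv_sub_mul hs'
    rw [eq_inv_mul_iff_mul_eq₀ (sub_ne_zero.2 hs)] at h1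
    rw [eq_inv_mul_iff_mul_eq₀ (sub_ne_zero.2 hs')] at h2
    rw [← h1, ← h2, riemannZeta_conj]
    simp

lemma logDeriv_riemannZeta₁_conj (s : ℂ) :
    logDeriv riemannZeta₁ ((starRingEnd ℂ) s) = (starRingEnd ℂ) (logDeriv riemannZeta₁ s) := by
  have h : (starRingEnd ℂ) ∘ riemannZeta₁ ∘ (starRingEnd ℂ) = riemannZeta₁ := by
    funext z
    simp [riemannZeta₁_conj]
  have h2 := congrFun (deriv_conj_conj (f := riemannZeta₁)) ((starRingEnd ℂ) s)
  rw [h] at h2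
  simp only [Function.comp, conj_conj] at h2
  rw [logDeriv_apply, logDeriv_apply, riemannZeta₁_conj, h2, map_div₀]

lemma integral_mul_re_logDeriv {Φ φ : ℝ → ℂ} (hΦc : Continuous Φ) (hΦ : Integrable Φ)
    (hΦ' : Integrable fun w : ℝ => w * Φ w)
    (hφ : ∀ x : ℝ, φ x = ∫ w : ℝ, Φ w * exp (2 * Real.pi * I * w * x)) {b : ℕ}
    (hb : ∀ x, Real.log b ≤ x → φ x = 0) (h0 : ∀ x ≤ 0, φ x = 0) (hRH : RiemannHypothesis)
    {σ : ℝ} (hσ : 1 / 2 < σ) (hσ3 : σ < 3)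
    (hintg : Integrable fun w : ℝ => Φ w * logDeriv riemannZeta₁ (σ - 2 * Real.pi * w * I))
    (hintg' : Integrable fun w : ℝ => Φ w * logDeriv riemannZeta₁ (σ + 2 * Real.pi * w * I)) :
    ∑ n ∈ Finset.Icc 1 b, (ArithmeticFunction.vonMangoldt n : ℂ) / (n : ℂ) ^ (σ : ℂ) *
        φ (Real.log n) - ∫ y in Set.Ioc 0 (Real.log b), φ y * exp ((1 - σ) * y) =
      ∫ w : ℝ, Φ w * (-(2 * (logDeriv riemannZeta₁ (σ + 2 * Real.pi * w * I)).re : ℝ) : ℂ) := by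
  rw [← integral_mul_neg_logDeriv hΦc hΦ hΦ' hφ hb hRH (z := σ) (by simpa using hσ)
    (by simpa using hσ3)]
  have hneg := integral_mul_neg_logDeriv (Φ := fun w => Φ (-w)) (φ := fun x => φ (-x))
    (hΦc.comp continuous_neg) hΦ.comp_neg (by simpa using hΦ'.comp_neg.neg)
    (by
      intro x
      rw [hφ, ← integral_neg_eq_self]
      congr 1
      funext w
      congr 2
      push_cast
      ring) (b := 1)
    (by
      intro x hx
      simp at hx
      exact h0 _ (by linarith)) hRH (z := σ) (by simpa using hσ) (by simpa using hσ3)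
  simp only [Finset.Icc_self, Finset.sum_singleton, Nat.cast_one, Real.log_one, neg_zero,
    h0 0 le_rfl, mul_zero, Set.Ioc_self, Measure.restrict_empty, integral_zero_measure,
    sub_zero] at hneg
  rw [← integral_neg_eq_self] at hneg
  simp only [neg_neg, ofReal_neg, mul_neg, neg_mul, sub_neg_eq_add] at hneg
  have h1 : ∀ w : ℝ, Φ w * (-(2 * (logDeriv riemannZeta₁ (σ + 2 * Real.pi * w * I)).re : ℝ) : ℂ) =
      -(Φ w * logDeriv riemannZeta₁ (σ - 2 * Real.pi * w * I)) +
      -(Φ w * logDeriv riemannZeta₁ (σ + 2 * Real.pi * w * I)) := by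
    intro w
    have e : (σ - 2 * Real.pi * w * I : ℂ) = (starRingEnd ℂ) (σ + 2 * Real.pi * w * I) := by
      apply Complex.ext <;> simp
    rw [e, logDeriv_riemannZeta₁_conj, ← neg_add, ← mul_add, add_comm ((starRingEnd ℂ) _),
      add_conj]
    push_cast
    ring
  simp_rw [h1, mul_neg]
  have hadd := integral_add hintg.neg hintg'.neg
  simp only [Pi.neg_apply] at hadd
  rw [hadd, hneg, add_zero]

/-- Under RH the error in the prime sum with a smooth weight is controlled by a weighted `L¹`
norm of the Fourier transform of the weight. -/
lemma exists_norm_sum_vonMangoldt_sub_integral_le (hRH : RiemannHypothesis) :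
    ∃ C > (0 : ℝ), ∀ (Φ φ Ψ Ψ' : ℝ → ℂ) (b : ℕ), Continuous Φ → Integrable Φ →
      (Integrable fun w : ℝ => w * Φ w) →
      (∀ x : ℝ, φ x = ∫ w : ℝ, Φ w * exp (2 * Real.pi * I * w * x)) →
      (∀ x, Real.log b ≤ x → φ x = 0) → (∀ x ≤ 0, φ x = 0) →
      (∀ w, ‖Φ w‖ = ‖Ψ w‖) → (∀ w, HasDerivAt Ψ (Ψ' w) w) → Continuous Ψ' →
      (Integrable fun w => Real.log (|w| + 4) * (8 * ‖Ψ w‖ + ‖Ψ' w‖)) →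
      ‖∑ n ∈ Finset.Icc 1 b, (ArithmeticFunction.vonMangoldt n : ℂ) / (n : ℂ) ^ (1 / 2 : ℂ) *
        φ (Real.log n) - ∫ y in Set.Ioc 0 (Real.log b), φ y * exp ((1 - 1 / 2) * y)‖ ≤
      C * ∫ w, Real.log (|w| + 4) * (8 * ‖Ψ w‖ + ‖Ψ' w‖) := by
  obtain ⟨C, hC, hw⟩ := exists_integral_re_logDeriv_le hRH
  obtain ⟨C', hC', hA⟩ := exists_norm_logDeriv_riemannZeta₁_le hRH
  refine ⟨2 * C, by positivity, ?_⟩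
  intro Φ φ Ψ Ψ' b hΦc hΦ hΦ' hφ hb h0 hΦΨ hd hc' hintg
  set Q : ℂ → ℂ := fun z => ∑ n ∈ Finset.Icc 1 b, (ArithmeticFunction.vonMangoldt n : ℂ) /
    (n : ℂ) ^ z * φ (Real.log n) - ∫ y in Set.Ioc 0 (Real.log b), φ y * exp ((1 - z) * y) with hQ
  have hQd : Differentiable ℂ Q := differentiable_sum_vonMangoldt_sub_integral hΦc hΦ hφ b
  have hσ : ∀ σ : ℝ, 1 / 2 < σ → σ ≤ 1 →
      ‖Q σ‖ ≤ 2 * C * ∫ w, Real.log (|w| + 4) * (8 * ‖Ψ w‖ + ‖Ψ' w‖) := by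
    intro σ h1 h2
    have hld : Continuous fun w : ℝ => logDeriv riemannZeta₁ (σ - 2 * Real.pi * w * I) :=
      continuous_logDeriv_riemannZeta₁ hRH (by simpa using h1)
    have hld' : Continuous fun w : ℝ => logDeriv riemannZeta₁ (σ + 2 * Real.pi * w * I) := by
      have := hld.comp continuous_neg
      simpa [Function.comp_def] using this
    have hδ : 0 < σ - 1 / 2 := by linarith
    have hbd : ∀ w t : ℝ, |t| = 2 * Real.pi * |w| → ‖Φ w * logDeriv riemannZeta₁ (σ + t * I)‖ ≤
        C' * (1 + 1 / (σ - 1 / 2)) * (4 * ‖Φ w‖ + 2 * Real.pi * ‖w * Φ w‖) := by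
      intro w t ht
      have h3 := hA (σ + t * I) (by simpa using h1) (by simp; linarith)
      have hre : ((σ : ℂ) + t * I).re = σ := by simp
      have him : ((σ : ℂ) + t * I).im = t := by simp
      rw [hre, him, ht] at h3
      have h4 : Real.log (2 * Real.pi * |w| + 4) ≤ 2 * Real.pi * |w| + 4 :=
        Real.log_le_self (by positivity)
      rw [norm_mul]
      calc ‖Φ w‖ * ‖logDeriv riemannZeta₁ (σ + t * I)‖
          ≤ ‖Φ w‖ * (C' * (2 * Real.pi * |w| + 4) * (1 + 1 / (σ - 1 / 2))) := by
            gcongr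
            exact h3.trans (by gcongr)
        _ = _ := by
          simp only [norm_mul, norm_real, Real.norm_eq_abs]
          ring
    have hdom : Integrable fun w : ℝ =>
        C' * (1 + 1 / (σ - 1 / 2)) * (4 * ‖Φ w‖ + 2 * Real.pi * ‖w * Φ w‖) :=
      ((hΦ.norm.const_mul _).add (hΦ'.norm.const_mul _)).const_mul _
    have hi : Integrable fun w : ℝ => Φ w * logDeriv riemannZeta₁ (σ - 2 * Real.pi * w * I) := by
      refine hdom.mono' (hΦc.mul hld).aestronglyMeasurable (Filter.Eventually.of_forall fun w => ?_)
      have := hbd w (-(2 * Real.pi * w)) (by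
        rw [abs_neg, abs_mul, abs_of_pos (by positivity : 0 < 2 * Real.pi)])
      push_cast at this
      simpa [sub_eq_add_neg] using this
    have hi' : Integrable fun w : ℝ => Φ w * logDeriv riemannZeta₁ (σ + 2 * Real.pi * w * I) := by
      refine hdom.mono' (hΦc.mul hld').aestronglyMeasurable
        (Filter.Eventually.of_forall fun w => ?_)
      have := hbd w (2 * Real.pi * w) (by
        rw [abs_mul, abs_of_pos (by positivity : 0 < 2 * Real.pi)])
      push_cast at this
      exact this
    have hQσ : Q σ = _ := integral_mul_re_logDeriv hΦc hΦ hΦ' hφ hb h0 hRH h1 (by linarith) hi hi'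
    rw [hQσ]
    have hwin := integral_norm_mul_le_of_window hd hc'
      (g := fun w => |(logDeriv riemannZeta₁ (σ + 2 * Real.pi * w * I)).re|)
      (B := fun u => C * Real.log (|u| + 4))
      (continuous_abs.comp (continuous_re.comp hld')) (fun t => abs_nonneg _)
      (fun u => hw u σ h1 h2) (by simpa [mul_assoc] using hintg.const_mul C)
    have e1 : ∫ u, C * Real.log (|u| + 4) * (8 * ‖Ψ u‖ + ‖Ψ' u‖) =
        C * ∫ w, Real.log (|w| + 4) * (8 * ‖Ψ w‖ + ‖Ψ' w‖) := by
      rw [← integral_const_mul]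
      congr 1
      funext w
      ring
    rw [e1] at hwin
    refine (norm_integral_le_integral_norm _).trans ?_
    have e2 : ∀ w : ℝ, ‖Φ w * (-(2 * (logDeriv riemannZeta₁ (σ + 2 * Real.pi * w * I)).re : ℝ) : ℂ)‖
        = 2 * (‖Ψ w‖ * |(logDeriv riemannZeta₁ (σ + 2 * Real.pi * w * I)).re|) := by
      intro w
      rw [norm_mul, norm_neg, norm_real, Real.norm_eq_abs, abs_mul, abs_two, hΦΨ]
      ring
    simp_rw [e2]
    rw [integral_const_mul]
    linarith
  have hlim : Filter.Tendsto (fun σ : ℝ => ‖Q σ‖) (nhdsWithin (1 / 2) (Set.Ioi (1 / 2)))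
      (nhds ‖Q ((1 / 2 : ℝ) : ℂ)‖) := by
    have : Continuous fun σ : ℝ => ‖Q σ‖ := (hQd.continuous.comp continuous_ofReal).norm
    exact this.continuousAt.tendsto.mono_left nhdsWithin_le_nhds
  have hfin := le_of_tendsto hlim (by
    filter_upwards [Ioc_mem_nhdsGT (by norm_num : (1 / 2 : ℝ) < 1)] with σ h
    exact hσ σ h.1 h.2)
  have e : ((1 / 2 : ℝ) : ℂ) = 1 / 2 := by push_cast; rfl
  rw [e] at hfin
  exact hfin

lemma HasCompactSupport.integral_norm_sq_fourier {f : ℝ → ℂ} (h₁ : HasCompactSupport f)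
    (h₂ : ContDiff ℝ ∞ f) :
    Integrable (fun w => ‖𝓕 f w‖ ^ 2) ∧ ∫ w, ‖𝓕 f w‖ ^ 2 = ∫ x, ‖f x‖ ^ 2 := by
  have h := SchwartzMap.integral_norm_sq_fourier (h₁.toSchwartzMap h₂)
  rw [SchwartzMap.fourier_coe] at h
  refine ⟨?_, h⟩
  have := ((𝓕 (h₁.toSchwartzMap h₂)).memLp 2 volume).norm.integrable_sq
  rw [SchwartzMap.fourier_coe] at this
  exact this

lemma HasCompactSupport.integral_sq_mul_norm_sq_fourier {f : ℝ → ℂ} (h₁ : HasCompactSupport f)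
    (h₂ : ContDiff ℝ ∞ f) :
    Integrable (fun w => (2 * Real.pi * w) ^ 2 * ‖𝓕 f w‖ ^ 2) ∧
      ∫ w, (2 * Real.pi * w) ^ 2 * ‖𝓕 f w‖ ^ 2 = ∫ x, ‖deriv f x‖ ^ 2 := by
  have h3 : ContDiff ℝ ∞ (deriv f) := (contDiff_infty_iff_deriv.1 h₂).2
  have h := h₁.deriv.integral_norm_sq_fourier h3
  rw [Real.fourier_deriv (h₂.continuous.integrable_of_hasCompactSupport h₁)
    (contDiff_infty_iff_deriv.1 h₂).1 (h3.continuous.integrable_of_hasCompactSupport h₁.deriv)] at h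
  have e : ∀ w : ℝ, ‖(2 * Real.pi * I * w) • 𝓕 f w‖ ^ 2 = (2 * Real.pi * w) ^ 2 * ‖𝓕 f w‖ ^ 2 := by
    intro w
    rw [norm_smul, mul_pow]
    congr 1
    simp [mul_pow]
  simp_rw [e] at h
  exact h

lemma log_add_four_mul_le {T v : ℝ} (hT : 0 ≤ T) :
    Real.log (T * |v| + 4) ≤ 2 * (Real.log (T + 4) * Real.log (|v| + 4)) := by
  have h1 := one_le_log_abs_add_four v
  have h2 := one_le_log_abs_add_four T
  rw [abs_of_nonneg hT] at h2
  have h3 : Real.log (T * |v| + 4) ≤ Real.log (T + 4) + Real.log (|v| + 4) := by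
    rw [← Real.log_mul (by positivity) (by positivity)]
    apply Real.log_le_log (by positivity)
    nlinarith [abs_nonneg v]
  nlinarith

lemma continuous_log_abs_add_four : Continuous fun w : ℝ => Real.log (|w| + 4) :=
  (continuous_abs.add continuous_const).log fun w => (by positivity : |w| + 4 ≠ 0)

lemma integrable_log_sq_div_one_add_sq :
    Integrable fun v : ℝ => Real.log (|v| + 4) ^ 2 / (1 + v ^ 2) := by
  have h := (integrable_rpow_neg_one_add_norm_sq (E := ℝ) (μ := volume) (r := 3 / 2)
    (by simp; norm_num)).const_mul (16 * 32 ^ (1 / 4 : ℝ))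
  refine h.mono' ?_ (Filter.Eventually.of_forall fun v => ?_)
  · exact ((continuous_log_abs_add_four.pow 2).div (by fun_prop)
      fun v => by positivity).aestronglyMeasurable
  · have h1 := one_le_log_abs_add_four v
    rw [Real.norm_of_nonneg (by positivity), Real.norm_eq_abs, sq_abs]
    have h2 : Real.log (|v| + 4) ≤ (|v| + 4) ^ (1 / 4 : ℝ) / (1 / 4) :=
      Real.log_le_rpow_div (by positivity) (by norm_num)
    have h3 : Real.log (|v| + 4) ^ 2 ≤ 16 * ((|v| + 4) ^ 2) ^ (1 / 4 : ℝ) := by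
      calc _ ≤ ((|v| + 4) ^ (1 / 4 : ℝ) / (1 / 4)) ^ 2 := by gcongr
        _ = _ := by
          rw [← Real.rpow_natCast_mul (by positivity), div_pow, ← Real.rpow_mul_natCast
            (by positivity), mul_comm ((1 / 4 : ℝ))]
          push_cast
          ring
    have h4 : ((|v| + 4) ^ 2) ^ (1 / 4 : ℝ) ≤ (32 * (1 + v ^ 2)) ^ (1 / 4 : ℝ) := by
      gcongr
      nlinarith [sq_abs v, sq_nonneg (|v| - 4)]
    rw [Real.mul_rpow (by norm_num) (by positivity)] at h4
    have h5 : (1 + v ^ 2) ^ (-(3 / 2) / 2 : ℝ) = (1 + v ^ 2) ^ (1 / 4 : ℝ) / (1 + v ^ 2) := by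
      rw [← Real.rpow_sub_one (by positivity)]
      norm_num
    rw [h5, ← mul_div_assoc]
    gcongr
    linarith

lemma exists_integral_log_sq_div_le : ∃ C > (0 : ℝ), ∀ T : ℝ, 1 ≤ T →
    Integrable (fun w : ℝ => Real.log (|w| + 4) ^ 2 / (1 + (w / T) ^ 2)) ∧
    ∫ w : ℝ, Real.log (|w| + 4) ^ 2 / (1 + (w / T) ^ 2) ≤ C * (T * Real.log (T + 4) ^ 2) := by
  set K := ∫ v : ℝ, Real.log (|v| + 4) ^ 2 / (1 + v ^ 2) with hK
  have hK0 : 0 ≤ K := integral_nonneg fun v => by positivity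
  refine ⟨4 * K + 1, by positivity, fun T hT => ?_⟩
  have hT0 : 0 < T := by linarith
  have hdom : Integrable fun w : ℝ =>
      4 * Real.log (T + 4) ^ 2 * (Real.log (|w / T| + 4) ^ 2 / (1 + (w / T) ^ 2)) :=
    (integrable_log_sq_div_one_add_sq.comp_div hT0.ne').const_mul _
  have hle : ∀ w : ℝ, Real.log (|w| + 4) ^ 2 / (1 + (w / T) ^ 2) ≤
      4 * Real.log (T + 4) ^ 2 * (Real.log (|w / T| + 4) ^ 2 / (1 + (w / T) ^ 2)) := by
    intro w
    have h := log_add_four_mul_le (v := w / T) hT0.le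
    rw [abs_div, abs_of_pos hT0, mul_div_cancel₀ _ hT0.ne'] at h
    rw [← mul_div_assoc, abs_div, abs_of_pos hT0]
    have h1 := one_le_log_abs_add_four w
    gcongr
    calc _ ≤ (2 * (Real.log (T + 4) * Real.log (|w| / T + 4))) ^ 2 := by gcongr
      _ = _ := by ring
  have hintg : Integrable (fun w : ℝ => Real.log (|w| + 4) ^ 2 / (1 + (w / T) ^ 2)) := by
    refine hdom.mono' ?_ (Filter.Eventually.of_forall fun w => ?_)
    · exact ((continuous_log_abs_add_four.pow 2).div (by fun_prop)
        fun v => by positivity).aestronglyMeasurable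
    · rw [Real.norm_of_nonneg (by positivity)]
      exact hle w
  refine ⟨hintg, (integral_mono hintg hdom hle).trans ?_⟩
  rw [integral_const_mul, Measure.integral_comp_div
    (fun v => Real.log (|v| + 4) ^ 2 / (1 + v ^ 2)), ← hK, abs_of_pos hT0, smul_eq_mul]
  nlinarith [mul_nonneg hT0.le (sq_nonneg (Real.log (T + 4)))]

/-- Weighted `L¹` bound for a Fourier transform through Cauchy-Schwarz and Plancherel. -/
lemma exists_integral_log_mul_norm_fourier_le : ∃ C > (0 : ℝ), ∀ (f : ℝ → ℂ) (T p : ℝ),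
    HasCompactSupport f → ContDiff ℝ ∞ f → 1 ≤ T → 0 < p → ∫ x, ‖f x‖ ^ 2 ≤ p ^ 2 →
    ∫ x, ‖deriv f x‖ ^ 2 ≤ (T * p) ^ 2 →
    Integrable (fun w => Real.log (|w| + 4) * ‖𝓕 f w‖) ∧
    ∫ w, Real.log (|w| + 4) * ‖𝓕 f w‖ ≤ C * (p * √T * Real.log (T + 4)) := by
  obtain ⟨C, hC, h⟩ := exists_integral_log_sq_div_le
  refine ⟨C + 2, by positivity, fun f T p h₁ h₂ hT hp hf hf' => ?_⟩
  have hT0 : 0 < T := by linarith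
  obtain ⟨hi, hle⟩ := h T hT
  obtain ⟨hi0, he0⟩ := h₁.integral_norm_sq_fourier h₂
  obtain ⟨hi1, he1⟩ := h₁.integral_sq_mul_norm_sq_fourier h₂
  have hL : 1 ≤ Real.log (T + 4) := by
    simpa [abs_of_pos hT0] using one_le_log_abs_add_four T
  set lam := p / (√T * Real.log (T + 4)) with hlam
  have hs : 0 < √T := Real.sqrt_pos.2 hT0
  have hlam0 : 0 < lam := by positivity
  have hpt : ∀ w : ℝ, Real.log (|w| + 4) * ‖𝓕 f w‖ ≤
      lam * (Real.log (|w| + 4) ^ 2 / (1 + (w / T) ^ 2)) + 1 / lam * (‖𝓕 f w‖ ^ 2 +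
        1 / T ^ 2 * ((2 * Real.pi * w) ^ 2 * ‖𝓕 f w‖ ^ 2)) := by
    intro w
    have hq : 0 < 1 + (w / T) ^ 2 := by positivity
    set q := 1 + (w / T) ^ 2 with hq'
    set a := Real.log (|w| + 4)
    set y := ‖𝓕 f w‖
    have h1 : a * y ≤ lam * (a ^ 2 / q) + 1 / lam * (q * y ^ 2) := by
      have e : lam * (a ^ 2 / q) + 1 / lam * (q * y ^ 2) - 2 * (a * y) =
          (lam * a - q * y) ^ 2 / (lam * q) := by
        field_simp
        ring
      have h0 : 0 ≤ (lam * a - q * y) ^ 2 / (lam * q) := by positivity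
      have ha : 0 ≤ a * y := mul_nonneg
        (by have := one_le_log_abs_add_four w; positivity) (norm_nonneg _)
      linarith
    have h2 : q * y ^ 2 ≤ y ^ 2 + 1 / T ^ 2 * ((2 * Real.pi * w) ^ 2 * y ^ 2) := by
      have h3 : (1 : ℝ) ≤ (2 * Real.pi) ^ 2 := by nlinarith [Real.pi_gt_three]
      have e : y ^ 2 + 1 / T ^ 2 * ((2 * Real.pi * w) ^ 2 * y ^ 2) - q * y ^ 2 =
          ((2 * Real.pi) ^ 2 - 1) * ((w / T) ^ 2 * y ^ 2) := by
        rw [hq']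
        field_simp
        ring
      have : 0 ≤ ((2 * Real.pi) ^ 2 - 1) * ((w / T) ^ 2 * y ^ 2) :=
        mul_nonneg (by linarith) (by positivity)
      linarith
    have h3 : 1 / lam * (q * y ^ 2) ≤
        1 / lam * (y ^ 2 + 1 / T ^ 2 * ((2 * Real.pi * w) ^ 2 * y ^ 2)) := by gcongr
    linarith
  have hfc : Continuous (𝓕 f) := by
    have := (𝓕 (h₁.toSchwartzMap h₂)).continuous
    rw [SchwartzMap.fourier_coe] at this
    exact this
  have hA := hi.const_mul lam
  have hB1 := hi1.const_mul (1 / T ^ 2)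
  have hB := (hi0.add hB1).const_mul (1 / lam)
  have hintg : Integrable (fun w => Real.log (|w| + 4) * ‖𝓕 f w‖) := by
    refine (hA.add hB).mono' (continuous_log_abs_add_four.mul hfc.norm).aestronglyMeasurable
      (Filter.Eventually.of_forall fun w => ?_)
    have := one_le_log_abs_add_four w
    rw [Real.norm_of_nonneg (by positivity)]
    exact hpt w
  refine ⟨hintg, (integral_mono hintg (hA.add hB) hpt).trans ?_⟩
  simp only [Pi.add_apply] at hB ⊢
  rw [integral_add hA hB, integral_const_mul, integral_const_mul, integral_add hi0 hB1,
    integral_const_mul, he0, he1]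
  have h4 : lam * (∫ w : ℝ, Real.log (|w| + 4) ^ 2 / (1 + (w / T) ^ 2)) ≤
      C * (p * √T * Real.log (T + 4)) := by
    calc _ ≤ lam * (C * (T * Real.log (T + 4) ^ 2)) := by gcongr
      _ = _ := by
        rw [hlam]
        have : T = √T * √T := (Real.mul_self_sqrt hT0.le).symm
        field_simp
        rw [Real.sq_sqrt hT0.le]
  have h5 : 1 / lam * ((∫ x, ‖f x‖ ^ 2) + 1 / T ^ 2 * ∫ x, ‖deriv f x‖ ^ 2) ≤
      2 * (p * √T * Real.log (T + 4)) := by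
    calc _ ≤ 1 / lam * (p ^ 2 + 1 / T ^ 2 * (T * p) ^ 2) := by gcongr
      _ = _ := by
        rw [hlam]
        field_simp
        ring
  linarith

lemma HasCompactSupport.integrable_norm_sq {f : ℝ → ℂ} (h : HasCompactSupport f)
    (hc : Continuous f) : Integrable fun y => ‖f y‖ ^ 2 := by
  refine (hc.norm.pow 2).integrable_of_hasCompactSupport ?_
  refine h.mono fun x hx => ?_
  rw [Function.mem_support] at hx ⊢
  contrapose! hx
  simp [hx]

lemma mul_id_integral_bounds {ψ : ℝ → ℂ} {T p : ℝ} (hψ : ContDiff ℝ ∞ ψ)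
    (h0 : ∀ y ≤ 0, ψ y = 0) (h4 : ∀ y, Real.log 4 ≤ y → ψ y = 0) (hT : 1 ≤ T)
    (hψ2 : ∫ y, ‖ψ y‖ ^ 2 ≤ p ^ 2) (hψ'2 : ∫ y, ‖deriv ψ y‖ ^ 2 ≤ 3 * (T * p) ^ 2) :
    HasCompactSupport ψ ∧ HasCompactSupport (fun y : ℝ => (-2 * Real.pi * I * y) * ψ y) ∧
    ContDiff ℝ ∞ (fun y : ℝ => (-2 * Real.pi * I * y) * ψ y) ∧
    ∫ y : ℝ, ‖(-2 * Real.pi * I * y) * ψ y‖ ^ 2 ≤ (40 * p) ^ 2 ∧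
    ∫ y, ‖deriv (fun y : ℝ => (-2 * Real.pi * I * y) * ψ y) y‖ ^ 2 ≤ (T * (40 * p)) ^ 2 := by
  have hlog4 : Real.log 4 ≤ 2 := by
    have : Real.log 4 = 2 * Real.log 2 := by
      rw [show (4 : ℝ) = 2 ^ 2 by norm_num, Real.log_pow]
      norm_num
    have := Real.log_two_lt_d9
    linarith
  have hcs : HasCompactSupport ψ := HasCompactSupport.intro (isCompact_Icc (a := 0)
    (b := Real.log 4)) fun x hx => by
      rw [Set.mem_Icc, not_and_or, not_le, not_le] at hx
      rcases hx with hx | hx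
      · exact h0 x hx.le
      · exact h4 x hx.le
  obtain ⟨χ, hχ⟩ : ∃ χ : ℝ → ℂ, χ = fun y : ℝ => (-2 * Real.pi * I * y) * ψ y := ⟨_, rfl⟩
  have hχs : ContDiff ℝ ∞ χ := hχ ▸ (contDiff_const.mul ofRealCLM.contDiff).mul hψ
  have hχcs : HasCompactSupport χ := hχ ▸ hcs.mul_left
  have hψc := hψ.continuous
  have hψd := (contDiff_infty_iff_deriv.1 hψ).1
  have hψ'c : Continuous (deriv ψ) := (contDiff_infty_iff_deriv.1 hψ).2.continuous
  have hdχ : ∀ y, deriv χ y = (-2 * Real.pi * I) * ψ y + (-2 * Real.pi * I * y) * deriv ψ y := by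
    intro y
    have h1 : HasDerivAt (fun y : ℝ => (-2 * Real.pi * I * y : ℂ)) (-2 * Real.pi * I) y := by
      simpa using (ofRealCLM.hasDerivAt (x := y)).const_mul (-2 * Real.pi * I : ℂ)
    rw [hχ]
    exact (h1.mul (hψd y).hasDerivAt).deriv
  have hpi : (2 * Real.pi) ^ 2 ≤ 40 := by nlinarith [Real.pi_lt_d2, Real.pi_gt_three]
  have hn : ‖(-2 * Real.pi * I : ℂ)‖ ^ 2 ≤ 40 := by
    simpa [mul_pow, abs_of_pos Real.pi_pos] using hpi
  have hy4 : ∀ y : ℝ, ∀ z : ℂ, (y < 0 ∨ Real.log 4 < y → z = 0) →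
      ‖(-2 * Real.pi * I * y : ℂ) * z‖ ^ 2 ≤ 160 * ‖z‖ ^ 2 := by
    intro y z hz
    by_cases hy : y < 0 ∨ Real.log 4 < y
    · simp [hz hy]
    · rw [not_or, not_lt, not_lt] at hy
      have h2 : y ^ 2 ≤ 4 := by nlinarith
      rw [norm_mul, norm_mul, mul_pow, mul_pow, norm_real, Real.norm_eq_abs, sq_abs]
      have : ‖(-2 * Real.pi * I : ℂ)‖ ^ 2 * y ^ 2 ≤ 40 * 4 := by gcongr
      have h3 : 0 ≤ ‖z‖ ^ 2 := by positivity
      nlinarith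
  have hψz : ∀ y, (y < 0 ∨ Real.log 4 < y → ψ y = 0) := by
    rintro y (h | h)
    · exact h0 y h.le
    · exact h4 y h.le
  have hψ'z : ∀ y, (y < 0 ∨ Real.log 4 < y → deriv ψ y = 0) := by
    rintro y (h | h)
    · have : ψ =ᶠ[nhds y] fun _ => 0 := by
        filter_upwards [Iio_mem_nhds h] with x hx
        exact h0 x (le_of_lt hx)
      rw [this.deriv_eq, deriv_const]
    · have : ψ =ᶠ[nhds y] fun _ => 0 := by
        filter_upwards [Ioi_mem_nhds h] with x hx
        exact h4 x (le_of_lt hx)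
      rw [this.deriv_eq, deriv_const]
  have hi0 := hcs.integrable_norm_sq hψc
  have hi1 := hcs.deriv.integrable_norm_sq hψ'c
  have hT0 : 0 < T := by linarith
  have hTp : p ^ 2 ≤ (T * p) ^ 2 := by
    rw [mul_pow]
    nlinarith [sq_nonneg p, sq_nonneg (T - 1)]
  have hχ2 : ∫ y, ‖χ y‖ ^ 2 ≤ (40 * p) ^ 2 := by
    calc _ ≤ ∫ y, 160 * ‖ψ y‖ ^ 2 := integral_mono_of_nonneg
          (Filter.Eventually.of_forall fun y => by positivity) (hi0.const_mul _)
          (Filter.Eventually.of_forall fun y => by rw [hχ]; exact hy4 y _ (hψz y))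
      _ ≤ 160 * p ^ 2 := by
        rw [integral_const_mul]
        gcongr
      _ ≤ _ := by nlinarith [sq_nonneg p]
  have hχ'2 : ∫ y, ‖deriv χ y‖ ^ 2 ≤ (T * (40 * p)) ^ 2 := by
    calc _ ≤ ∫ y, (80 * ‖ψ y‖ ^ 2 + 320 * ‖deriv ψ y‖ ^ 2) := by
          refine integral_mono_of_nonneg
            (Filter.Eventually.of_forall fun y => by positivity)
            ((hi0.const_mul _).add (hi1.const_mul _)) (Filter.Eventually.of_forall fun y => ?_)
          simp only
          rw [hdχ]
          have ha : ‖(-2 * Real.pi * I : ℂ) * ψ y‖ ^ 2 ≤ 40 * ‖ψ y‖ ^ 2 := by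
            rw [norm_mul, mul_pow]
            gcongr
          have hb := hy4 y _ (hψ'z y)
          set A := (-2 * Real.pi * I : ℂ) * ψ y
          set B := (-2 * Real.pi * I * y : ℂ) * deriv ψ y
          have h := norm_add_le A B
          nlinarith [sq_nonneg (‖A‖ - ‖B‖), norm_nonneg (A + B)]
      _ ≤ 80 * p ^ 2 + 320 * (3 * (T * p) ^ 2) := by
        rw [integral_add (hi0.const_mul _) (hi1.const_mul _), integral_const_mul,
          integral_const_mul]
        gcongr
      _ ≤ _ := by nlinarith [sq_nonneg p]
  rw [← hχ]
  refine ⟨hcs, hχcs, hχs, ?_, hχ'2⟩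
  rwa [hχ] at hχ2

lemma exists_norm_sum_vonMangoldt_log_sub_integral_le (hRH : RiemannHypothesis) :
    ∃ C > (0 : ℝ), ∀ (ψ : ℝ → ℂ) (y₀ T p : ℝ) (b : ℕ), ContDiff ℝ ∞ ψ → 0 ≤ y₀ →
      (∀ y ≤ 0, ψ y = 0) → (∀ y, Real.log 4 ≤ y → ψ y = 0) → 1 ≤ T → 0 < p →
      ∫ y, ‖ψ y‖ ^ 2 ≤ p ^ 2 → ∫ y, ‖deriv ψ y‖ ^ 2 ≤ 3 * (T * p) ^ 2 →
      Real.log 4 + y₀ ≤ Real.log b →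
      ‖∑ n ∈ Finset.Icc 1 b, (ArithmeticFunction.vonMangoldt n : ℂ) / (n : ℂ) ^ (1 / 2 : ℂ) *
        ψ (Real.log n - y₀) -
        ∫ y in Set.Ioc 0 (Real.log b), ψ (y - y₀) * exp ((1 - 1 / 2) * y)‖ ≤
      C * (p * √T * Real.log (T + 4)) := by
  obtain ⟨C₁, hC₁, hE⟩ := exists_norm_sum_vonMangoldt_sub_integral_le hRH
  obtain ⟨C₂, hC₂, hF⟩ := exists_integral_log_mul_norm_fourier_le
  refine ⟨C₁ * (56 * C₂), by positivity, ?_⟩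
  intro ψ y₀ T p b hψ hy₀ h0 h4 hT hp hψ2 hψ'2 hb
  obtain ⟨hcs, hχcs, hχs, hχ2, hχ'2⟩ := mul_id_integral_bounds hψ h0 h4 hT hψ2 hψ'2
  have hψc := hψ.continuous
  obtain ⟨χ, hχ⟩ : ∃ χ : ℝ → ℂ, χ = fun y : ℝ => (-2 * Real.pi * I * y) * ψ y := ⟨_, rfl⟩
  rw [← hχ] at hχcs hχs hχ'2
  replace hχ2 : ∫ y, ‖χ y‖ ^ 2 ≤ (40 * p) ^ 2 := by
    rw [hχ]
    exact hχ2
  obtain ⟨hI1, hB1⟩ := hF ψ T (2 * p) hcs hψ hT (by positivity) (by nlinarith [sq_nonneg p])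
    (by nlinarith [sq_nonneg (T * p)])
  obtain ⟨hI2, hB2⟩ := hF χ T (40 * p) hχcs hχs hT (by positivity) hχ2 hχ'2
  have hψi : Integrable ψ := hψc.integrable_of_hasCompactSupport hcs
  have hS : 𝓕 ψ = 𝓕 (hcs.toSchwartzMap hψ) := by
    rw [SchwartzMap.fourier_coe]
    rfl
  have hSc : Continuous (𝓕 ψ) := by
    rw [hS]
    exact (𝓕 (hcs.toSchwartzMap hψ)).continuous
  have hSi : Integrable (𝓕 ψ) := by
    rw [hS]
    exact (𝓕 (hcs.toSchwartzMap hψ)).integrable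
  have hSi' : Integrable fun w : ℝ => w * 𝓕 ψ w := by
    have h := (𝓕 (hcs.toSchwartzMap hψ)).integrable_pow_mul volume 1
    rw [← hS] at h
    refine h.mono' (continuous_ofReal.mul hSc).aestronglyMeasurable
      (Filter.Eventually.of_forall fun w => ?_)
    simp
  have hexp : ∀ w : ℝ, ‖exp (-(2 * Real.pi * I * w * y₀))‖ = 1 := by
    intro w
    have := norm_exp_two_pi_I_mul (-w) y₀
    push_cast at this
    rw [← this]
    congr 2
    ring
  have hexpc : Continuous fun w : ℝ => exp (-(2 * Real.pi * I * w * y₀)) := by fun_prop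
  have hsum : (fun w => Real.log (|w| + 4) * (8 * ‖𝓕 ψ w‖ + ‖𝓕 χ w‖)) = fun w =>
      8 * (Real.log (|w| + 4) * ‖𝓕 ψ w‖) + Real.log (|w| + 4) * ‖𝓕 χ w‖ := by
    funext w
    ring
  have hmain := hE (fun w => exp (-(2 * Real.pi * I * w * y₀)) * 𝓕 ψ w) (fun x => ψ (x - y₀))
    (𝓕 ψ) (𝓕 χ) b (hexpc.mul hSc)
    (hSi.norm.mono' (hexpc.mul hSc).aestronglyMeasurable
      (Filter.Eventually.of_forall fun w => by rw [norm_mul, hexp, one_mul]))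
    (by
      refine hSi'.norm.mono' (continuous_ofReal.mul (hexpc.mul hSc)).aestronglyMeasurable
        (Filter.Eventually.of_forall fun w => ?_)
      rw [norm_mul, norm_mul, norm_mul, hexp, one_mul])
    (by
      intro x
      have h := congrFun (hψc.fourierInv_fourier_eq hψi hSi) (x - y₀)
      rw [← h, Real.fourierInv_eq']
      congr 1
      funext w
      rw [smul_eq_mul, mul_right_comm (exp (-(2 * Real.pi * I * w * y₀))), ← exp_add]
      congr 2
      simp
      ring)
    (fun x hx => h4 _ (by linarith)) (fun x hx => h0 _ (by linarith))
    (fun w => by rw [norm_mul, hexp, one_mul])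
    (fun w => by
      have := Real.hasDerivAt_fourier hψi (by
        refine (continuous_id.smul hψc).integrable_of_hasCompactSupport ?_
        exact hcs.smul_left) w
      rw [hχ]
      simpa only [smul_eq_mul] using this)
    (by
      have : 𝓕 χ = 𝓕 (hχcs.toSchwartzMap hχs) := by
        rw [SchwartzMap.fourier_coe]
        rfl
      rw [this]
      exact (𝓕 (hχcs.toSchwartzMap hχs)).continuous)
    (by
      rw [hsum]
      exact (hI1.const_mul 8).add hI2)
  refine hmain.trans ?_
  rw [mul_assoc, hsum, integral_add (hI1.const_mul 8) hI2, integral_const_mul]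
  gcongr
  linarith

lemma integral_Ioi_eq_integral_exp_mul (g : ℝ → ℝ) :
    ∫ x in Set.Ioi 0, g x = ∫ y, Real.exp y * g (Real.exp y) := by
  rw [← Real.range_exp, ← Set.image_univ, integral_image_eq_integral_abs_deriv_smul
    MeasurableSet.univ (fun x _ => (Real.hasDerivAt_exp x).hasDerivWithinAt)
    Real.exp_injective.injOn, setIntegral_univ]
  simp [Real.abs_exp]

lemma integral_Ioc_one_eq_integral_exp_mul (g : ℝ → ℂ) {b : ℝ} (hb : 1 ≤ b) :
    ∫ x in Set.Ioc 1 b, g x = ∫ y in Set.Ioc 0 (Real.log b), (Real.exp y : ℂ) * g (Real.exp y) := by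
  have : Set.Ioc 1 b = Real.exp '' Set.Ioc 0 (Real.log b) := by
    have := Real.expOrderIso.image_Ioc 0 (Real.log b)
    ext x
    simp only [Set.mem_Ioc, Set.mem_image]
    constructor
    · rintro ⟨h1, h2⟩
      exact ⟨Real.log x, ⟨Real.log_pos h1, Real.log_le_log (by linarith) h2⟩,
        Real.exp_log (by linarith)⟩
    · rintro ⟨y, ⟨h1, h2⟩, rfl⟩
      exact ⟨Real.one_lt_exp_iff.2 h1, (Real.le_log_iff_exp_le (by linarith)).1 h2⟩
  rw [this, integral_image_eq_integral_abs_deriv_smul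
    measurableSet_Ioc (fun x _ => (Real.hasDerivAt_exp x).hasDerivWithinAt)
    Real.exp_injective.injOn]
  simp [Real.abs_exp]

/-- The error in the prime number theorem with weight `f`, for `f` vanishing beyond `b`. -/
noncomputable def vonMangoldtError (b : ℕ) (f : ℝ → ℂ) : ℂ :=
  ∑ n ∈ Finset.Icc 1 b, (ArithmeticFunction.vonMangoldt n : ℂ) * f n - ∫ x in Set.Ioc 0 (b : ℝ), f x

/-- Under RH, the prime number theorem error for a smooth weight in a dyadic range, in terms of
`L²` norms of the weight and its derivative. -/
lemma exists_norm_vonMangoldtError_le (hRH : RiemannHypothesis) :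
    ∃ C > (0 : ℝ), ∀ (f : ℝ → ℂ) (a T p : ℝ) (b : ℕ), ContDiff ℝ ∞ f → 1 ≤ a →
      (∀ x ≤ a, f x = 0) → (∀ x, 4 * a ≤ x → f x = 0) → 1 ≤ T → 0 < p →
      ∫ x, ‖f x‖ ^ 2 ≤ p ^ 2 → ∫ x, ‖x * deriv f x‖ ^ 2 ≤ (T * p) ^ 2 → 4 * a ≤ b →
      ‖vonMangoldtError b f‖ ≤ C * (p * √T * Real.log (T + 4)) := by
  obtain ⟨C, hC, h⟩ := exists_norm_sum_vonMangoldt_log_sub_integral_le hRH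
  refine ⟨C, hC, ?_⟩
  intro f a T p b hf ha h0 h4 hT hp hf2 hf'2 hb
  have ha0 : 0 < a := by linarith
  have hb1 : (1 : ℝ) ≤ b := by linarith
  have hcs : HasCompactSupport f := HasCompactSupport.intro (isCompact_Icc (a := a)
    (b := 4 * a)) fun x hx => by
      rw [Set.mem_Icc, not_and_or, not_le, not_le] at hx
      rcases hx with hx | hx
      · exact h0 x hx.le
      · exact h4 x hx.le
  have hfd := (contDiff_infty_iff_deriv.1 hf).1
  have hf'c : Continuous (deriv f) := (contDiff_infty_iff_deriv.1 hf).2.continuous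
  obtain ⟨φ, hφ⟩ : ∃ φ : ℝ → ℂ, φ = fun x => (Real.exp (x / 2) : ℂ) * f (Real.exp x) := ⟨_, rfl⟩
  have hφs : ContDiff ℝ ∞ φ := by
    rw [hφ]
    exact (ofRealCLM.contDiff.comp (Real.contDiff_exp.comp (contDiff_id.div_const 2))).mul
      (hf.comp Real.contDiff_exp)
  have hφd : ∀ x, deriv φ x = 1 / 2 * φ x +
      (Real.exp (x / 2) : ℂ) * ((Real.exp x : ℝ) * deriv f (Real.exp x)) := by
    intro x
    rw [hφ]
    have h1 : HasDerivAt (fun x : ℝ => Real.exp (x / 2)) (Real.exp (x / 2) * (1 / 2)) x :=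
      ((hasDerivAt_id x).div_const 2).exp
    have h2 : HasDerivAt (fun x => f (Real.exp x)) (Real.exp x • deriv f (Real.exp x)) x :=
      (hfd (Real.exp x)).hasDerivAt.scomp x (Real.hasDerivAt_exp x)
    rw [(h1.ofReal_comp.fun_mul h2).deriv]
    push_cast
    rw [real_smul]
    push_cast
    ring
  have hexp2 : ∀ x : ℝ, ‖(Real.exp (x / 2) : ℂ)‖ ^ 2 = Real.exp x := by
    intro x
    rw [norm_real, Real.norm_of_nonneg (Real.exp_nonneg _), ← Real.exp_nat_mul]
    congr 1
    push_cast
    ring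
  have hsub : ∀ g : ℝ → ℂ, Continuous g → HasCompactSupport g → ∀ q : ℝ, ∫ x, ‖g x‖ ^ 2 ≤ q →
      ∫ x : ℝ, ‖(Real.exp (x / 2) : ℂ) * g (Real.exp x)‖ ^ 2 ≤ q := by
    intro g hg hgs q hq
    simp_rw [norm_mul, mul_pow, hexp2]
    rw [← integral_Ioi_eq_integral_exp_mul (fun x => ‖g x‖ ^ 2)]
    exact (setIntegral_le_integral (hgs.integrable_norm_sq hg)
      (Filter.Eventually.of_forall fun x => by positivity)).trans hq
  have hφ2 : ∫ x, ‖φ x‖ ^ 2 ≤ p ^ 2 := by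
    rw [hφ]
    exact hsub f hf.continuous hcs _ hf2
  have hg2 := hsub (fun x => x * deriv f x) (continuous_ofReal.mul hf'c) hcs.deriv.mul_left _ hf'2
  have hφ0 : ∀ x ≤ Real.log a, φ x = 0 := by
    intro x hx
    simp only [hφ]
    rw [h0, mul_zero]
    rwa [← Real.le_log_iff_exp_le ha0]
  have hφ4 : ∀ x, Real.log 4 + Real.log a ≤ x → φ x = 0 := by
    intro x hx
    simp only [hφ]
    rw [h4, mul_zero]
    rwa [← Real.log_le_iff_le_exp (by positivity), Real.log_mul (by norm_num) ha0.ne']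
  have hφcs : HasCompactSupport φ := HasCompactSupport.intro (isCompact_Icc (a := Real.log a)
    (b := Real.log 4 + Real.log a)) fun x hx => by
      rw [Set.mem_Icc, not_and_or, not_le, not_le] at hx
      rcases hx with hx | hx
      · exact hφ0 x hx.le
      · exact hφ4 x hx.le
  have hφ'c : Continuous (deriv φ) := (contDiff_infty_iff_deriv.1 hφs).2.continuous
  have hTp : p ^ 2 ≤ (T * p) ^ 2 := by
    rw [mul_pow]
    nlinarith [sq_nonneg p, sq_nonneg (T - 1)]
  obtain ⟨γ, hγ⟩ : ∃ γ : ℝ → ℂ, γ = fun x : ℝ =>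
    (Real.exp (x / 2) : ℂ) * ((Real.exp x : ℝ) * deriv f (Real.exp x)) := ⟨_, rfl⟩
  have hγe : ∀ x, γ x = deriv φ x - 1 / 2 * φ x := by
    intro x
    rw [hφd, hγ]
    ring
  have hγc : Continuous γ := by
    rw [funext hγe]
    exact hφ'c.sub (continuous_const.mul hφs.continuous)
  have hγcs : HasCompactSupport γ := by
    rw [funext hγe]
    exact hφcs.deriv.sub hφcs.mul_left
  have hi0 := hφcs.integrable_norm_sq hφs.continuous
  have hi1 := hγcs.integrable_norm_sq hγc
  have hφ'2 : ∫ x, ‖deriv φ x‖ ^ 2 ≤ 3 * (T * p) ^ 2 := by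
    calc _ ≤ ∫ x, (1 / 2 * ‖φ x‖ ^ 2 + 2 * ‖γ x‖ ^ 2) := by
          refine integral_mono_of_nonneg (Filter.Eventually.of_forall fun y => by positivity)
            ((hi0.const_mul _).add (hi1.const_mul _)) (Filter.Eventually.of_forall fun y => ?_)
          have e : deriv φ y = 1 / 2 * φ y + γ y := by
            rw [hγe]
            ring
          simp only
          rw [e]
          have h := norm_add_le (1 / 2 * φ y) (γ y)
          have h' : ‖1 / 2 * φ y‖ = 1 / 2 * ‖φ y‖ := by
            rw [norm_mul]
            norm_num
          rw [h'] at h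
          nlinarith [sq_nonneg (1 / 2 * ‖φ y‖ - ‖γ y‖), norm_nonneg (1 / 2 * φ y + γ y)]
      _ = 1 / 2 * (∫ x, ‖φ x‖ ^ 2) + 2 * ∫ x, ‖γ x‖ ^ 2 := by
        rw [integral_add (hi0.const_mul _) (hi1.const_mul _), integral_const_mul,
          integral_const_mul]
      _ ≤ 1 / 2 * p ^ 2 + 2 * (T * p) ^ 2 := by
        gcongr
        rw [hγ]
        exact hg2
      _ ≤ _ := by nlinarith
  have hlb : Real.log 4 + Real.log a ≤ Real.log b := by
    rw [← Real.log_mul (by norm_num) ha0.ne']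
    exact Real.log_le_log (by positivity) hb
  have key := h (fun y => φ (y + Real.log a)) (Real.log a) T p b
    (hφs.comp (contDiff_id.add contDiff_const)) (Real.log_nonneg ha)
    (fun y hy => hφ0 _ (by linarith)) (fun y hy => hφ4 _ (by linarith)) hT hp
    (by rwa [integral_add_right_eq_self (fun y => ‖φ y‖ ^ 2)])
    (by
      simp_rw [deriv_comp_add_const]
      rwa [integral_add_right_eq_self (fun y => ‖deriv φ y‖ ^ 2)]) hlb
  simp only [sub_add_cancel] at key
  have e1 : ∑ n ∈ Finset.Icc 1 b, (ArithmeticFunction.vonMangoldt n : ℂ) / (n : ℂ) ^ (1 / 2 : ℂ) *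
      φ (Real.log n) = ∑ n ∈ Finset.Icc 1 b, (ArithmeticFunction.vonMangoldt n : ℂ) * f n := by
    refine Finset.sum_congr rfl fun n hn => ?_
    have hn0 : 0 < n := (Finset.mem_Icc.1 hn).1
    have hn0' : (0 : ℝ) < n := by exact_mod_cast hn0
    have hnc : (n : ℂ) ≠ 0 := by exact_mod_cast hn0.ne'
    have e : ((Real.exp (Real.log n / 2) : ℝ) : ℂ) = (n : ℂ) ^ (1 / 2 : ℂ) := by
      rw [cpow_def_of_ne_zero hnc, ofReal_exp, ← natCast_log]
      push_cast
      congr 1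
      ring
    have hne : (n : ℂ) ^ (1 / 2 : ℂ) ≠ 0 := by
      rw [cpow_def_of_ne_zero hnc]
      exact exp_ne_zero _
    rw [hφ]
    simp only
    rw [e, Real.exp_log hn0']
    field_simp
  have e2 : ∫ y in Set.Ioc 0 (Real.log b), φ y * exp ((1 - 1 / 2) * y) =
      ∫ x in Set.Ioc 0 (b : ℝ), f x := by
    have e3 : ∫ x in Set.Ioc 0 (b : ℝ), f x = ∫ x in Set.Ioc 1 (b : ℝ), f x := by
      refine setIntegral_eq_of_subset_of_forall_sdiff_eq_zero measurableSet_Ioc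
        (Set.Ioc_subset_Ioc_left zero_le_one) fun x hx => h0 x ?_
      have := hx.2
      simp only [Set.mem_Ioc, not_and, not_le] at this
      by_contra! hc
      have := this (by linarith)
      linarith [hx.1.2]
    rw [e3, integral_Ioc_one_eq_integral_exp_mul f hb1]
    congr 1
    funext y
    rw [hφ]
    simp only
    rw [mul_right_comm, ofReal_exp, ofReal_exp, ← exp_add]
    congr 2
    push_cast
    ring
  rw [e1, e2] at key
  exact key

/-- A smooth cutoff, equal to `1` up to `X` and to `0` from `X + η` on. -/
noncomputable def smoothCut (X η x : ℝ) : ℝ := Real.smoothTransition ((X + η - x) / η)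

lemma contDiff_smoothCut (X η : ℝ) : ContDiff ℝ ∞ (smoothCut X η) :=
  Real.smoothTransition.contDiff.comp ((contDiff_const.sub contDiff_id).div_const _)

lemma smoothCut_nonneg (X η x : ℝ) : 0 ≤ smoothCut X η x := Real.smoothTransition.nonneg _

lemma smoothCut_le_one (X η x : ℝ) : smoothCut X η x ≤ 1 := Real.smoothTransition.le_one _

lemma smoothCut_of_le {X η x : ℝ} (hη : 0 < η) (h : x ≤ X) : smoothCut X η x = 1 :=
  Real.smoothTransition.one_of_one_le ((one_le_div hη).2 (by linarith))

lemma smoothCut_of_ge {X η x : ℝ} (hη : 0 < η) (h : X + η ≤ x) : smoothCut X η x = 0 :=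
  Real.smoothTransition.zero_of_nonpos (div_nonpos_of_nonpos_of_nonneg (by linarith) hη.le)

lemma abs_smoothCut_sub_le (X η X' η' x : ℝ) : |smoothCut X η x - smoothCut X' η' x| ≤ 1 := by
  have h1 := smoothCut_nonneg X η x
  have h2 := smoothCut_le_one X η x
  have h3 := smoothCut_nonneg X' η' x
  have h4 := smoothCut_le_one X' η' x
  rw [abs_le]
  constructor <;> linarith

lemma exists_abs_deriv_smoothCut_le : ∃ M ≥ (1 : ℝ), ∀ X η x : ℝ, 0 < η →
    |deriv (smoothCut X η) x| ≤ M / η := by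
  have hs : ContDiff ℝ ∞ Real.smoothTransition := Real.smoothTransition.contDiff
  have hc : Continuous (deriv Real.smoothTransition) := (contDiff_infty_iff_deriv.1 hs).2.continuous
  obtain ⟨M, hM⟩ := (isCompact_Icc (a := (0 : ℝ)) (b := 1)).exists_bound_of_continuousOn
    hc.continuousOn
  have hM' : ∀ x, |deriv Real.smoothTransition x| ≤ max M 1 := by
    intro x
    by_cases hx : x ∈ Set.Icc (0 : ℝ) 1
    · exact (hM x hx).trans (le_max_left _ _)
    · rw [Set.mem_Icc, not_and_or, not_le, not_le] at hx
      have : deriv Real.smoothTransition x = 0 := by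
        rcases hx with hx | hx
        · have : Real.smoothTransition =ᶠ[nhds x] fun _ => 0 := by
            filter_upwards [Iio_mem_nhds hx] with y hy
            exact Real.smoothTransition.zero_of_nonpos (le_of_lt hy)
          rw [this.deriv_eq, deriv_const]
        · have : Real.smoothTransition =ᶠ[nhds x] fun _ => 1 := by
            filter_upwards [Ioi_mem_nhds hx] with y hy
            exact Real.smoothTransition.one_of_one_le (le_of_lt hy)
          rw [this.deriv_eq, deriv_const]
      rw [this, abs_zero]
      positivity
  refine ⟨max M 1, le_max_right _ _, fun X η x hη => ?_⟩
  have h1 : HasDerivAt (fun x => (X + η - x) / η) (-1 / η) x := by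
    simpa using ((hasDerivAt_id x).const_sub (X + η)).div_const η
  have h2 := ((contDiff_infty_iff_deriv.1 hs).1 ((X + η - x) / η)).hasDerivAt.comp x h1
  have h3 : deriv (smoothCut X η) x = _ := h2.deriv
  rw [h3, abs_mul, abs_div, abs_neg, abs_one, abs_of_pos hη, mul_one_div]
  gcongr
  exact hM' _

/-- The prime number theorem error for a weight cut off to a range, under RH. -/
lemma exists_norm_vonMangoldtError_mul_le (hRH : RiemannHypothesis) :
    ∃ C > (0 : ℝ), ∀ (F : ℝ → ℂ) (g : ℝ → ℝ) (a u v K θ P T : ℝ) (b : ℕ), ContDiff ℝ ∞ F →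
      ContDiff ℝ ∞ g → 1 ≤ a → a ≤ u → u ≤ v → v ≤ 4 * a → (∀ x ≤ u, g x = 0) →
      (∀ x, v ≤ x → g x = 0) → (∀ x, |g x| ≤ 1) → (∀ x, |deriv g x| ≤ K) → 0 ≤ θ → 0 < P →
      ∫ x in u..v, ‖F x‖ ^ 2 ≤ P → ∫ x in u..v, ‖deriv F x‖ ^ 2 ≤ θ ^ 2 * P →
      1 + 6 * a * (K + θ) ≤ T → 4 * a ≤ b →
      ‖vonMangoldtError b (fun x => g x * F x)‖ ≤ C * (√(P * T) * Real.log (T + 4)) := by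
  obtain ⟨C, hC, h⟩ := exists_norm_vonMangoldtError_le hRH
  refine ⟨C, hC, ?_⟩
  intro F g a u v K θ P T b hF hg ha hau huv hva hu hv hg1 hgK hθ hP hF2 hF'2 hT hb
  have hK : 0 ≤ K := (abs_nonneg _).trans (hgK 0)
  have hT1 : 1 ≤ T := by nlinarith [mul_nonneg (by linarith : 0 ≤ a) (add_nonneg hK hθ)]
  have hFd := (contDiff_infty_iff_deriv.1 hF).1
  have hF'c : Continuous (deriv F) := (contDiff_infty_iff_deriv.1 hF).2.continuous
  have hgd := (contDiff_infty_iff_deriv.1 hg).1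
  have hg'c : Continuous (deriv g) := (contDiff_infty_iff_deriv.1 hg).2.continuous
  have hfs : ContDiff ℝ ∞ fun x => (g x : ℂ) * F x := (ofRealCLM.contDiff.comp hg).mul hF
  have hout : ∀ x, x ∉ Set.Icc u v → g x = 0 ∧ deriv g x = 0 := by
    intro x hx
    rw [Set.mem_Icc, not_and_or, not_le, not_le] at hx
    rcases hx with hx | hx
    · have : g =ᶠ[nhds x] fun _ => 0 := by
        filter_upwards [Iio_mem_nhds hx] with y hy
        exact hu y (le_of_lt hy)
      exact ⟨hu x hx.le, by rw [this.deriv_eq, deriv_const]⟩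
    · have : g =ᶠ[nhds x] fun _ => 0 := by
        filter_upwards [Ioi_mem_nhds hx] with y hy
        exact hv y (le_of_lt hy)
      exact ⟨hv x hx.le, by rw [this.deriv_eq, deriv_const]⟩
  have hd : ∀ x, deriv (fun x => (g x : ℂ) * F x) x = deriv g x * F x + g x * deriv F x :=
    fun x => ((hgd x).hasDerivAt.ofReal_comp.mul (hFd x).hasDerivAt).deriv
  have hintg : ∀ q : ℝ → ℝ, (∀ x, x ∉ Set.Icc u v → q x = 0) → ∫ x, q x = ∫ x in u..v, q x := by
    intro q hq
    rw [← setIntegral_eq_integral_of_forall_compl_eq_zero hq, integral_Icc_eq_integral_Ioc,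
      intervalIntegral.integral_of_le huv]
  have hs : √P ^ 2 = P := Real.sq_sqrt hP.le
  have key := h _ a T √P b hfs ha (fun x hx => by rw [hu x (by linarith)]; simp)
    (fun x hx => by rw [hv x (by linarith)]; simp) hT1 (Real.sqrt_pos.2 hP)
    (by
      rw [hintg _ fun x hx => by rw [(hout x hx).1]; simp, hs]
      refine le_trans (intervalIntegral.integral_mono_on huv
        (((continuous_ofReal.comp hg.continuous).mul hF.continuous).norm.pow 2
          |>.intervalIntegrable _ _)
        ((hF.continuous.norm.pow 2).intervalIntegrable _ _) fun x hx => ?_) hF2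
      rw [norm_mul, norm_real, Real.norm_eq_abs]
      exact pow_le_pow_left₀ (by positivity)
        (mul_le_of_le_one_left (norm_nonneg _) (hg1 x)) 2)
    (by
      have hc1 : Continuous fun x => ‖F x‖ ^ 2 := hF.continuous.norm.pow 2
      have hc2 : Continuous fun x => ‖deriv F x‖ ^ 2 := hF'c.norm.pow 2
      have e1 : ∫ x in u..v, (32 * a ^ 2 * K ^ 2 * ‖F x‖ ^ 2 + 32 * a ^ 2 * ‖deriv F x‖ ^ 2) ≤
          (T * √P) ^ 2 := by
        rw [intervalIntegral.integral_add ((hc1.const_mul _).intervalIntegrable _ _)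
          ((hc2.const_mul _).intervalIntegrable _ _), intervalIntegral.integral_const_mul,
          intervalIntegral.integral_const_mul, mul_pow, hs]
        calc _ ≤ 32 * a ^ 2 * K ^ 2 * P + 32 * a ^ 2 * (θ ^ 2 * P) := by gcongr
          _ = (32 * a ^ 2 * (K ^ 2 + θ ^ 2)) * P := by ring
          _ ≤ T ^ 2 * P := by
            gcongr
            have : 6 * a * (K + θ) ≤ T := by linarith
            have h0 : 0 ≤ 6 * a * (K + θ) := by positivity
            have h2 : (6 * a * (K + θ)) ^ 2 ≤ T ^ 2 := by gcongr
            have h3 : 0 ≤ a ^ 2 * (K * θ) := by positivity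
            nlinarith [mul_nonneg (sq_nonneg a) (sq_nonneg K), mul_nonneg (sq_nonneg a)
              (sq_nonneg θ)]
      rw [hintg _ fun x hx => by rw [hd, (hout x hx).1, (hout x hx).2]; simp]
      refine le_trans (intervalIntegral.integral_mono_on huv
        (((continuous_ofReal.mul
          (contDiff_infty_iff_deriv.1 hfs).2.continuous).norm.pow 2).intervalIntegrable _ _)
        (((hc1.const_mul _).add (hc2.const_mul _)).intervalIntegrable _ _) fun x hx => ?_) e1
      rw [hd, norm_mul, norm_real, Real.norm_eq_abs, abs_of_nonneg (by linarith [hx.1])]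
      have hx4 : x ≤ 4 * a := by linarith [hx.2]
      have hx0 : 0 ≤ x := by linarith [hx.1]
      have h1 : ‖((deriv g x : ℝ) : ℂ) * F x + g x * deriv F x‖ ≤ K * ‖F x‖ + ‖deriv F x‖ := by
        refine (norm_add_le _ _).trans ?_
        rw [norm_mul, norm_mul, norm_real, norm_real, Real.norm_eq_abs, Real.norm_eq_abs]
        gcongr
        · exact hgK x
        · exact mul_le_of_le_one_left (norm_nonneg _) (hg1 x)
      calc _ ≤ (4 * a * (K * ‖F x‖ + ‖deriv F x‖)) ^ 2 := by gcongr
        _ ≤ 32 * a ^ 2 * K ^ 2 * ‖F x‖ ^ 2 + 32 * a ^ 2 * ‖deriv F x‖ ^ 2 := by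
          nlinarith [mul_nonneg (sq_nonneg a) (sq_nonneg (K * ‖F x‖ - ‖deriv F x‖))])
    hb
  rw [Real.sqrt_mul hP.le]
  exact key

/-- The Cauchy-Schwarz inequality against a constant. -/
lemma sq_intervalIntegral_le {f : ℝ → ℝ} (hf : Continuous f) {a b : ℝ} (hab : a ≤ b) :
    (∫ x in a..b, f x) ^ 2 ≤ (b - a) * ∫ x in a..b, f x ^ 2 := by
  rcases hab.eq_or_lt with rfl | hab'
  · simp
  have hba : 0 < b - a := sub_pos.2 hab'
  set m := (∫ x in a..b, f x) / (b - a) with hm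
  have h0 : 0 ≤ ∫ x in a..b, (f x ^ 2 - (2 * m * f x - m ^ 2)) :=
    intervalIntegral.integral_nonneg hab fun x _ => by nlinarith [sq_nonneg (f x - m)]
  have h1 := intervalIntegral.integral_sub (μ := volume) (f := fun x => f x ^ 2)
    (g := fun x => 2 * m * f x - m ^ 2) ((hf.pow 2).intervalIntegrable a b)
    (((hf.const_mul _).sub continuous_const).intervalIntegrable _ _)
  have h2 := intervalIntegral.integral_sub (μ := volume) (f := fun x => 2 * m * f x)
    (g := fun _ => m ^ 2) ((hf.const_mul _).intervalIntegrable a b) intervalIntegrable_const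
  rw [h1, h2, intervalIntegral.integral_const_mul, intervalIntegral.integral_const,
    smul_eq_mul] at h0
  have hI : ∫ x in a..b, f x = m * (b - a) := by
    rw [hm]
    field_simp
  rw [hI] at h0 ⊢
  nlinarith

lemma vonMangoldtError_sub {f g : ℝ → ℂ} (hf : Continuous f) (hg : Continuous g) (b : ℕ) :
    vonMangoldtError b (fun x => f x - g x) = vonMangoldtError b f - vonMangoldtError b g := by
  simp only [vonMangoldtError, mul_sub, Finset.sum_sub_distrib]
  rw [integral_sub hf.integrableOn_Ioc hg.integrableOn_Ioc]
  ring

lemma vonMangoldtError_smoothCut_sub {F : ℝ → ℂ} (hF : ContDiff ℝ ∞ F) (X η X' η' : ℝ) (b : ℕ) :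
    vonMangoldtError b (fun x => ((smoothCut X η x - smoothCut X' η' x : ℝ) : ℂ) * F x) =
      vonMangoldtError b (fun x => smoothCut X η x * F x) -
        vonMangoldtError b (fun x => smoothCut X' η' x * F x) := by
  have h := vonMangoldtError_sub (f := fun x => (smoothCut X η x : ℂ) * F x)
    (g := fun x => (smoothCut X' η' x : ℂ) * F x)
    ((continuous_ofReal.comp (contDiff_smoothCut X η).continuous).mul hF.continuous)
    ((continuous_ofReal.comp (contDiff_smoothCut X' η').continuous).mul hF.continuous) b
  rw [← h]
  congr 1
  funext x
  push_cast
  ring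

/-- A weight whose Fourier transform lives at frequencies of size `O(ξ)`, with squared
`L²` norm at most `B`. -/
structure IsBandLimited (F : ℝ → ℂ) (ξ B : ℝ) : Prop where
  contDiff : ContDiff ℝ ∞ F
  norm_sq_le : ∀ x, ‖F x‖ ^ 2 ≤ ξ * B
  norm_deriv_sq_le : ∀ x, ‖deriv F x‖ ^ 2 ≤ ξ ^ 2 * (ξ * B)
  integral_norm_sq_le : ∀ u v, u ≤ v → ∫ x in u..v, ‖F x‖ ^ 2 ≤ B
  integral_norm_deriv_sq_le : ∀ u v, u ≤ v → ∫ x in u..v, ‖deriv F x‖ ^ 2 ≤ ξ ^ 2 * B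

lemma IsBandLimited.integral_norm_sq_le_min {F : ℝ → ℂ} {ξ B : ℝ} (h : IsBandLimited F ξ B)
    {u v : ℝ} (huv : u ≤ v) : ∫ x in u..v, ‖F x‖ ^ 2 ≤ min B ((v - u) * (ξ * B)) := by
  refine le_min (h.integral_norm_sq_le u v huv) ?_
  have := intervalIntegral.integral_mono_on (μ := volume) huv
    ((h.contDiff.continuous.norm.pow 2).intervalIntegrable _ _) intervalIntegrable_const
    (fun x _ => h.norm_sq_le x)
  rwa [intervalIntegral.integral_const, smul_eq_mul] at this

lemma IsBandLimited.integral_norm_deriv_sq_le_min {F : ℝ → ℂ} {ξ B : ℝ} (h : IsBandLimited F ξ B)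
    {u v : ℝ} (huv : u ≤ v) :
    ∫ x in u..v, ‖deriv F x‖ ^ 2 ≤ ξ ^ 2 * min B ((v - u) * (ξ * B)) := by
  rw [mul_min_of_nonneg _ _ (sq_nonneg ξ)]
  refine le_min (h.integral_norm_deriv_sq_le u v huv) ?_
  have := intervalIntegral.integral_mono_on (μ := volume) huv
    (((contDiff_infty_iff_deriv.1 h.contDiff).2.continuous.norm.pow 2).intervalIntegrable _ _)
    intervalIntegrable_const (fun x _ => h.norm_deriv_sq_le x)
  rw [intervalIntegral.integral_const, smul_eq_mul] at this
  exact this.trans_eq (by ring)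

lemma exists_log_add_four_le {A : ℝ} (hA : 0 ≤ A) : ∃ c > (0 : ℝ), ∀ N T : ℝ, 2 ≤ N → 0 ≤ T →
    T ≤ A * N → Real.log (T + 4) ≤ c * Real.log N := by
  have h2 : 0 < Real.log 2 := Real.log_pos (by norm_num)
  have h3 : 0 < Real.log (A + 4) := Real.log_pos (by linarith)
  refine ⟨Real.log (A + 4) / Real.log 2 + 1, by positivity, fun N T hN hT hTA => ?_⟩
  have hL : Real.log 2 ≤ Real.log N := Real.log_le_log (by norm_num) hN
  have h4 : Real.log (T + 4) ≤ Real.log (A + 4) + Real.log N := by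
    rw [← Real.log_mul (by positivity) (by positivity)]
    apply Real.log_le_log (by positivity)
    nlinarith
  have h5 : Real.log (A + 4) ≤ Real.log (A + 4) / Real.log 2 * Real.log N := by
    rw [div_mul_eq_mul_div, le_div_iff₀ h2]
    gcongr
  linarith

/-- The error for a piece of a band-limited weight between two smooth cutoffs. -/
lemma exists_norm_vonMangoldtError_smoothCut_sub_le (hRH : RiemannHypothesis) {A : ℝ}
    (hA : 0 < A) : ∃ C > (0 : ℝ), ∀ (N b : ℕ) (F : ℝ → ℂ) (ξ B : ℝ) (g : ℝ → ℝ)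
      (a u v K Y : ℝ), 2 ≤ N → IsBandLimited F ξ B → 0 < ξ → 0 < B → ContDiff ℝ ∞ g → 1 ≤ a →
      a ≤ u → u < v → v ≤ 4 * a → (∀ x ≤ u, g x = 0) → (∀ x, v ≤ x → g x = 0) →
      (∀ x, |g x| ≤ 1) → (∀ x, |deriv g x| ≤ K) → 1 + 6 * a * (K + ξ) ≤ A * N → 0 ≤ Y →
      min 1 ((v - u) * ξ) * (1 + 6 * a * (K + ξ)) ≤ A * Y → 4 * a ≤ b →
      ‖vonMangoldtError b (fun x => g x * F x)‖ ≤ C * (Real.log N * √(Y * B)) := by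
  obtain ⟨C, hC, h⟩ := exists_norm_vonMangoldtError_mul_le hRH
  obtain ⟨c, hc, hlog⟩ := exists_log_add_four_le hA.le
  refine ⟨C * (√A * c), by positivity, ?_⟩
  intro N b F ξ B g a u v K Y hN hF hξ hB hg ha hau huv hva hu hv hg1 hgK hT hY hPT hb
  have hvu : 0 < v - u := sub_pos.2 huv
  have hK : 0 ≤ K := (abs_nonneg _).trans (hgK 0)
  have hT0 : 0 ≤ 1 + 6 * a * (K + ξ) := by positivity
  have hmin : min B ((v - u) * (ξ * B)) = min 1 ((v - u) * ξ) * B := by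
    rw [min_mul_of_nonneg _ _ hB.le]
    ring_nf
  have h1 := h F g a u v K ξ (min B ((v - u) * (ξ * B))) _ b hF.contDiff hg ha hau huv.le hva hu hv
    hg1 hgK hξ.le (lt_min hB (by positivity)) (hF.integral_norm_sq_le_min huv.le)
    (hF.integral_norm_deriv_sq_le_min huv.le) le_rfl hb
  refine h1.trans ?_
  have h2 := hlog N _ (by exact_mod_cast hN) hT0 hT
  have h3 : √(min B ((v - u) * (ξ * B)) * (1 + 6 * a * (K + ξ))) ≤ √A * √(Y * B) := by
    rw [← Real.sqrt_mul hA.le]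
    apply Real.sqrt_le_sqrt
    rw [hmin]
    nlinarith
  calc _ ≤ C * (√A * √(Y * B) * (c * Real.log N)) := by
        gcongr
        exact Real.log_nonneg (by linarith)
    _ = _ := by ring

lemma abs_deriv_smoothCut_sub_le {M : ℝ} (hM : ∀ X η x : ℝ, 0 < η →
    |deriv (smoothCut X η) x| ≤ M / η) {X η X' η' : ℝ} (hη : 0 < η) (hη' : 0 < η') (x : ℝ) :
    |deriv (fun x => smoothCut X η x - smoothCut X' η' x) x| ≤ M / η + M / η' := by
  have h : ∀ X η : ℝ, Differentiable ℝ (smoothCut X η) :=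
    fun X η => (contDiff_infty_iff_deriv.1 (contDiff_smoothCut X η)).1
  rw [deriv_fun_sub (h X η x) (h X' η' x)]
  exact (abs_sub _ _).trans (add_le_add (hM _ _ _ hη) (hM _ _ _ hη'))

lemma norm_vonMangoldtError_le_of_forall_ge_eq_zero {f : ℝ → ℂ} {S : ℝ}
    (hS : ∀ x, ‖f x‖ ≤ S) (h4 : ∀ x, 4 ≤ x → f x = 0) {b : ℕ} (hb : 4 ≤ b) :
    ‖vonMangoldtError b f‖ ≤
      (∑ n ∈ Finset.Icc 1 4, ArithmeticFunction.vonMangoldt n + 4) * S := by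
  have e1 : ∑ n ∈ Finset.Icc 1 b, (ArithmeticFunction.vonMangoldt n : ℂ) * f n =
      ∑ n ∈ Finset.Icc 1 4, (ArithmeticFunction.vonMangoldt n : ℂ) * f n := by
    refine (Finset.sum_subset (Finset.Icc_subset_Icc_right hb) fun n hn hn' => ?_).symm
    rw [h4, mul_zero]
    simp only [Finset.mem_Icc] at hn hn'
    exact_mod_cast (by omega : 4 ≤ n)
  have e2 : ∫ x in Set.Ioc 0 (b : ℝ), f x = ∫ x in (0 : ℝ)..4, f x := by
    rw [intervalIntegral.integral_of_le (by norm_num)]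
    refine setIntegral_eq_of_subset_of_forall_sdiff_eq_zero measurableSet_Ioc
      (Set.Ioc_subset_Ioc_right (by exact_mod_cast hb)) fun x hx => h4 x ?_
    have := hx.2
    simp only [Set.mem_Ioc, not_and, not_le] at this
    exact (this hx.1.1).le
  rw [vonMangoldtError, e1, e2, add_mul, Finset.sum_mul]
  refine (norm_sub_le _ _).trans (add_le_add ((norm_sum_le _ _).trans
    (Finset.sum_le_sum fun n _ => ?_)) ?_)
  · rw [norm_mul, norm_real, Real.norm_of_nonneg ArithmeticFunction.vonMangoldt_nonneg]
    gcongr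
    exact hS _
  · have := intervalIntegral.norm_integral_le_of_norm_le_const (a := (0 : ℝ)) (b := 4) (C := S)
      (f := f) fun x _ => hS x
    rw [sub_zero, abs_of_pos (by norm_num : (0 : ℝ) < 4)] at this
    linarith

lemma IsBandLimited.norm_le {F : ℝ → ℂ} {ξ B : ℝ} (h : IsBandLimited F ξ B) (x : ℝ) :
    ‖F x‖ ≤ √(ξ * B) := Real.le_sqrt_of_sq_le (h.norm_sq_le x)

lemma norm_smoothCut_mul_le {F : ℝ → ℂ} {S : ℝ} (hS : ∀ x, ‖F x‖ ≤ S) (X η x : ℝ) :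
    ‖(smoothCut X η x : ℂ) * F x‖ ≤ S := by
  rw [norm_mul, norm_real, Real.norm_of_nonneg (smoothCut_nonneg _ _ _)]
  exact (mul_le_of_le_one_left (norm_nonneg _) (smoothCut_le_one _ _ _)).trans (hS x)

/-- The error for a band-limited weight with a smooth cutoff at scale `X`. -/
lemma exists_norm_vonMangoldtError_smoothCut_self_le (hRH : RiemannHypothesis) :
    ∃ C > (0 : ℝ), ∀ (N b : ℕ) (F : ℝ → ℂ) (ξ B : ℝ), 2 ≤ N → IsBandLimited F ξ B → 0 < ξ →
      ξ ≤ 1 / 2 → 0 < B → 4 * N ≤ b → ∀ X : ℝ, 1 ≤ X → X ≤ N →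
      ‖vonMangoldtError b (fun x => smoothCut X X x * F x)‖ ≤
        C * (Real.log N * √(X * ξ * B)) := by
  obtain ⟨M, hM1, hM⟩ := exists_abs_deriv_smoothCut_le
  obtain ⟨c, hc, h⟩ := exists_norm_vonMangoldtError_smoothCut_sub_le hRH
    (A := 2 * (4 + 9 * M)) (by positivity)
  obtain ⟨C₀, hC₀⟩ : ∃ C₀ : ℝ,
    C₀ = ∑ n ∈ Finset.Icc 1 4, ArithmeticFunction.vonMangoldt n + 4 := ⟨_, rfl⟩
  have hC₀0 : 0 < C₀ := by
    rw [hC₀]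
    have := Finset.sum_nonneg fun n (_ : n ∈ Finset.Icc 1 4) =>
      ArithmeticFunction.vonMangoldt_nonneg (n := n)
    linarith
  have hl2 : 0 < Real.log 2 := Real.log_pos (by norm_num)
  refine ⟨4 * c + C₀ / Real.log 2, by positivity, ?_⟩
  intro N b F ξ B hN hF hξ hξ2 hB hb
  have hNr : (2 : ℝ) ≤ N := by exact_mod_cast hN
  have hbr : 4 * (N : ℝ) ≤ b := by exact_mod_cast hb
  have hL : Real.log 2 ≤ Real.log N := Real.log_le_log (by norm_num) hNr
  have base : ∀ X : ℝ, 1 ≤ X → X ≤ 2 →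
      ‖vonMangoldtError b (fun x => smoothCut X X x * F x)‖ ≤
        (4 * c + C₀ / Real.log 2) * (Real.log N * √(X * ξ * B)) := by
    intro X hX1 hX2
    have h1 := norm_vonMangoldtError_le_of_forall_ge_eq_zero (b := b)
      (norm_smoothCut_mul_le hF.norm_le X X)
      (fun x hx => by rw [smoothCut_of_ge (by linarith) (by linarith)]; simp)
      (by omega)
    rw [← hC₀] at h1
    have h2 : √(ξ * B) ≤ √(X * ξ * B) := by
      apply Real.sqrt_le_sqrt
      nlinarith [mul_pos hξ hB]
    calc _ ≤ C₀ * √(ξ * B) := h1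
      _ ≤ C₀ * √(X * ξ * B) := by gcongr
      _ = C₀ / Real.log 2 * (Real.log 2 * √(X * ξ * B)) := by field_simp
      _ ≤ (4 * c + C₀ / Real.log 2) * (Real.log N * √(X * ξ * B)) := by
        gcongr
        linarith
  have key : ∀ k : ℕ, ∀ X : ℝ, 1 ≤ X → X ≤ N → X ≤ 2 ^ k →
      ‖vonMangoldtError b (fun x => smoothCut X X x * F x)‖ ≤
        (4 * c + C₀ / Real.log 2) * (Real.log N * √(X * ξ * B)) := by
    intro k
    induction k with
    | zero =>
      intro X hX _ hX2
      exact base X hX (by simp at hX2; linarith)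
    | succ k ih =>
      intro X hX hXN hXk
      rcases le_total X 2 with hX2 | hX2
      · exact base X hX hX2
      have hX0 : 0 < X := by linarith
      have h1 := ih (X / 2) (by linarith) (by linarith) (by rw [pow_succ] at hXk; linarith)
      have hT : 1 + 6 * (X / 2) * (3 * M / X + ξ) = 1 + 9 * M + 3 * (X * ξ) := by
        field_simp
        ring
      have hXξ : X * ξ ≤ N * (1 / 2) := by gcongr
      have h2 := h N b F ξ B (fun x => smoothCut X X x - smoothCut (X / 2) (X / 2) x) (X / 2)
        (X / 2) (2 * X) (3 * M / X) (X * ξ) hN hF hξ hB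
        ((contDiff_smoothCut _ _).sub (contDiff_smoothCut _ _)) (by linarith) le_rfl (by linarith)
        (by linarith)
        (fun x hx => by
          rw [smoothCut_of_le hX0 (by linarith), smoothCut_of_le (by linarith) hx, sub_self])
        (fun x hx => by
          rw [smoothCut_of_ge hX0 (by linarith), smoothCut_of_ge (by linarith) (by linarith),
            sub_self])
        (fun x => abs_smoothCut_sub_le _ _ _ _ _)
        (fun x => (abs_deriv_smoothCut_sub_le hM hX0 (by linarith) x).trans_eq (by
          field_simp
          ring))
        (by rw [hT]; nlinarith) (by positivity)
        (by
          rw [hT]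
          have hXξ0 : 0 < X * ξ := mul_pos hX0 hξ
          rcases le_total (X * ξ) 1 with h1 | h1
          · refine (mul_le_mul (min_le_right _ _) (by linarith : _ ≤ 4 + 9 * M) (by positivity)
              (mul_nonneg (by linarith) hξ.le)).trans ?_
            nlinarith
          · refine (mul_le_mul (min_le_left _ _) (by nlinarith : _ ≤ (4 + 9 * M) * (X * ξ))
              (by positivity) zero_le_one).trans ?_
            nlinarith)
        (by linarith)
      rw [vonMangoldtError_smoothCut_sub hF.contDiff] at h2
      have h3 : √(X / 2 * ξ * B) ≤ 3 / 4 * √(X * ξ * B) := by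
        apply Real.sqrt_le_iff.2 ⟨by positivity, ?_⟩
        rw [mul_pow, Real.sq_sqrt (by positivity)]
        nlinarith [mul_pos (mul_pos hX0 hξ) hB]
      have hS := Real.sqrt_nonneg (X * ξ * B)
      obtain ⟨S, hSd⟩ : ∃ S, S = √(X * ξ * B) := ⟨_, rfl⟩
      rw [← hSd] at h2 h3 hS ⊢
      calc _ ≤ c * (Real.log N * S) +
            (4 * c + C₀ / Real.log 2) * (Real.log N * (3 / 4 * S)) := by
            refine (norm_le_norm_sub_add _ _).trans (add_le_add h2 (h1.trans ?_))
            gcongr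
        _ = (4 * c + 3 / 4 * (C₀ / Real.log 2)) * (Real.log N * S) := by ring
        _ ≤ _ := by
          refine mul_le_mul_of_nonneg_right ?_ (mul_nonneg (by linarith) hS)
          have : 0 < C₀ / Real.log 2 := by positivity
          linarith
  intro X hX hXN
  obtain ⟨k, hk⟩ := pow_unbounded_of_one_lt X (one_lt_two : (1 : ℝ) < 2)
  exact key k X hX hXN hk.le

/-- Cutting a band-limited weight off at `N` ever more sharply. -/
lemma exists_norm_vonMangoldtError_smoothCut_le (hRH : RiemannHypothesis) :
    ∃ C > (0 : ℝ), ∀ (N b : ℕ) (F : ℝ → ℂ) (ξ B : ℝ), 2 ≤ N → IsBandLimited F ξ B →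
      1 / (2 * (N : ℝ)) ≤ ξ → ξ ≤ 1 / 2 → 0 < B → 4 * N ≤ b → ∀ k : ℕ, 2 ^ k ≤ 1 / (2 * ξ) →
      ‖vonMangoldtError b (fun x => smoothCut N (1 / (2 * ξ) / 2 ^ k) x * F x)‖ ≤
        C * (Real.log N * √(N * ξ * B) * (k + 2)) := by
  obtain ⟨M, hM1, hM⟩ := exists_abs_deriv_smoothCut_le
  obtain ⟨c, hc, h⟩ := exists_norm_vonMangoldtError_smoothCut_sub_le hRH
    (A := 14 + 24 * M) (by positivity)
  obtain ⟨C₁, hC₁, h₁⟩ := exists_norm_vonMangoldtError_smoothCut_self_le hRH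
  refine ⟨C₁ + c, by positivity, ?_⟩
  intro N b F ξ B hN hF hξN hξ2 hB hb
  have hNr : (2 : ℝ) ≤ N := by exact_mod_cast hN
  have hN0 : (0 : ℝ) < N := by linarith
  have hbr : 4 * (N : ℝ) ≤ b := by exact_mod_cast hb
  have hL : 0 ≤ Real.log N := Real.log_nonneg (by linarith)
  have hξ : 0 < ξ := lt_of_lt_of_le (by positivity) hξN
  have hNξ : 1 ≤ 2 * (N * ξ) := by
    rw [div_le_iff₀ (by positivity)] at hξN
    linarith
  have hη₀ : 1 / (2 * ξ) ≤ N := by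
    rw [div_le_iff₀ (by positivity)]
    linarith
  have hNξ2 : N * ξ ≤ N * (1 / 2) := by gcongr
  have hS := Real.sqrt_nonneg (N * ξ * B)
  intro k
  induction k with
  | zero =>
    intro _
    rw [pow_zero, div_one]
    have hη0 : 0 < 1 / (2 * ξ) := by positivity
    have hT : 1 + 6 * N * (4 * M * ξ + ξ) = 1 + 6 * (4 * M + 1) * (N * ξ) := by ring
    have hM0 : 0 ≤ M * (N * ξ) := by positivity
    have h2 := h N b F ξ B (fun x => smoothCut N (1 / (2 * ξ)) x - smoothCut N N x) N N (2 * N)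
      (4 * M * ξ) (N * ξ) hN hF hξ hB
      ((contDiff_smoothCut _ _).sub (contDiff_smoothCut _ _)) (by linarith) le_rfl (by linarith)
      (by linarith)
      (fun x hx => by rw [smoothCut_of_le hη0 hx, smoothCut_of_le hN0 hx, sub_self])
      (fun x hx => by
        rw [smoothCut_of_ge hη0 (by linarith), smoothCut_of_ge hN0 (by linarith), sub_self])
      (fun x => abs_smoothCut_sub_le _ _ _ _ _)
      (fun x => (abs_deriv_smoothCut_sub_le hM hη0 hN0 x).trans (by
        have e : M / (1 / (2 * ξ)) = 2 * M * ξ := by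
          field_simp
        have : M / N ≤ M / (1 / (2 * ξ)) := by gcongr
        linarith))
      (by rw [hT]; nlinarith) (by positivity)
      (by
        rw [hT]
        calc _ ≤ 1 * (1 + 6 * (4 * M + 1) * (N * ξ)) := by
              gcongr
              exact min_le_left _ _
          _ ≤ _ := by nlinarith)
      hbr
    rw [vonMangoldtError_smoothCut_sub hF.contDiff] at h2
    have h3 := h₁ N b F ξ B hN hF hξ hξ2 hB hb N (by linarith) le_rfl
    refine (norm_le_norm_sub_add _ _).trans ((add_le_add h2 h3).trans ?_)
    have h4 := mul_nonneg hL hS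
    push_cast
    nlinarith
  | succ k ih =>
    intro hk
    have hk' : (2 : ℝ) ^ k ≤ 1 / (2 * ξ) := by
      refine le_trans ?_ hk
      gcongr <;> norm_num
    have h1 := ih hk'
    obtain ⟨η, hη⟩ : ∃ η, η = 1 / (2 * ξ) / 2 ^ (k + 1) := ⟨_, rfl⟩
    have hη' : 1 / (2 * ξ) / 2 ^ k = 2 * η := by
      rw [hη, pow_succ]
      field_simp
    have hη1 : 1 ≤ η := by
      rw [hη, le_div_iff₀ (by positivity), one_mul]
      exact hk
    have hη2 : 2 * η ≤ 1 / (2 * ξ) := by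
      rw [← hη']
      exact div_le_self (by positivity) (one_le_pow₀ (by norm_num))
    have hηξ : 4 * (η * ξ) ≤ 1 := by
      rw [le_div_iff₀ (by positivity)] at hη2
      linarith
    rw [← hη]
    rw [hη'] at h1
    have hη0 : 0 < η := by linarith
    have hT : 1 + 6 * N * (2 * M / η + ξ) ≤ (7 + 12 * M) * (N / η) := by
      have e : 1 + 6 * N * (2 * M / η + ξ) = (η + 12 * M * N + 6 * N * (η * ξ)) / η := by
        field_simp
        ring
      rw [e, ← mul_div_assoc]
      gcongr
      nlinarith
    have h2 := h N b F ξ B (fun x => smoothCut N η x - smoothCut N (2 * η) x) N N (N + 2 * η)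
      (2 * M / η) (N * ξ) hN hF hξ hB
      ((contDiff_smoothCut _ _).sub (contDiff_smoothCut _ _)) (by linarith) le_rfl (by linarith)
      (by linarith)
      (fun x hx => by rw [smoothCut_of_le hη0 hx, smoothCut_of_le (by linarith) hx, sub_self])
      (fun x hx => by
        rw [smoothCut_of_ge hη0 (by linarith), smoothCut_of_ge (by linarith) (by linarith),
          sub_self])
      (fun x => abs_smoothCut_sub_le _ _ _ _ _)
      (fun x => (abs_deriv_smoothCut_sub_le hM hη0 (by linarith) x).trans (by
        have : M / (2 * η) ≤ M / η := by
          gcongr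
          linarith
        calc _ ≤ M / η + M / η := by linarith
          _ = _ := by ring))
      (by
        refine hT.trans ?_
        have : N / η ≤ N := div_le_self hN0.le hη1
        nlinarith)
      (by positivity)
      (by
        calc _ ≤ 2 * η * ξ * ((7 + 12 * M) * (N / η)) := by
              gcongr
              exact (min_le_right _ _).trans_eq (by ring)
          _ = (14 + 24 * M) * (N * ξ) := by
              field_simp
              ring)
      hbr
    rw [vonMangoldtError_smoothCut_sub hF.contDiff] at h2
    refine (norm_le_norm_sub_add _ _).trans ((add_le_add h2 h1).trans ?_)
    have h4 := mul_nonneg hL hS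
    push_cast
    nlinarith

lemma Finset.Icc_one_sum_eq_add_Ioc {M : Type*} [AddCommMonoid M] (f : ℕ → M) {N b : ℕ}
    (h : N ≤ b) : ∑ n ∈ Finset.Icc 1 b, f n =
      ∑ n ∈ Finset.Icc 1 N, f n + ∑ n ∈ Finset.Ioc N b, f n := by
  rw [← Finset.sum_union]
  · congr 1
    ext n
    simp only [Finset.mem_Icc, Finset.mem_union, Finset.mem_Ioc]
    omega
  · rw [Finset.disjoint_left]
    intro n h1 h2
    simp only [Finset.mem_Icc, Finset.mem_Ioc] at h1 h2
    omega

/-- Under RH, an upper bound for primes in the short interval `(N, N + η]`. -/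
lemma exists_sum_vonMangoldt_mul_smoothCut_le (hRH : RiemannHypothesis) :
    ∃ C > (0 : ℝ), ∀ (N b : ℕ) (η : ℝ), 2 ≤ N → 4 * N ≤ b → 1 ≤ η → η ≤ N →
      ∑ n ∈ Finset.Ioc N b, ArithmeticFunction.vonMangoldt n * smoothCut N η n ≤
        C * (η + √N * Real.log N) := by
  obtain ⟨M, hM1, hM⟩ := exists_abs_deriv_smoothCut_le
  obtain ⟨C, hC, h⟩ := exists_norm_vonMangoldtError_mul_le hRH
  obtain ⟨c, hc, hlog⟩ := exists_log_add_four_le (A := 1 + 36 * M) (by positivity)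
  refine ⟨C * (√(3 / 2 * (1 + 36 * M)) * c) + 3 / 2, by positivity, ?_⟩
  intro N b η hN hb hη1 hηN
  have hNr : (2 : ℝ) ≤ N := by exact_mod_cast hN
  have hbr : 4 * (N : ℝ) ≤ b := by exact_mod_cast hb
  have hη0 : 0 < η := by linarith
  have hη4 : 0 < η / 4 := by linarith
  have hL : 0 ≤ Real.log N := Real.log_nonneg (by linarith)
  obtain ⟨g, hg⟩ : ∃ g : ℝ → ℝ,
    g = fun x => smoothCut (N + η) (η / 4) x - smoothCut (N - η / 4) (η / 4) x := ⟨_, rfl⟩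
  have hgs : ContDiff ℝ ∞ g := by
    rw [hg]
    exact (contDiff_smoothCut _ _).sub (contDiff_smoothCut _ _)
  have hgu : ∀ x ≤ N - η / 4, g x = 0 := fun x hx => by
    simp only [hg]
    rw [smoothCut_of_le hη4 (by linarith), smoothCut_of_le hη4 hx, sub_self]
  have hgv : ∀ x, N + 5 / 4 * η ≤ x → g x = 0 := fun x hx => by
    simp only [hg]
    rw [smoothCut_of_ge hη4 (by linarith), smoothCut_of_ge hη4 (by linarith), sub_self]
  have hg1 : ∀ x, |g x| ≤ 1 := fun x => by
    simp only [hg]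
    exact abs_smoothCut_sub_le _ _ _ _ _
  have hg0 : ∀ x, 0 ≤ g x := fun x => by
    simp only [hg]
    rcases le_total x (N + η) with hx | hx
    · rw [smoothCut_of_le hη4 hx]
      linarith [smoothCut_le_one (N - η / 4) (η / 4) x]
    · rw [smoothCut_of_ge (X := N - η / 4) hη4 (by linarith)]
      linarith [smoothCut_nonneg (N + η) (η / 4) x]
  have hgcut : ∀ x : ℝ, N ≤ x → smoothCut N η x ≤ g x := fun x hx => by
    simp only [hg]
    rw [smoothCut_of_ge (X := N - η / 4) hη4 (by linarith), sub_zero]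
    rcases le_total x (N + η) with hx | hx
    · rw [smoothCut_of_le hη4 hx]
      exact smoothCut_le_one _ _ _
    · rw [smoothCut_of_ge hη0 hx]
      exact smoothCut_nonneg _ _ _
  have hgK : ∀ x, |deriv g x| ≤ 8 * M / η := fun x => by
    rw [hg]
    refine (abs_deriv_smoothCut_sub_le hM hη4 hη4 x).trans_eq ?_
    field_simp
    ring
  have hNη : 1 ≤ N / η := by rwa [le_div_iff₀ hη0, one_mul]
  have h1 := h (fun _ => 1) g (3 / 4 * N) (N - η / 4) (N + 5 / 4 * η) (8 * M / η) 0 (3 / 2 * η)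
    ((1 + 36 * M) * (N / η)) b contDiff_const hgs (by linarith) (by linarith) (by linarith)
    (by linarith) hgu hgv hg1 hgK le_rfl (by positivity)
    (by
      simp only [norm_one, one_pow, intervalIntegral.integral_const, smul_eq_mul]
      linarith)
    (by simp)
    (by
      have : 1 + 6 * (3 / 4 * (N : ℝ)) * (8 * M / η + 0) = 1 + 36 * M * (N / η) := by ring
      rw [this]
      linarith)
    (by linarith)
  have h2 := hlog N ((1 + 36 * M) * (N / η)) hNr (by positivity) (by
    gcongr
    exact div_le_self (by linarith) hη1)
  have h3 : √(3 / 2 * η * ((1 + 36 * M) * (N / η))) = √(3 / 2 * (1 + 36 * M)) * √N := by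
    rw [← Real.sqrt_mul (by positivity)]
    congr 1
    field_simp
  rw [h3] at h1
  have h4 : ‖∫ x in Set.Ioc 0 (b : ℝ), (g x : ℂ) * 1‖ ≤ 3 / 2 * η := by
    have e : ∫ x in Set.Ioc 0 (b : ℝ), (g x : ℂ) * 1 =
        ∫ x in (N - η / 4)..(N + 5 / 4 * η), (g x : ℂ) * 1 := by
      rw [intervalIntegral.integral_of_le (by linarith)]
      refine setIntegral_eq_of_subset_of_forall_sdiff_eq_zero measurableSet_Ioc
        (Set.Ioc_subset_Ioc (by linarith) (by linarith)) fun x hx => ?_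
      have := hx.2
      simp only [Set.mem_Ioc, not_and_or, not_lt, not_le] at this
      rcases this with h | h
      · rw [hgu x h, ofReal_zero, zero_mul]
      · rw [hgv x h.le, ofReal_zero, zero_mul]
    rw [e]
    have := intervalIntegral.norm_integral_le_of_norm_le_const (a := N - η / 4)
      (b := N + 5 / 4 * η) (C := 1) (f := fun x => (g x : ℂ) * 1) fun x _ => by
        rw [mul_one, norm_real]
        exact hg1 x
    rw [one_mul, abs_of_nonneg (by linarith)] at this
    linarith
  have h5 : ‖∑ n ∈ Finset.Icc 1 b, (ArithmeticFunction.vonMangoldt n : ℂ) * ((g n : ℂ) * 1)‖ =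
      ∑ n ∈ Finset.Icc 1 b, ArithmeticFunction.vonMangoldt n * g n := by
    have : ∑ n ∈ Finset.Icc 1 b, (ArithmeticFunction.vonMangoldt n : ℂ) * ((g n : ℂ) * 1) =
        ((∑ n ∈ Finset.Icc 1 b, ArithmeticFunction.vonMangoldt n * g n : ℝ) : ℂ) := by
      push_cast
      simp only [mul_one]
    rw [this, norm_real, Real.norm_of_nonneg]
    exact Finset.sum_nonneg fun n _ =>
      mul_nonneg ArithmeticFunction.vonMangoldt_nonneg (hg0 n)
  have h6 : ∑ n ∈ Finset.Ioc N b, ArithmeticFunction.vonMangoldt n * smoothCut N η n ≤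
      ∑ n ∈ Finset.Icc 1 b, ArithmeticFunction.vonMangoldt n * g n := by
    rw [Finset.Icc_one_sum_eq_add_Ioc _ (by omega : N ≤ b)]
    refine le_add_of_nonneg_of_le (Finset.sum_nonneg fun n _ =>
      mul_nonneg ArithmeticFunction.vonMangoldt_nonneg (hg0 n)) (Finset.sum_le_sum fun n hn => ?_)
    refine mul_le_mul_of_nonneg_left (hgcut n ?_) ArithmeticFunction.vonMangoldt_nonneg
    exact_mod_cast (Finset.mem_Ioc.1 hn).1.le
  rw [vonMangoldtError] at h1
  have h7 := norm_sub_norm_le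
    (∑ n ∈ Finset.Icc 1 b, (ArithmeticFunction.vonMangoldt n : ℂ) * ((g n : ℂ) * 1))
    (∫ x in Set.Ioc 0 (b : ℝ), (g x : ℂ) * 1)
  rw [h5] at h7
  obtain ⟨s, hs⟩ : ∃ s, s = √(3 / 2 * (1 + 36 * M)) := ⟨_, rfl⟩
  have hs0 : 0 ≤ s := hs ▸ Real.sqrt_nonneg _
  rw [← hs] at h1 ⊢
  have h8 : C * (s * √N * Real.log ((1 + 36 * M) * (N / η) + 4)) ≤
      C * (s * √N * (c * Real.log N)) := by gcongr
  have h9 : 0 ≤ C * (s * c) * η := by positivity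
  have h10 : 0 ≤ √N * Real.log N := by positivity
  have h11 : C * (s * √N * (c * Real.log N)) = C * (s * c) * (√N * Real.log N) := by ring
  nlinarith

/-- Replacing a smooth cutoff of width `η` at `N` by the sharp one. -/
lemma exists_norm_vonMangoldtError_le_smoothCut_add (hRH : RiemannHypothesis) :
    ∃ C > (0 : ℝ), ∀ (N b : ℕ) (F : ℝ → ℂ) (S η : ℝ), 2 ≤ N → 4 * N ≤ b → Continuous F →
      (∀ x, ‖F x‖ ≤ S) → 1 ≤ η → η ≤ N →
      ‖vonMangoldtError N F‖ ≤ ‖vonMangoldtError b (fun x => smoothCut N η x * F x)‖ +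
        C * (S * (η + √N * Real.log N)) := by
  obtain ⟨C, hC, h⟩ := exists_sum_vonMangoldt_mul_smoothCut_le hRH
  refine ⟨C + 1, by positivity, ?_⟩
  intro N b F S η hN hb hF hS hη1 hηN
  have hNr : (2 : ℝ) ≤ N := by exact_mod_cast hN
  have hbr : 4 * (N : ℝ) ≤ b := by exact_mod_cast hb
  have hη0 : 0 < η := by linarith
  have hS0 : 0 ≤ S := (norm_nonneg _).trans (hS 0)
  have hL : 0 ≤ Real.log N := Real.log_nonneg (by linarith)
  have hcont : Continuous fun x : ℝ => (smoothCut N η x : ℂ) * F x :=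
    (continuous_ofReal.comp (contDiff_smoothCut _ _).continuous).mul hF
  have e1 : ∑ n ∈ Finset.Icc 1 b, (ArithmeticFunction.vonMangoldt n : ℂ) *
      ((smoothCut N η n : ℂ) * F n) = ∑ n ∈ Finset.Icc 1 N,
        (ArithmeticFunction.vonMangoldt n : ℂ) * F n + ∑ n ∈ Finset.Ioc N b,
        (ArithmeticFunction.vonMangoldt n : ℂ) * ((smoothCut N η n : ℂ) * F n) := by
    rw [Finset.Icc_one_sum_eq_add_Ioc _ (by omega : N ≤ b)]
    congr 1
    refine Finset.sum_congr rfl fun n hn => ?_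
    rw [smoothCut_of_le hη0 (by exact_mod_cast (Finset.mem_Icc.1 hn).2), ofReal_one, one_mul]
  have e2 : ∫ x in Set.Ioc 0 (b : ℝ), (smoothCut N η x : ℂ) * F x =
      (∫ x in Set.Ioc 0 (N : ℝ), F x) + ∫ x in (N : ℝ)..(N + η), (smoothCut N η x : ℂ) * F x := by
    rw [← intervalIntegral.integral_of_le (by linarith),
      ← intervalIntegral.integral_add_adjacent_intervals (b := (N : ℝ))
        (hcont.intervalIntegrable _ _) (hcont.intervalIntegrable _ _),
      intervalIntegral.integral_of_le (by linarith)]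
    congr 1
    · refine setIntegral_congr_fun measurableSet_Ioc fun x hx => ?_
      rw [smoothCut_of_le hη0 hx.2, ofReal_one, one_mul]
    · rw [intervalIntegral.integral_of_le (by linarith), intervalIntegral.integral_of_le
        (by linarith)]
      refine setIntegral_eq_of_subset_of_forall_sdiff_eq_zero measurableSet_Ioc
        (Set.Ioc_subset_Ioc_right (by linarith)) fun x hx => ?_
      have := hx.2
      simp only [Set.mem_Ioc, not_and, not_le] at this
      rw [smoothCut_of_ge hη0 (this hx.1.1).le, ofReal_zero, zero_mul]
  have h1 : ‖∑ n ∈ Finset.Ioc N b, (ArithmeticFunction.vonMangoldt n : ℂ) *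
      ((smoothCut N η n : ℂ) * F n)‖ ≤ C * (η + √N * Real.log N) * S := by
    refine le_trans ?_ (mul_le_mul_of_nonneg_right (h N b η hN hb hη1 hηN) hS0)
    rw [Finset.sum_mul]
    refine (norm_sum_le _ _).trans (Finset.sum_le_sum fun n _ => ?_)
    rw [norm_mul, norm_mul, norm_real, norm_real,
      Real.norm_of_nonneg ArithmeticFunction.vonMangoldt_nonneg,
      Real.norm_of_nonneg (smoothCut_nonneg _ _ _), ← mul_assoc]
    exact mul_le_mul_of_nonneg_left (hS _)
      (mul_nonneg ArithmeticFunction.vonMangoldt_nonneg (smoothCut_nonneg _ _ _))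
  have h2 : ‖∫ x in (N : ℝ)..(N + η), (smoothCut N η x : ℂ) * F x‖ ≤ S * η := by
    have := intervalIntegral.norm_integral_le_of_norm_le_const (a := (N : ℝ))
      (b := N + η) (f := fun x => (smoothCut N η x : ℂ) * F x)
      fun x _ => norm_smoothCut_mul_le hS N η x
    rwa [add_sub_cancel_left, abs_of_pos hη0] at this
  have e3 : vonMangoldtError N F = vonMangoldtError b (fun x => smoothCut N η x * F x) -
      (∑ n ∈ Finset.Ioc N b, (ArithmeticFunction.vonMangoldt n : ℂ) *
        ((smoothCut N η n : ℂ) * F n) - ∫ x in (N : ℝ)..(N + η), (smoothCut N η x : ℂ) * F x) := by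
    rw [vonMangoldtError, vonMangoldtError, e1, e2]
    ring
  rw [e3]
  refine (norm_sub_le _ _).trans (add_le_add_right ((norm_sub_le _ _).trans
    ((add_le_add h1 h2).trans ?_)) _)
  have : 0 ≤ S * (√N * Real.log N) := by positivity
  nlinarith

/-- Comparing a sum with the integral. -/
lemma norm_sum_sub_integral_le {F : ℝ → ℂ} (hF : ContDiff ℝ 1 F) (N : ℕ) :
    ‖∑ n ∈ Finset.Icc 1 N, F n - ∫ x in Set.Ioc 0 (N : ℝ), F x‖ ≤
      ∫ x in (0 : ℝ)..N, ‖deriv F x‖ := by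
  have hd : Differentiable ℝ F := hF.differentiable one_ne_zero
  have hc : Continuous (deriv F) := hF.continuous_deriv le_rfl
  rw [← intervalIntegral.integral_of_le (Nat.cast_nonneg N)]
  induction N with
  | zero => simp
  | succ N ih =>
    rw [Finset.sum_Icc_succ_top (by omega)]
    have hN : (N : ℝ) ≤ ((N + 1 : ℕ) : ℝ) := by push_cast; linarith
    rw [← intervalIntegral.integral_add_adjacent_intervals (b := (N : ℝ)) (μ := volume)
      (hF.continuous.intervalIntegrable _ _) (hF.continuous.intervalIntegrable _ _),
      ← intervalIntegral.integral_add_adjacent_intervals (a := 0) (b := (N : ℝ)) (μ := volume)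
      (hc.norm.intervalIntegrable _ _) (hc.norm.intervalIntegrable _ _), add_sub_add_comm]
    refine (norm_add_le _ _).trans (add_le_add ih ?_)
    have e : F (N + 1 : ℕ) - ∫ x in (N : ℝ)..(N + 1 : ℕ), F x =
        ∫ x in (N : ℝ)..(N + 1 : ℕ), (F (N + 1 : ℕ) - F x) := by
      rw [intervalIntegral.integral_sub (μ := volume) intervalIntegrable_const
        (hF.continuous.intervalIntegrable _ _), intervalIntegral.integral_const]
      push_cast
      simp
    rw [e]
    have := intervalIntegral.norm_integral_le_of_norm_le_const (a := (N : ℝ))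
      (b := ((N + 1 : ℕ) : ℝ)) (f := fun x => F (N + 1 : ℕ) - F x)
      (C := ∫ x in (N : ℝ)..(N + 1 : ℕ), ‖deriv F x‖) fun x hx => by
        rw [Set.uIoc_of_le hN] at hx
        rw [← intervalIntegral.integral_deriv_eq_sub (fun y _ => hd y)
          (hc.intervalIntegrable _ _)]
        refine (intervalIntegral.norm_integral_le_integral_norm hx.2).trans ?_
        exact intervalIntegral.integral_mono_interval hx.1.le hx.2 le_rfl
          (Filter.Eventually.of_forall fun y => norm_nonneg _) (hc.norm.intervalIntegrable _ _)
    refine this.trans_eq ?_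
    push_cast
    simp

lemma IsBandLimited.norm_sum_sub_integral_le {F : ℝ → ℂ} {ξ B : ℝ} (h : IsBandLimited F ξ B)
    (hξ : 0 ≤ ξ) (hξ1 : ξ ≤ 1) (hB : 0 ≤ B) (N : ℕ) :
    ‖∑ n ∈ Finset.Icc 1 N, F n - ∫ x in Set.Ioc 0 (N : ℝ), F x‖ ≤ √N * √(ξ * B) := by
  refine (_root_.norm_sum_sub_integral_le (contDiff_infty.1 h.contDiff 1) N).trans ?_
  rw [← Real.sqrt_mul (Nat.cast_nonneg N)]
  refine Real.le_sqrt_of_sq_le ?_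
  have hc : Continuous (deriv F) := (contDiff_infty_iff_deriv.1 h.contDiff).2.continuous
  have hN : (0 : ℝ) ≤ N := Nat.cast_nonneg N
  refine (sq_intervalIntegral_le hc.norm hN).trans ?_
  rw [sub_zero]
  refine mul_le_mul_of_nonneg_left ?_ hN
  refine (h.integral_norm_deriv_sq_le 0 N hN).trans ?_
  gcongr
  nlinarith

/-- Under RH, the sum of `Λ(n) - 1` against a band-limited weight. -/
lemma exists_norm_sum_vonMangoldt_sub_one_le (hRH : RiemannHypothesis) :
    ∃ C > (0 : ℝ), ∀ (N : ℕ) (F : ℝ → ℂ) (ξ B : ℝ), 2 ≤ N → IsBandLimited F ξ B →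
      1 / (2 * (N : ℝ)) ≤ ξ → ξ ≤ 1 / 2 → 0 < B → ∀ k : ℕ, 2 ^ k ≤ 1 / (2 * ξ) →
      ‖∑ n ∈ Finset.Icc 1 N, ((ArithmeticFunction.vonMangoldt n : ℂ) - 1) * F n‖ ≤
        C * (√(ξ * B) * (√N * Real.log N * (k + 2) + 1 / (2 * ξ) / 2 ^ k)) := by
  obtain ⟨C₁, hC₁, h₁⟩ := exists_norm_vonMangoldtError_smoothCut_le hRH
  obtain ⟨C₂, hC₂, h₂⟩ := exists_norm_vonMangoldtError_le_smoothCut_add hRH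
  have hl2 : 0 < Real.log 2 := Real.log_pos (by norm_num)
  refine ⟨C₁ + C₂ + 1 / Real.log 2, by positivity, ?_⟩
  intro N F ξ B hN hF hξN hξ2 hB k hk
  have hNr : (2 : ℝ) ≤ N := by exact_mod_cast hN
  have hξ : 0 < ξ := lt_of_lt_of_le (by positivity) hξN
  have hη₀ : 1 / (2 * ξ) ≤ N := by
    rw [div_le_iff₀ (by positivity)] at hξN ⊢
    linarith
  have hL : Real.log 2 ≤ Real.log N := Real.log_le_log (by norm_num) hNr
  obtain ⟨η, hη⟩ : ∃ η, η = 1 / (2 * ξ) / 2 ^ k := ⟨_, rfl⟩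
  have hη1 : 1 ≤ η := by
    rw [hη, le_div_iff₀ (by positivity), one_mul]
    exact hk
  have hηN : η ≤ N := by
    refine le_trans ?_ hη₀
    rw [hη]
    exact div_le_self (by positivity) (one_le_pow₀ (by norm_num))
  have e1 := h₁ N (4 * N) F ξ B hN hF hξN hξ2 hB le_rfl k hk
  rw [← hη] at e1 ⊢
  have e2 := h₂ N (4 * N) F _ η hN le_rfl hF.contDiff.continuous hF.norm_le hη1 hηN
  have e3 := hF.norm_sum_sub_integral_le hξ.le (by linarith) hB.le N
  have e4 : ∑ n ∈ Finset.Icc 1 N, ((ArithmeticFunction.vonMangoldt n : ℂ) - 1) * F n =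
      vonMangoldtError N F - (∑ n ∈ Finset.Icc 1 N, F n - ∫ x in Set.Ioc 0 (N : ℝ), F x) := by
    simp only [vonMangoldtError, sub_mul, one_mul, Finset.sum_sub_distrib]
    ring
  have e5 : √(N * ξ * B) = √N * √(ξ * B) := by
    rw [← Real.sqrt_mul (Nat.cast_nonneg N), mul_assoc]
  rw [e5] at e1
  rw [e4]
  refine (norm_sub_le _ _).trans ((add_le_add (e2.trans (add_le_add_left e1 _)) e3).trans ?_)
  have hW := Real.sqrt_nonneg (ξ * B)
  have hs := Real.sqrt_nonneg (N : ℝ)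
  have hL0 : 0 ≤ Real.log N := hl2.le.trans hL
  obtain ⟨W, hWd⟩ : ∃ W, W = √(ξ * B) := ⟨_, rfl⟩
  obtain ⟨s, hsd⟩ : ∃ s, s = √(N : ℝ) := ⟨_, rfl⟩
  obtain ⟨L, hLd⟩ : ∃ L, L = Real.log (N : ℝ) := ⟨_, rfl⟩
  rw [← hWd] at hW ⊢
  rw [← hsd] at hs ⊢
  rw [← hLd] at hL hL0 ⊢
  have f1 : s * W ≤ 1 / Real.log 2 * (W * (s * L * (k + 2) + η)) := by
    rw [one_div_mul_eq_div, le_div_iff₀ hl2]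
    have : s * W * Real.log 2 ≤ s * W * L := by gcongr
    have h2 : 0 ≤ s * W * L * (k + 1) := by positivity
    have h3 : 0 ≤ W * η := by positivity
    linarith
  have f2 : C₁ * (L * (s * W) * (k + 2)) ≤ C₁ * (W * (s * L * (k + 2) + η)) := by
    refine mul_le_mul_of_nonneg_left ?_ hC₁.le
    have h3 : 0 ≤ W * η := by positivity
    linarith
  have f3 : C₂ * (W * (η + s * L)) ≤ C₂ * (W * (s * L * (k + 2) + η)) := by
    refine mul_le_mul_of_nonneg_left (mul_le_mul_of_nonneg_left ?_ hW) hC₂.le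
    have h2 : 0 ≤ s * L * (k + 1) := by positivity
    linarith
  linarith

lemma exists_two_pow_le_div_le {x y : ℝ} (hx : 1 ≤ x) (hy : 1 ≤ y) :
    ∃ k : ℕ, (2 : ℝ) ^ k ≤ x ∧ x / 2 ^ k ≤ 2 * y := by
  rcases le_total x y with h | h
  · exact ⟨0, by simpa using hx, by simp; linarith⟩
  · obtain ⟨k, hk1, hk2⟩ := exists_nat_pow_near (x := x / y) (y := 2)
      ((one_le_div (by linarith)).2 h) (by norm_num)
    refine ⟨k, hk1.trans (div_le_self (by linarith) hy), ?_⟩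
    rw [div_lt_iff₀ (by linarith), pow_succ] at hk2
    rw [div_le_iff₀ (by positivity)]
    linarith

/-- Under RH, the squared sum of `Λ(n) - 1` against a band-limited weight. -/
lemma exists_norm_sum_vonMangoldt_sub_one_sq_le (hRH : RiemannHypothesis) :
    ∃ C > (0 : ℝ), ∀ (N : ℕ) (F : ℝ → ℂ) (ξ B : ℝ), 2 ≤ N → IsBandLimited F ξ B →
      1 / (2 * (N : ℝ)) ≤ ξ → ξ ≤ 1 / 2 → 0 < B →
      ‖∑ n ∈ Finset.Icc 1 N, ((ArithmeticFunction.vonMangoldt n : ℂ) - 1) * F n‖ ^ 2 ≤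
        C * (B * (N * ξ * Real.log N ^ 2 + min (1 / ξ) (N * ξ * Real.log N ^ 4))) := by
  obtain ⟨C, hC, h⟩ := exists_norm_sum_vonMangoldt_sub_one_le hRH
  have hl2 : 0 < Real.log 2 := Real.log_pos (by norm_num)
  obtain ⟨m, hm⟩ : ∃ m, m = 3 / Real.log 2 + 2 / Real.log 2 ^ 2 := ⟨_, rfl⟩
  have hm0 : 0 < m := by rw [hm]; positivity
  refine ⟨C ^ 2 * (8 + m ^ 2), by positivity, ?_⟩
  intro N F ξ B hN hF hξN hξ2 hB
  have hNr : (2 : ℝ) ≤ N := by exact_mod_cast hN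
  have hN0 : (0 : ℝ) < N := by linarith
  have hξ : 0 < ξ := lt_of_lt_of_le (by positivity) hξN
  have hη1 : 1 ≤ 1 / (2 * ξ) := by
    rw [le_div_iff₀ (by positivity)]
    linarith
  have hη₀ : 1 / (2 * ξ) ≤ N := by
    rw [div_le_iff₀ (by positivity)] at hξN ⊢
    linarith
  have hL : Real.log 2 ≤ Real.log N := Real.log_le_log (by norm_num) hNr
  obtain ⟨L, hLd⟩ : ∃ L, L = Real.log (N : ℝ) := ⟨_, rfl⟩
  have hL0 : 0 < L := hLd ▸ hl2.trans_le hL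
  have b1 := h N F ξ B hN hF hξN hξ2 hB 0 (by simpa using hη1)
  obtain ⟨k, hk1, hk2⟩ := exists_two_pow_le_div_le hη1
    (Real.one_le_sqrt.2 (by linarith : (1 : ℝ) ≤ N))
  have b2 := h N F ξ B hN hF hξN hξ2 hB k hk1
  have hkL : k * Real.log 2 ≤ L := by
    rw [← Real.log_pow, hLd]
    exact Real.log_le_log (by positivity) (hk1.trans hη₀)
  rw [← hLd] at b1 b2 hL ⊢
  have hs2 : √(N : ℝ) ^ 2 = N := Real.sq_sqrt hN0.le
  have hW2 : √(ξ * B) ^ 2 = ξ * B := Real.sq_sqrt (by positivity)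
  obtain ⟨x, hx⟩ : ∃ x, x = ‖∑ n ∈ Finset.Icc 1 N,
    ((ArithmeticFunction.vonMangoldt n : ℂ) - 1) * F n‖ := ⟨_, rfl⟩
  have hx0 : 0 ≤ x := hx ▸ norm_nonneg _
  rw [← hx] at b1 b2 ⊢
  have c1 : x ^ 2 ≤ C ^ 2 * (8 + m ^ 2) * (B * (N * ξ * L ^ 2 + 1 / ξ)) := by
    calc x ^ 2 ≤ (C * (√(ξ * B) * (√N * L * (↑(0 : ℕ) + 2) + 1 / (2 * ξ) / 2 ^ 0))) ^ 2 := by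
          gcongr
      _ = C ^ 2 * (√(ξ * B) ^ 2 * (2 * (√N * L) + 1 / (2 * ξ)) ^ 2) := by
          push_cast
          ring
      _ ≤ C ^ 2 * (√(ξ * B) ^ 2 * (2 * ((2 * (√N * L)) ^ 2 + (1 / (2 * ξ)) ^ 2))) := by
          gcongr
          exact add_sq_le
      _ = C ^ 2 * (B * (8 * (N * ξ * L ^ 2) + 1 / 2 * (1 / ξ))) := by
          rw [hW2, mul_pow, mul_pow, hs2]
          field_simp
          ring
      _ ≤ C ^ 2 * (B * ((8 + m ^ 2) * (N * ξ * L ^ 2) + (8 + m ^ 2) * (1 / ξ))) := by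
          gcongr
          · nlinarith
          · nlinarith
      _ = _ := by ring
  have c2 : x ^ 2 ≤ C ^ 2 * (8 + m ^ 2) * (B * (N * ξ * L ^ 2 + N * ξ * L ^ 4)) := by
    have d1 : (k : ℝ) + 2 ≤ 3 / Real.log 2 * L := by
      rw [div_mul_eq_mul_div, le_div_iff₀ hl2]
      linarith
    have d2 : 2 ≤ 2 / Real.log 2 ^ 2 * L ^ 2 := by
      rw [div_mul_eq_mul_div, le_div_iff₀ (by positivity)]
      gcongr
    calc x ^ 2 ≤ (C * (√(ξ * B) * (√N * L * (3 / Real.log 2 * L) +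
          2 / Real.log 2 ^ 2 * L ^ 2 * √N))) ^ 2 := by
          gcongr
          refine b2.trans ?_
          gcongr
          refine hk2.trans ?_
          gcongr
      _ = C ^ 2 * (√(ξ * B) ^ 2 * (√N ^ 2 * L ^ 4 * m ^ 2)) := by
          rw [hm]
          ring
      _ = C ^ 2 * m ^ 2 * (B * (0 + N * ξ * L ^ 4)) := by
          rw [hW2, hs2]
          ring
      _ ≤ _ := by
          gcongr
          · linarith
          · positivity
  rcases min_cases (1 / ξ) (N * ξ * L ^ 4) with h | h <;> rw [h.1]
  · exact c1
  · exact c2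

lemma norm_fourier_sq_le {G : ℝ → ℂ} (hG : Continuous G) {r : ℝ} (hr : 0 ≤ r)
    (h0 : ∀ x, x ∉ Set.Ioc (-r) r → G x = 0) (x : ℝ) :
    ‖𝓕 G x‖ ^ 2 ≤ 2 * r * ∫ y, ‖G y‖ ^ 2 := by
  have h1 : ‖𝓕 G x‖ ≤ ∫ y, ‖G y‖ := VectorFourier.norm_fourierIntegral_le_integral_norm _ _ _ _ _
  have h2 : ∫ y, ‖G y‖ = ∫ y in (-r)..r, ‖G y‖ := by
    rw [intervalIntegral.integral_of_le (by linarith)]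
    exact (setIntegral_eq_integral_of_forall_compl_eq_zero fun y hy => by
      rw [h0 y hy, norm_zero]).symm
  have h3 : ∫ y, ‖G y‖ ^ 2 = ∫ y in (-r)..r, ‖G y‖ ^ 2 := by
    rw [intervalIntegral.integral_of_le (by linarith)]
    exact (setIntegral_eq_integral_of_forall_compl_eq_zero fun y hy => by
      rw [h0 y hy, norm_zero, zero_pow two_ne_zero]).symm
  have h4 := sq_intervalIntegral_le hG.norm (by linarith : -r ≤ r)
  rw [h3]
  calc _ ≤ (∫ y, ‖G y‖) ^ 2 := by gcongr
    _ ≤ _ := by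
      rw [h2]
      exact h4.trans_eq (by ring)

lemma intervalIntegral_le_integral {f : ℝ → ℝ} (hf : Integrable f) (h0 : ∀ x, 0 ≤ f x) {u v : ℝ}
    (huv : u ≤ v) : ∫ x in u..v, f x ≤ ∫ x, f x := by
  rw [intervalIntegral.integral_of_le huv]
  exact setIntegral_le_integral hf (Filter.Eventually.of_forall h0)

/-- The Fourier transform of a smooth function supported on `[-2ξ, 2ξ]` is band-limited. -/
lemma isBandLimited_fourier {G : ℝ → ℂ} (hG : ContDiff ℝ ∞ G) {ξ J : ℝ} (hξ : 0 < ξ)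
    (h0 : ∀ x, x ∉ Set.Ioc (-(2 * ξ)) (2 * ξ) → G x = 0) (hJ : ∫ x, ‖G x‖ ^ 2 ≤ J) :
    IsBandLimited (𝓕 G) ξ (1000 * J) := by
  have hcs : HasCompactSupport G := HasCompactSupport.intro
    (isCompact_Icc (a := -(2 * ξ)) (b := 2 * ξ)) fun x hx =>
      h0 x fun h => hx (Set.Ioc_subset_Icc_self h)
  obtain ⟨H, hH⟩ : ∃ H : ℝ → ℂ, H = fun x : ℝ => (-2 * Real.pi * I * x) • G x := ⟨_, rfl⟩
  have hHs : ContDiff ℝ ∞ H := by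
    rw [hH]
    exact (contDiff_const.mul ofRealCLM.contDiff).smul hG
  have hH0 : ∀ x, x ∉ Set.Ioc (-(2 * ξ)) (2 * ξ) → H x = 0 := fun x hx => by
    simp only [hH]
    rw [h0 x hx, smul_zero]
  have hHcs : HasCompactSupport H := HasCompactSupport.intro
    (isCompact_Icc (a := -(2 * ξ)) (b := 2 * ξ)) fun x hx =>
      hH0 x fun h => hx (Set.Ioc_subset_Icc_self h)
  have hd : deriv (𝓕 G) = 𝓕 H := by
    rw [Real.deriv_fourier (hG.continuous.integrable_of_hasCompactSupport hcs), hH]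
    exact (continuous_id.smul hG.continuous).integrable_of_hasCompactSupport hcs.smul_left
  have hpi : Real.pi ^ 2 ≤ 10 := by nlinarith [Real.pi_lt_d2, Real.pi_pos]
  have hJ0 : 0 ≤ J := (integral_nonneg fun x => by positivity).trans hJ
  have hHG : ∀ x, ‖H x‖ ^ 2 ≤ 160 * ξ ^ 2 * ‖G x‖ ^ 2 := fun x => by
    by_cases hx : x ∈ Set.Ioc (-(2 * ξ)) (2 * ξ)
    · have e : ‖H x‖ ^ 2 = 4 * Real.pi ^ 2 * x ^ 2 * ‖G x‖ ^ 2 := by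
        simp only [hH]
        rw [norm_smul]
        simp only [norm_mul, norm_neg, Complex.norm_ofNat, norm_real, norm_I,
          Real.norm_of_nonneg Real.pi_pos.le, mul_pow, Real.norm_eq_abs, sq_abs]
        ring
      rw [e]
      have hx2 : x ^ 2 ≤ (2 * ξ) ^ 2 := sq_le_sq' hx.1.le hx.2
      refine mul_le_mul_of_nonneg_right ?_ (by positivity)
      nlinarith [mul_le_mul hpi hx2 (sq_nonneg x) (by norm_num)]
    · rw [hH0 x hx, norm_zero, zero_pow two_ne_zero]
      positivity
  have hHJ : ∫ x, ‖H x‖ ^ 2 ≤ 160 * ξ ^ 2 * J := by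
    refine (integral_mono (hHcs.integrable_norm_sq hHs.continuous)
      ((hcs.integrable_norm_sq hG.continuous).const_mul _) hHG).trans ?_
    rw [integral_const_mul]
    gcongr
  obtain ⟨i1, e1⟩ := hcs.integral_norm_sq_fourier hG
  obtain ⟨i2, e2⟩ := hHcs.integral_norm_sq_fourier hHs
  refine ⟨?_, fun x => ?_, fun x => ?_, fun u v huv => ?_, fun u v huv => ?_⟩
  · have : ContDiff ℝ ∞ (𝓕 (hcs.toSchwartzMap hG) : SchwartzMap ℝ ℂ) :=
      SchwartzMap.smooth' _
    rwa [SchwartzMap.fourier_coe] at this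
  · refine (norm_fourier_sq_le hG.continuous (by positivity) h0 x).trans ?_
    calc _ ≤ 2 * (2 * ξ) * J := by gcongr
      _ ≤ _ := by nlinarith [mul_nonneg hξ.le hJ0]
  · rw [hd]
    refine (norm_fourier_sq_le hHs.continuous (by positivity) hH0 x).trans ?_
    calc _ ≤ 2 * (2 * ξ) * (160 * ξ ^ 2 * J) := by gcongr
      _ = 640 * (ξ ^ 3 * J) := by ring
      _ ≤ 1000 * (ξ ^ 3 * J) := by
        gcongr
        norm_num
      _ = _ := by ring
  · refine (intervalIntegral_le_integral i1 (fun x => by positivity) huv).trans ?_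
    rw [e1]
    linarith
  · rw [hd]
    refine (intervalIntegral_le_integral i2 (fun x => by positivity) huv).trans ?_
    rw [e2]
    refine hHJ.trans ?_
    nlinarith [mul_nonneg (sq_nonneg ξ) hJ0]

lemma S1_sub_T1_eq (N : ℕ) (α : ℝ) : S1 N α - T1 N α = ∑ n ∈ Finset.Icc 1 N,
    ((ArithmeticFunction.vonMangoldt n : ℂ) - 1) * exp (2 * Real.pi * I * n * α) := by
  simp only [S1, T1, sub_mul, one_mul, Finset.sum_sub_distrib]

lemma contDiff_S1_sub_T1 (N : ℕ) : ContDiff ℝ ∞ fun α : ℝ => S1 N α - T1 N α := by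
  simp only [S1_sub_T1_eq]
  exact ContDiff.sum fun n _ => contDiff_const.mul
    ((contDiff_const.mul ofRealCLM.contDiff).cexp)

lemma conj_S1_sub_T1 (N : ℕ) (α : ℝ) :
    (starRingEnd ℂ) (S1 N α - T1 N α) = ∑ n ∈ Finset.Icc 1 N,
      ((ArithmeticFunction.vonMangoldt n : ℂ) - 1) * exp ((-2 * Real.pi * α * n : ℝ) * I) := by
  rw [S1_sub_T1_eq, map_sum]
  refine Finset.sum_congr rfl fun n _ => ?_
  rw [map_mul, map_sub, conj_ofReal, map_one, ← exp_conj]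
  congr 2
  simp only [map_mul, conj_ofReal, conj_I, map_ofNat, map_natCast]
  push_cast
  ring

/-- Plancherel for the weighted second moment of `S₁ - T₁`. -/
lemma sum_vonMangoldt_sub_one_mul_fourier {κ : ℝ → ℝ} (hκ : Continuous κ)
    (hκs : HasCompactSupport κ) (N : ℕ) :
    ∑ n ∈ Finset.Icc 1 N, ((ArithmeticFunction.vonMangoldt n : ℂ) - 1) *
      𝓕 (fun α : ℝ => (κ α : ℂ) * (S1 N α - T1 N α)) n =
      ((∫ α, κ α * ‖S1 N α - T1 N α‖ ^ 2 : ℝ) : ℂ) := by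
  have hD := (contDiff_S1_sub_T1 N).continuous
  have hc : Continuous fun α : ℝ => (κ α : ℂ) * (S1 N α - T1 N α) :=
    (continuous_ofReal.comp hκ).mul hD
  have hκ' : HasCompactSupport fun α : ℝ => (κ α : ℂ) * (S1 N α - T1 N α) := by
    refine hκs.mono fun x hx => ?_
    rw [Function.mem_support] at hx ⊢
    intro h
    simp [h] at hx
  have e : ∀ n ∈ Finset.Icc 1 N, ((ArithmeticFunction.vonMangoldt n : ℂ) - 1) *
      𝓕 (fun α : ℝ => (κ α : ℂ) * (S1 N α - T1 N α)) n =
      ∫ α : ℝ, ((ArithmeticFunction.vonMangoldt n : ℂ) - 1) *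
        (exp ((-2 * Real.pi * α * n : ℝ) * I) * ((κ α : ℂ) * (S1 N α - T1 N α))) := by
    intro n _
    rw [Real.fourier_real_eq_integral_exp_smul, integral_const_mul]
    rfl
  rw [Finset.sum_congr rfl e, ← integral_finsetSum, ← integral_complex_ofReal]
  · congr 1
    funext α
    have h1 := conj_S1_sub_T1 N α
    have h2 : (S1 N α - T1 N α) * (starRingEnd ℂ) (S1 N α - T1 N α) =
        ((‖S1 N α - T1 N α‖ ^ 2 : ℝ) : ℂ) := by
      rw [mul_conj, normSq_eq_norm_sq]
    rw [ofReal_mul, ← h2, h1, Finset.mul_sum, Finset.mul_sum]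
    refine Finset.sum_congr rfl fun n _ => ?_
    ring
  · intro n _
    refine (Continuous.integrable_of_hasCompactSupport ?_ hκ'.mul_left).const_mul _
    exact (Complex.continuous_exp.comp (by fun_prop)).mul hc

lemma abs_log_three_mul_le {N ξ : ℝ} (hN : 2 ≤ N) (hξN : 1 / (2 * N) ≤ ξ) (hξ : ξ ≤ 1 / 2) :
    |Real.log (3 * ξ)| ≤ Real.log N := by
  have h0 : 0 < ξ := lt_of_lt_of_le (by positivity) hξN
  rw [div_le_iff₀ (by positivity)] at hξN
  rw [abs_le, ← Real.log_inv]
  constructor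
  · refine Real.log_le_log (by positivity) ?_
    rw [inv_le_iff_one_le_mul₀ (by positivity)]
    nlinarith
  · exact Real.log_le_log (by positivity) (by linarith)

lemma one_div_le_add_log_sq_div {N ξ : ℝ} (hN : 27 ≤ N) (hξN : 1 / (2 * N) ≤ ξ)
    (hξ : ξ ≤ 1 / 2) :
    1 / ξ ≤ N * ξ * Real.log N ^ 2 + Real.log N ^ 2 / (ξ * Real.log (3 * ξ) ^ 2) := by
  have h0 : 0 < ξ := lt_of_lt_of_le (by positivity) hξN
  have hL : Real.log 2 ≤ Real.log N := Real.log_le_log (by norm_num) (by linarith)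
  have hl2 := Real.log_two_gt_d9
  by_cases h : Real.log (3 * ξ) = 0
  · have h3 : 3 * ξ = 1 := Real.eq_one_of_pos_of_log_eq_zero (by positivity) h
    have h4 : ξ = 1 / 3 := by linarith
    rw [h]
    simp only [ne_eq, OfNat.ofNat_ne_zero, not_false_eq_true, zero_pow, mul_zero, div_zero,
      add_zero]
    rw [h4]
    have : (0.69 : ℝ) ≤ Real.log N := by linarith
    have h5 : (0.69 : ℝ) ^ 2 ≤ Real.log N ^ 2 := by gcongr
    norm_num at h5 ⊢
    nlinarith
  · have h1 := abs_log_three_mul_le (by linarith) hξN hξ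
    have h2 : Real.log (3 * ξ) ^ 2 ≤ Real.log N ^ 2 := by
      rw [← sq_abs]
      gcongr
    have h3 : 1 / ξ ≤ Real.log N ^ 2 / (ξ * Real.log (3 * ξ) ^ 2) := by
      rw [div_le_div_iff₀ h0 (by positivity)]
      nlinarith
    have : 0 ≤ N * ξ * Real.log N ^ 2 := by positivity
    linarith

/-- Assuming RH, for all sufficiently large `N` (with `L = log N`),
`∫_{−ξ}^{ξ} |S₁(α) − T₁(α)|² dα ≪ Nξ L² + min(L²/(ξ (log 3ξ)²), Nξ L⁴)`, uniformly for
`1/(2N) ≤ ξ ≤ 1/2`. -/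
theorem S1_minus_T1_truncated_L2_RH (hRH : RiemannHypothesis) :
    ∃ C > (0 : ℝ), ∃ N₀ : ℕ, ∀ N : ℕ, N₀ ≤ N → ∀ ξ : ℝ,
      1 / (2 * (N : ℝ)) ≤ ξ → ξ ≤ 1 / 2 →
      (∫ α in (-ξ)..ξ, ‖S1 N α - T1 N α‖ ^ 2) ≤
        C * ((N : ℝ) * ξ * Real.log N ^ 2 +
          min (Real.log N ^ 2 / (ξ * Real.log (3 * ξ) ^ 2)) ((N : ℝ) * ξ * Real.log N ^ 4)) := by
  obtain ⟨C, hC, h⟩ := exists_norm_sum_vonMangoldt_sub_one_sq_le hRH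
  refine ⟨2000 * C, by positivity, 27, ?_⟩
  intro N hN ξ hξN hξ2
  have hNr : (27 : ℝ) ≤ N := by exact_mod_cast hN
  have hξ : 0 < ξ := lt_of_lt_of_le (by positivity) hξN
  have hD := contDiff_S1_sub_T1 N
  obtain ⟨κ, hκ⟩ : ∃ κ : ℝ → ℝ, κ = fun α => smoothCut ξ ξ α * smoothCut ξ ξ (-α) := ⟨_, rfl⟩
  have hκs : ContDiff ℝ ∞ κ := by
    rw [hκ]
    exact (contDiff_smoothCut _ _).mul ((contDiff_smoothCut _ _).comp contDiff_neg)
  have hκ0 : ∀ x, 0 ≤ κ x := fun x => by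
    simp only [hκ]
    exact mul_nonneg (smoothCut_nonneg _ _ _) (smoothCut_nonneg _ _ _)
  have hκ1 : ∀ x, κ x ≤ 1 := fun x => by
    simp only [hκ]
    exact mul_le_one₀ (smoothCut_le_one _ _ _) (smoothCut_nonneg _ _ _) (smoothCut_le_one _ _ _)
  have hκξ : ∀ x ∈ Set.Icc (-ξ) ξ, κ x = 1 := fun x hx => by
    simp only [hκ]
    rw [smoothCut_of_le hξ hx.2, smoothCut_of_le hξ (by linarith [hx.1]), one_mul]
  have hκ2 : ∀ x, x ∉ Set.Ioc (-(2 * ξ)) (2 * ξ) → κ x = 0 := fun x hx => by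
    simp only [hκ]
    rw [Set.mem_Ioc, not_and_or, not_lt, not_le] at hx
    rcases hx with hx | hx
    · rw [smoothCut_of_ge (x := -x) hξ (by linarith), mul_zero]
    · rw [smoothCut_of_ge (x := x) hξ (by linarith), zero_mul]
  have hκc : HasCompactSupport κ := HasCompactSupport.intro
    (isCompact_Icc (a := -(2 * ξ)) (b := 2 * ξ)) fun x hx =>
      hκ2 x fun h => hx (Set.Ioc_subset_Icc_self h)
  obtain ⟨J, hJ⟩ : ∃ J, J = ∫ α, κ α * ‖S1 N α - T1 N α‖ ^ 2 := ⟨_, rfl⟩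
  have hJi : Integrable fun α => κ α * ‖S1 N α - T1 N α‖ ^ 2 :=
    (hκs.continuous.mul (hD.continuous.norm.pow 2)).integrable_of_hasCompactSupport hκc.mul_right
  have hIJ : ∫ α in (-ξ)..ξ, ‖S1 N α - T1 N α‖ ^ 2 ≤ J := by
    rw [hJ]
    refine le_of_eq_of_le ?_ (intervalIntegral_le_integral hJi
      (fun x => mul_nonneg (hκ0 x) (by positivity)) (by linarith : -ξ ≤ ξ))
    refine intervalIntegral.integral_congr fun x hx => ?_
    rw [Set.uIcc_of_le (by linarith)] at hx
    rw [hκξ x hx, one_mul]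
  refine hIJ.trans ?_
  have hG : ContDiff ℝ ∞ fun α : ℝ => (κ α : ℂ) * (S1 N α - T1 N α) :=
    (ofRealCLM.contDiff.comp hκs).mul hD
  have hG0 : ∀ x, x ∉ Set.Ioc (-(2 * ξ)) (2 * ξ) → (κ x : ℂ) * (S1 N x - T1 N x) = 0 :=
    fun x hx => by rw [hκ2 x hx, ofReal_zero, zero_mul]
  have hGJ : ∫ α, ‖(κ α : ℂ) * (S1 N α - T1 N α)‖ ^ 2 ≤ J := by
    rw [hJ]
    refine integral_mono_of_nonneg (Filter.Eventually.of_forall fun x => by positivity) hJi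
      (Filter.Eventually.of_forall fun x => ?_)
    simp only
    rw [norm_mul, norm_real, Real.norm_of_nonneg (hκ0 x), mul_pow]
    refine mul_le_mul_of_nonneg_right ?_ (by positivity)
    nlinarith [hκ0 x, hκ1 x]
  have hF := isBandLimited_fourier hG hξ hG0 hGJ
  obtain ⟨L, hLd⟩ : ∃ L, L = Real.log (N : ℝ) := ⟨_, rfl⟩
  have hmin : N * ξ * L ^ 2 + min (1 / ξ) (N * ξ * L ^ 4) ≤ 2 * (N * ξ * L ^ 2 +
      min (L ^ 2 / (ξ * Real.log (3 * ξ) ^ 2)) (N * ξ * L ^ 4)) := by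
    have h1 := one_div_le_add_log_sq_div hNr hξN hξ2
    rw [← hLd] at h1
    have h2 : 0 ≤ N * ξ * L ^ 2 := by positivity
    have h3 : 0 ≤ L ^ 2 / (ξ * Real.log (3 * ξ) ^ 2) := by positivity
    have h4 : 0 ≤ N * ξ * L ^ 4 := by positivity
    rcases min_cases (L ^ 2 / (ξ * Real.log (3 * ξ) ^ 2)) (N * ξ * L ^ 4) with h | h <;> rw [h.1]
    · linarith [min_le_left (1 / ξ) (N * ξ * L ^ 4)]
    · linarith [min_le_right (1 / ξ) (N * ξ * L ^ 4)]
  have hR0 : 0 ≤ N * ξ * L ^ 2 +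
      min (L ^ 2 / (ξ * Real.log (3 * ξ) ^ 2)) (N * ξ * L ^ 4) := by positivity
  rw [← hLd]
  rcases le_or_gt J 0 with hJ0 | hJ0
  · exact hJ0.trans (by positivity)
  have h1 := h N _ ξ (1000 * J) (by omega) hF hξN hξ2 (by positivity)
  rw [sum_vonMangoldt_sub_one_mul_fourier hκs.continuous hκc, norm_real, ← hJ,
    Real.norm_of_nonneg hJ0.le, ← hLd] at h1
  have h2 : J * J ≤ J * (1000 * C * (N * ξ * L ^ 2 + min (1 / ξ) (N * ξ * L ^ 4))) := by
    linarith
  have h3 := le_of_mul_le_mul_left h2 hJ0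
  calc J ≤ _ := h3
    _ ≤ 1000 * C * (2 * (N * ξ * L ^ 2 +
      min (L ^ 2 / (ξ * Real.log (3 * ξ) ^ 2)) (N * ξ * L ^ 4))) := by gcongr
    _ = _ := by ring
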